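/- arXiv:2101.00779 — 7 statements merged into one kernel-verified Lean document; each statement's English description precedes it below -/
import Mathlib

section
/- Let t ≥ 3, let 2 ≤ ℓ₁ ≤ ℓ₂ ≤ ... ≤ ℓ_t be integers, let k ≥ 1 be an integer, and fix j ∈ {1,...,t}. Define ℓ'_j = ℓ_j and ℓ'_i = ℓ_i − 2k for every i ≠ j, and assume ℓ'_i ≥ 2 for all i. Then p(ℓ'₁,...,ℓ'_t) ≤ max{ℓ'₁, ..., ℓ'_t, s(ℓ₁,...,ℓ_t) − k}. -/
/-- There is a path on `ℓ` vertices in the complete graph on `Fin n`, all of whose edges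
avoid colour `i` under the edge-colouring `c`. -/
def AvoidsPath (n t ℓ : ℕ) (c : Sym2 (Fin n) → Fin t) (i : Fin t) : Prop :=
  ∃ P : Fin ℓ → Fin n, Function.Injective P ∧
    ∀ k : ℕ, ∀ h : k + 1 < ℓ, c s(P ⟨k, Nat.lt_of_succ_lt h⟩, P ⟨k + 1, h⟩) ≠ i

/-- Every `t`-colouring of the edges of `K_n` contains, for some colour `i`,
a path on `L i` vertices avoiding colour `i`. -/
def IsChromRamsey (t : ℕ) (L : Fin t → ℕ) (n : ℕ) : Prop :=
  ∀ c : Sym2 (Fin n) → Fin t, ∃ i : Fin t, AvoidsPath n t (L i) c i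

/-- `p(L)`: the least `n` such that every `t`-colouring of `K_n` contains, for some colour `i`,
a path on `L i` vertices avoiding colour `i`. -/
noncomputable def pRamsey (t : ℕ) (L : Fin t → ℕ) : ℕ := sInf {n | IsChromRamsey t L n}

/-- `s(L) = ⌊(L₁ + 2·L₂ + ⋯ + 2^(t-1)·L_t - 2) / (2^t - 2)⌋`. -/
def sVal (t : ℕ) (L : Fin t → ℕ) : ℕ :=
  ((∑ i : Fin t, 2 ^ (i : ℕ) * L i) - 2) / (2 ^ t - 2)

section ChromaticPaths

open Finset
open scoped Classical

/-- `G` contains a path on `s` vertices. -/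
def SimpleGraph.HasPathOn {V : Type*} (G : SimpleGraph V) (s : ℕ) : Prop :=
  ∃ l : List V, l.Nodup ∧ l.IsChain G.Adj ∧ l.length = s

theorem SimpleGraph.HasPathOn.mono {V : Type*} {G : SimpleGraph V} {s s' : ℕ}
    (h : G.HasPathOn s) (hs : s' ≤ s) : G.HasPathOn s' := by
  obtain ⟨l, h1, h2, h3⟩ := h
  exact ⟨l.take s', h1.sublist (List.take_sublist _ _), h2.take _, by simp; omega⟩

theorem List.countP_cons_add_countP_le {V : Type*} (α β : V → Prop) (x : V) (l : List V)
    (hl : (x :: l).IsChain fun y z => ¬(α y ∧ β z))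
    (hα : ∀ y ∈ (x :: l).getLast?, ¬α y) :
    (x :: l).countP α + l.countP β ≤ l.length := by
  induction l generalizing x with
  | nil => simp_all
  | cons y l ih =>
    rw [List.isChain_cons_cons] at hl
    have := ih y hl.2 (by simpa [List.getLast?_cons_cons] using hα)
    rw [List.countP_cons (a := x), List.countP_cons (a := y) (p := fun z => decide (β z))]
    simp only [decide_eq_true_eq, List.length_cons]
    have h1 := hl.1
    split_ifs <;> first | omega | tauto

theorem List.countP_add_countP_lt {V : Type*} (α β : V → Prop) (l : List V) (hne : l ≠ [])
    (hl : l.IsChain fun y z => ¬(α y ∧ β z))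
    (hα : ∀ y ∈ l.getLast?, ¬α y) (hβ : ∀ y ∈ l.head?, ¬β y) :
    l.countP α + l.countP β + 1 ≤ l.length := by
  cases l with
  | nil => simp at hne
  | cons x l =>
    have := List.countP_cons_add_countP_le α β x l hl hα
    rw [List.countP_cons (p := fun z => decide (β z))]
    simp at hβ
    simp [hβ]
    omega

namespace SimpleGraph

theorem degree_add_degree_of_split {V : Type*} [Fintype V] (G : SimpleGraph V) {u v : V}
    (huv : ¬G.Adj u v) {p q : List V} (hp : p.IsChain G.Adj) (hq : q.IsChain G.Adj)
    (hu : p.getLast? = some u) (hv : q.head? = some v) (hnd : (p ++ q).Nodup)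
    (hG : ¬G.HasPathOn (p.length + q.length)) :
    #{w | G.Adj u w} + #{w | G.Adj v w} + 2 ≤ Fintype.card V := by
  have hvu : ¬G.Adj v u := fun h => huv h.symm
  have key : ∀ l : List V, l.Perm (p ++ q) → ¬ l.IsChain G.Adj := by
    intro l hl hc
    exact hG ⟨l, hl.nodup_iff.2 hnd, hc, by simp [hl.length_eq]⟩
  have hpr : p.reverse.IsChain G.Adj := by
    rw [List.isChain_reverse]; exact hp.imp fun _ _ h => h.symm
  have hqr : q.reverse.IsChain G.Adj := by
    rw [List.isChain_reverse]; exact hq.imp fun _ _ h => h.symm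
  have hpne : p ≠ [] := by rintro rfl; simp at hu
  have hqne : q ≠ [] := by rintro rfl; simp at hv
  have h1 : ∀ y ∈ q.getLast?, ¬G.Adj u y := by
    intro y hy h
    refine key (p ++ q.reverse) ((List.reverse_perm q).append_left p) ?_
    rw [List.isChain_append]
    refine ⟨hp, hqr, ?_⟩
    simp_all
  have h2 : ∀ y ∈ p.head?, ¬G.Adj v y := by
    intro y hy h
    refine key (p.reverse ++ q) ((List.reverse_perm p).append_right q) ?_
    rw [List.isChain_append]
    refine ⟨hpr, hq, ?_⟩
    have := h.symm
    simp_all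
  have h3 : p.IsChain fun y z => ¬(G.Adj u y ∧ G.Adj v z) := by
    rw [List.isChain_iff_forall_rel_of_append_cons_cons]
    rintro y z p1 p2 rfl ⟨h4, h5⟩
    refine key ((p1 ++ [y]) ++ (z :: p2).reverse ++ q) ?_ ?_
    · refine List.Perm.append_right q ?_
      rw [List.append_assoc]
      exact ((List.reverse_perm (z :: p2)).append_left [y]).append_left p1
    · have hp' : ((p1 ++ [y]) ++ (z :: p2)).IsChain G.Adj := by simpa using hp
      have hpr' : ((z :: p2).reverse ++ (p1 ++ [y]).reverse).IsChain G.Adj := by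
        rw [← List.reverse_append]; simpa using hpr
      rw [List.isChain_append] at hp' hpr'
      have hu' : (z :: p2).getLast? = some u := by
        rw [← hu, List.getLast?_append_of_ne_nil _ (by simp), List.getLast?_cons_cons]
      rw [List.isChain_append, List.isChain_append]
      refine ⟨⟨hp'.1, hpr'.1, ?_⟩, hq, ?_⟩
      · intro a ha b hb
        rw [List.head?_reverse, hu'] at hb
        rw [List.getLast?_concat] at ha
        obtain rfl := Option.mem_some_iff.1 ha
        obtain rfl := Option.mem_some_iff.1 hb
        exact h4.symm
      · intro a ha b hb
        rw [hv] at hb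
        rw [List.reverse_cons, ← List.append_assoc, List.getLast?_concat] at ha
        obtain rfl := Option.mem_some_iff.1 ha
        obtain rfl := Option.mem_some_iff.1 hb
        exact h5.symm
  have h4 : q.IsChain fun y z => ¬(G.Adj u y ∧ G.Adj v z) := by
    rw [List.isChain_iff_forall_rel_of_append_cons_cons]
    rintro y z p1 p2 rfl ⟨h4, h5⟩
    refine key (p ++ (p1 ++ [y]).reverse ++ (z :: p2)) ?_ ?_
    · rw [List.append_assoc]
      refine List.Perm.append_left p ?_
      refine ((List.reverse_perm (p1 ++ [y])).append_right _).trans ?_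
      simp
    · have hp' : ((p1 ++ [y]) ++ (z :: p2)).IsChain G.Adj := by simpa using hq
      have hpr' : ((z :: p2).reverse ++ (p1 ++ [y]).reverse).IsChain G.Adj := by
        rw [← List.reverse_append]; simpa using hqr
      rw [List.isChain_append] at hp' hpr'
      have hv' : (p1 ++ [y]).head? = some v := by
        rw [← hv]; simp [List.head?_append]
      have hv'' : (p1 ++ [y]).reverse.getLast? = some v := by rw [List.getLast?_reverse, hv']
      rw [List.isChain_append, List.isChain_append]
      refine ⟨⟨hp, hpr'.2.1, ?_⟩, hp'.2.1, ?_⟩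
      · simp_all
      · rw [List.getLast?_append, hv'']
        simp_all
  have h5 : ∀ w, w ∉ p ++ q → ¬(G.Adj u w ∧ G.Adj v w) := by
    rintro w hw ⟨ha, hb⟩
    refine hG (HasPathOn.mono (s := (p ++ w :: q).length) ⟨p ++ w :: q, ?_, ?_, rfl⟩ (by simp))
    · exact (List.perm_middle.nodup_iff).2 (List.nodup_cons.2 ⟨hw, hnd⟩)
    · rw [List.isChain_append, List.isChain_cons]
      have := hb.symm
      simp_all
  have c1 := List.countP_add_countP_lt (G.Adj u) (G.Adj v) p hpne h3 (by simp [hu]) h2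
  have c2 := List.countP_add_countP_lt (G.Adj u) (G.Adj v) q hqne h4 h1 (by simp [hv])
  have hc : ∀ x : V, #{w ∈ (p ++ q).toFinset | G.Adj x w} = p.countP (G.Adj x) + q.countP (G.Adj x) := by
    intro x
    rw [← List.countP_append, List.countP_eq_length_filter,
      ← List.toFinset_card_of_nodup (hnd.filter _), List.toFinset_filter]
    congr 1
    ext w; simp
  have hL : #(p ++ q).toFinset = p.length + q.length := by
    rw [List.toFinset_card_of_nodup hnd, List.length_append]
  have hs : ∀ x : V, #{w | G.Adj x w} = #{w ∈ (p ++ q).toFinset | G.Adj x w}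
      + #{w ∈ ((p ++ q).toFinset)ᶜ | G.Adj x w} := by
    intro x
    rw [← card_union_of_disjoint]
    · congr 1
      ext w
      simp only [mem_filter, mem_univ, true_and, mem_union, mem_compl]
      tauto
    · exact disjoint_filter_filter disjoint_compl_right
  have ho : #{w ∈ ((p ++ q).toFinset)ᶜ | G.Adj u w} + #{w ∈ ((p ++ q).toFinset)ᶜ | G.Adj v w}
      ≤ #((p ++ q).toFinset)ᶜ := by
    rw [← card_union_of_disjoint]
    · exact card_le_card (union_subset (filter_subset _ _) (filter_subset _ _))
    · rw [Finset.disjoint_left]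
      intro w hw hw'
      simp only [mem_filter, mem_compl, List.mem_toFinset] at hw hw'
      exact h5 w hw.1 ⟨hw.2, hw'.2⟩
  have hcard := card_add_card_compl (p ++ q).toFinset
  have e1 := hs u
  have e2 := hs v
  rw [hc] at e1 e2
  omega

/-- The property of having a path on `s` vertices is stable under the Bondy-Chvátal closure. -/
theorem degree_add_degree_of_sup_edge {V : Type*} [Fintype V] (G : SimpleGraph V) {u v : V}
    (huv : ¬G.Adj u v) {s : ℕ} (hG : ¬G.HasPathOn s)
    (hG' : (G ⊔ edge u v).HasPathOn s) :
    #{w | G.Adj u w} + #{w | G.Adj v w} + 2 ≤ Fintype.card V := by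
  obtain ⟨l, hnd, hc, hl⟩ := hG'
  have hnc : ¬l.IsChain G.Adj := fun h => hG ⟨l, hnd, h, hl⟩
  rw [List.isChain_iff_forall_rel_of_append_cons_cons] at hnc
  push Not at hnc
  obtain ⟨a, b, l1, l2, rfl, hab⟩ := hnc
  have hsplit : ((l1 ++ [a]) ++ (b :: l2)).IsChain (G ⊔ edge u v).Adj := by simpa using hc
  have hnd' : ((l1 ++ [a]) ++ (b :: l2)).Nodup := by simpa using hnd
  rw [List.isChain_append] at hsplit
  have hadj := hsplit.2.2 a (by simp) b (by simp)
  simp only [sup_adj, hab, edge_adj, false_or] at hadj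
  have hp : (l1 ++ [a]).IsChain G.Adj := by
    refine hsplit.1.imp_of_mem_imp ?_
    intro x y hx hy hxy
    have hb : b ∉ l1 ++ [a] := fun h => (List.disjoint_of_nodup_append hnd') h (by simp)
    rw [sup_adj, edge_adj] at hxy
    have : x ≠ b := fun h => hb (h ▸ hx)
    have : y ≠ b := fun h => hb (h ▸ hy)
    grind
  have hq : (b :: l2).IsChain G.Adj := by
    refine hsplit.2.1.imp_of_mem_imp ?_
    intro x y hx hy hxy
    have hb : a ∉ b :: l2 := fun h => (List.disjoint_of_nodup_append hnd') (by simp) h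
    rw [sup_adj, edge_adj] at hxy
    have : x ≠ a := fun h => hb (h ▸ hx)
    have : y ≠ a := fun h => hb (h ▸ hy)
    grind
  have := degree_add_degree_of_split G hab hp hq (by simp) (by simp) hnd'
    (by simp at hl ⊢; rw [← hl] at hG; convert hG using 2; omega)
  rcases hadj.1 with ⟨rfl, rfl⟩ | ⟨rfl, rfl⟩
  · exact this
  · rwa [add_comm #{w | G.Adj b w}]

/-- A graph without a path on `s` vertices lies in one whose non-adjacent vertices have small
degree sum. -/
theorem exists_le_forall_degree_add_degree {V : Type*} [Fintype V] (G : SimpleGraph V) {s : ℕ}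
    (hG : ¬G.HasPathOn s) : ∃ G', G ≤ G' ∧ ¬G'.HasPathOn s ∧ ∀ u v, u ≠ v → ¬G'.Adj u v →
      #{w | G'.Adj u w} + #{w | G'.Adj v w} + 2 ≤ Fintype.card V := by
  obtain ⟨G', hle, hmax⟩ := (Set.toFinite {G : SimpleGraph V | ¬G.HasPathOn s}).exists_le_maximal hG
  refine ⟨G', hle, hmax.prop, fun u v hne huv => ?_⟩
  refine degree_add_degree_of_sup_edge G' huv hmax.prop ?_
  by_contra h
  have := hmax.le_of_ge h le_sup_left
  exact huv (this (by simp [edge_adj, hne]))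

/-- A Chvátal-type degree condition for graphs without a Hamiltonian path. -/
theorem exists_small_degrees {V : Type*} [Fintype V] (G : SimpleGraph V)
    (hG : ¬G.HasPathOn (Fintype.card V)) : ∃ (x : ℕ) (X : Finset V),
      2 * x + 2 ≤ Fintype.card V ∧ #X = x + 1 ∧ ∀ v ∈ X, #{w | G.Adj v w} ≤ x := by
  obtain ⟨G', hle, hG', hdeg⟩ := exists_le_forall_degree_add_degree G hG
  have hne : ({p : V × V | p.1 ≠ p.2 ∧ ¬G'.Adj p.1 p.2} : Finset (V × V)).Nonempty := by
    by_contra h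
    refine hG' ⟨univ.toList, nodup_toList _, ?_, by simp⟩
    have h2 : (univ.toList : List V).IsChain (· ≠ ·) := List.Pairwise.isChain (nodup_toList _)
    refine h2.imp fun a b hab => ?_
    by_contra hc
    exact h ⟨(a, b), by simp [hab, hc]⟩
  obtain ⟨⟨u, v⟩, hmem, hmax⟩ := exists_max_image _
    (fun p : V × V => #{w | G'.Adj p.1 w} + #{w | G'.Adj p.2 w}) hne
  simp only [mem_filter, mem_univ, true_and, and_imp, Prod.forall] at hmem hmax
  obtain ⟨huv, hadj⟩ := hmem
  wlog hlt : #{w | G'.Adj u w} ≤ #{w | G'.Adj v w} generalizing u v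
  · refine this v u ?_ huv.symm (fun h => hadj h.symm) (by omega)
    intro a b h1 h2
    have := hmax a b h1 h2
    omega
  have hd := hdeg u v huv hadj
  have hcard : #{w | w ≠ v ∧ ¬G'.Adj v w} + #{w | G'.Adj v w} + 1 = Fintype.card V := by
    have h1 : insert v ({w | G'.Adj v w} : Finset V)ᶜᶜ = ({w | w ≠ v ∧ ¬G'.Adj v w} : Finset V)ᶜ := by
      ext w
      simp
      tauto
    have h2 := card_add_card_compl ({w | w ≠ v ∧ ¬G'.Adj v w} : Finset V)
    rw [← h1, compl_compl, card_insert_of_notMem (by simp)] at h2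
    omega
  obtain ⟨X, hX, hXc⟩ := exists_subset_card_eq
    (s := ({w | w ≠ v ∧ ¬G'.Adj v w} : Finset V)) (n := #{w | G'.Adj u w} + 1) (by omega)
  refine ⟨#{w | G'.Adj u w}, X, by omega, hXc, fun w hw => ?_⟩
  have hw' := hX hw
  simp only [mem_filter, mem_univ, true_and] at hw'
  have h1 := hmax w v hw'.1 (fun h => hw'.2 h.symm)
  have h2 : #{z | G.Adj w z} ≤ #{z | G'.Adj w z} :=
    card_le_card (monotone_filter_right _ fun z _ hz => hle hz)
  omega

theorem exists_small_degrees_on {V : Type*} (G : SimpleGraph V) (U : Finset V)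
    (hG : ¬G.HasPathOn #U) : ∃ (x : ℕ) (X : Finset V), X ⊆ U ∧
      2 * x + 2 ≤ #U ∧ #X = x + 1 ∧ ∀ v ∈ X, #{w ∈ U | G.Adj v w} ≤ x := by
  obtain ⟨x, X, h1, h2, h3⟩ := exists_small_degrees (G.comap (Subtype.val : U → V)) (by
    rintro ⟨l, hl1, hl2, hl3⟩
    refine hG ⟨l.map Subtype.val, hl1.map Subtype.val_injective, ?_, by simpa using hl3⟩
    rw [List.isChain_map]
    exact hl2)
  refine ⟨x, X.map (Function.Embedding.subtype _), ?_, by simpa using h1, by simpa using h2, ?_⟩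
  · intro v hv
    simp only [mem_map, Function.Embedding.subtype_apply] at hv
    obtain ⟨a, -, rfl⟩ := hv
    exact a.2
  · intro v hv
    simp only [mem_map, Function.Embedding.subtype_apply] at hv
    obtain ⟨a, ha, rfl⟩ := hv
    refine le_trans (le_of_eq ?_) (h3 a ha)
    rw [← card_map (Function.Embedding.subtype _)]
    congr 1
    ext w
    simp [and_comm]

end SimpleGraph

theorem Finset.exists_subset_card_eq_forall_le {V : Type*} (f : V → ℕ) (H : Finset V) {r : ℕ}
    (hr : r ≤ #H) : ∃ H' ⊆ H, #H' = r ∧ ∀ u ∈ H, u ∉ H' → ∀ v ∈ H', f u ≤ f v := by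
  induction r with
  | zero => exact ⟨∅, by simp, by simp, by simp⟩
  | succ r ih =>
    obtain ⟨H', hs, hc, hf⟩ := ih (by omega)
    have hne : (H \ H').Nonempty := by
      rw [← card_pos, card_sdiff_of_subset hs]
      omega
    obtain ⟨m, hm, hmax⟩ := exists_max_image (H \ H') f hne
    rw [mem_sdiff] at hm
    refine ⟨insert m H', insert_subset hm.1 hs, by rw [card_insert_of_notMem hm.2, hc], ?_⟩
    intro u hu hu' v hv
    rw [mem_insert, not_or] at hu'
    rcases mem_insert.1 hv with rfl | hv
    · exact hmax u (mem_sdiff.2 ⟨hu, hu'.2⟩)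
    · exact hf u hu hu'.2 v hv

namespace SimpleGraph

/-- A graph which is a clique outside `H` and has no path missing fewer than `D` vertices contains
many vertices in `H` sending few edges to the clique. -/
theorem exists_small_degrees_compl {V : Type*} [Fintype V] (G : SimpleGraph V) (H : Finset V)
    (hH : ∀ u ∉ H, ∀ v ∉ H, u ≠ v → G.Adj u v) {s D : ℕ} (hs : s ≤ Fintype.card V)
    (hsD : s + D = Fintype.card V + 1) (hG : ¬G.HasPathOn s) :
    ∃ (x : ℕ) (A : Finset V), A ⊆ H ∧ #A = x + D ∧ x + #A < Fintype.card V ∧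
      ∀ v ∈ A, #{w ∈ Hᶜ | G.Adj v w} ≤ x := by
  have hcard := card_add_card_compl H
  have hws : #Hᶜ < s := by
    by_contra! h
    refine hG (HasPathOn.mono (s := #Hᶜ) ⟨Hᶜ.toList, nodup_toList _, ?_, by simp⟩ h)
    have h2 : (Hᶜ.toList).IsChain (· ≠ ·) := List.Pairwise.isChain (nodup_toList _)
    refine h2.imp_of_mem_imp fun a b ha hb hab => hH a ?_ b ?_ hab
    · simpa using ha
    · simpa using hb
  by_cases hbig : #Hᶜ + D < #H
  · obtain ⟨A, hA, hAc⟩ := exists_subset_card_eq hbig.le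
    exact ⟨#Hᶜ, A, hA, hAc, by omega, fun v _ => card_le_card (filter_subset _ _)⟩
  obtain ⟨H', hs', hc', hf⟩ := exists_subset_card_eq_forall_le
    (fun v => #{w ∈ Hᶜ | G.Adj v w}) H (r := s - #Hᶜ) (by omega)
  have hdisj : Disjoint Hᶜ H' := (disjoint_compl_left).mono_right hs'
  have hU : #(Hᶜ ∪ H') = s := by
    rw [card_union_of_disjoint hdisj]
    omega
  obtain ⟨x, X, hXU, hx, hXc, hX⟩ := exists_small_degrees_on G (Hᶜ ∪ H') (by rwa [hU])
  have hdegW : ∀ v ∈ X, #{w ∈ Hᶜ | G.Adj v w} ≤ x := fun v hv =>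
    (card_le_card (filter_subset_filter _ subset_union_left)).trans (hX v hv)
  by_cases hXH : X ⊆ H'
  · refine ⟨x, X ∪ (H \ H'), union_subset (hXH.trans hs') sdiff_subset, ?_, ?_, ?_⟩
    · rw [card_union_of_disjoint (disjoint_sdiff.mono_left hXH), card_sdiff_of_subset hs']
      omega
    · rw [card_union_of_disjoint (disjoint_sdiff.mono_left hXH), card_sdiff_of_subset hs']
      omega
    · intro v hv
      rcases mem_union.1 hv with hv | hv
      · exact hdegW v hv
      · rw [mem_sdiff] at hv
        obtain ⟨v', hv'⟩ : X.Nonempty := by rw [← card_pos]; omega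
        exact (hf v hv.1 hv.2 v' (hXH hv')).trans (hdegW v' hv')
  · obtain ⟨w₀, hw₀, hw₀'⟩ := not_subset.1 hXH
    have hw₀W : w₀ ∈ Hᶜ := (mem_union.1 (hXU hw₀)).resolve_right hw₀'
    have hwpos : 0 < #Hᶜ := card_pos.2 ⟨w₀, hw₀W⟩
    have hsub : Hᶜ.erase w₀ ∪ {w ∈ H' | G.Adj w₀ w} ⊆ {w ∈ Hᶜ ∪ H' | G.Adj w₀ w} := by
      intro w hw
      simp only [mem_union, mem_erase, mem_filter, mem_compl] at hw hw₀W ⊢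
      rcases hw with hw | hw
      · exact ⟨Or.inl hw.2, hH _ hw₀W _ hw.2 (Ne.symm hw.1)⟩
      · exact ⟨Or.inr hw.1, hw.2⟩
    have hle := (card_le_card hsub).trans (hX w₀ hw₀)
    rw [card_union_of_disjoint (hdisj.mono (erase_subset _ _) (filter_subset _ _)),
      card_erase_of_mem hw₀W] at hle
    rw [hU] at hx
    have hno : #{w ∈ H' | G.Adj w₀ w} = 0 := by omega
    rw [card_eq_zero, filter_eq_empty_iff] at hno
    have hsmall' : ∀ v ∈ H', #{w ∈ Hᶜ | G.Adj v w} ≤ x := by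
      intro v hv
      have : #{w ∈ Hᶜ | G.Adj v w} ≤ #(Hᶜ.erase w₀) := by
        refine card_le_card fun w hw => ?_
        rw [mem_filter] at hw
        refine mem_erase.2 ⟨?_, hw.1⟩
        rintro rfl
        exact hno hv hw.2.symm
      rw [card_erase_of_mem hw₀W] at this
      omega
    have hsmall : ∀ v ∈ H, #{w ∈ Hᶜ | G.Adj v w} ≤ x := by
      intro v hv
      by_cases hv' : v ∈ H'
      · exact hsmall' v hv'
      · obtain ⟨v', hv''⟩ : H'.Nonempty := by rw [← card_pos]; omega
        exact (hf v hv hv' v' hv'').trans (hsmall' v' hv'')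
    obtain ⟨A, hA, hAc⟩ := exists_subset_card_eq (s := H) (n := x + D) (by omega)
    exact ⟨x, A, hA, hAc, by omega, fun v hv => hsmall v (hA hv)⟩

end SimpleGraph

/-- For sorted positive `a`, an averaged bound on the partial sums of `a` by `x` gives a bound on the
differences `a i - x i`, weighted by powers of two. -/
theorem sum_two_pow_mul_sub_lt_of_monotone {t : ℕ} (ht : 0 < t) {n : ℤ} {a x : ℕ → ℤ}
    (ha : Monotone a) (hpos : ∀ i, 0 < a i)
    (hT : ∀ m ≤ t, 0 ≤ ∑ i ∈ range m, a i * (x i - ∑ j ∈ range i, a j))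
    (hlt : ∀ i < t, x i + a i < n) (hn : ∑ i ∈ range t, a i ≤ n) :
    ∑ i ∈ range t, 2 ^ (t - 1 - i) * (a i - x i) < n := by
  have hY : ∀ m ≤ t, 0 ≤ ∑ i ∈ range m, (x i - ∑ j ∈ range i, a j) ∧
      ∑ i ∈ range m, a i * (x i - ∑ j ∈ range i, a j) ≤
        a m * ∑ i ∈ range m, (x i - ∑ j ∈ range i, a j) := by
    intro m
    induction m with
    | zero => simp
    | succ m ih =>
      intro hm
      obtain ⟨-, ih⟩ := ih (by omega)
      have h0 := hT (m + 1) hm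
      rw [sum_range_succ] at h0 ⊢
      rw [sum_range_succ (fun i => a i * _)]
      set Y := ∑ i ∈ range m, (x i - ∑ j ∈ range i, a j)
      set y := x m - ∑ j ∈ range m, a j
      have h1 : 0 ≤ a m * (Y + y) := by linarith [mul_add (a m) Y y]
      have h2 : 0 ≤ Y + y := nonneg_of_mul_nonneg_right h1 (hpos m)
      refine ⟨h2, ?_⟩
      have h3 := mul_le_mul_of_nonneg_right (ha (Nat.le_succ m)) h2
      linarith [mul_add (a m) Y y]
  have hstep : ∀ (f : ℕ → ℤ) (m : ℕ), ∑ i ∈ range (m + 1), 2 ^ (m - i) * f i =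
      2 * ∑ i ∈ range m, 2 ^ (m - 1 - i) * f i + f m := by
    intro f m
    rw [sum_range_succ, mul_sum]
    congr 1
    · refine sum_congr rfl fun i hi => ?_
      rw [mem_range] at hi
      rw [← mul_assoc, ← pow_succ']
      congr 2
      omega
    · simp
  have hZ : ∀ m ≤ t, ∑ i ∈ range m, (x i - ∑ j ∈ range i, a j) ≤
      ∑ i ∈ range m, 2 ^ (m - 1 - i) * (x i - ∑ j ∈ range i, a j) := by
    intro m
    induction m with
    | zero => simp
    | succ m ih =>
      intro hm
      have h1 := (hY m (by omega)).1
      have h2 := ih (by omega)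
      rw [Nat.add_sub_cancel, hstep, sum_range_succ]
      linarith
  have hS : ∀ m, ∑ i ∈ range m, 2 ^ (m - 1 - i) * (a i - ∑ j ∈ range i, a j) =
      ∑ i ∈ range m, a i := by
    intro m
    induction m with
    | zero => simp
    | succ m ih =>
      rw [Nat.add_sub_cancel, hstep, ih, sum_range_succ]
      ring
  have hD : ∑ i ∈ range t, 2 ^ (t - 1 - i) * (a i - x i) = ∑ i ∈ range t, a i -
      ∑ i ∈ range t, 2 ^ (t - 1 - i) * (x i - ∑ j ∈ range i, a j) := by
    rw [← hS, ← sum_sub_distrib]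
    exact sum_congr rfl fun i _ => by ring
  rw [hD]
  obtain ⟨m, rfl⟩ : ∃ m, t = m + 1 := ⟨t - 1, by omega⟩
  have h1 := hZ m (by omega)
  have h2 := (hY m (by omega)).1
  have h3 := (hY (m + 1) le_rfl).1
  have h4 := hlt m (by omega)
  rw [Nat.add_sub_cancel, hstep]
  rw [sum_range_succ] at h3 hn ⊢
  omega

theorem exists_perm_sum_two_pow_mul_sub_lt {t : ℕ} (ht : 0 < t) {n : ℕ} {a x : Fin t → ℕ}
    {e : Fin t → Fin t → ℕ} (hpos : ∀ i, 0 < a i)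
    (he : ∀ i j, i ≠ j → a i * a j ≤ e i j + e j i) (hx : ∀ i, ∑ j, e i j ≤ a i * x i)
    (hlt : ∀ i, x i + a i < n) (hn : ∑ i, a i ≤ n) :
    ∃ τ : Equiv.Perm (Fin t), ∑ i, 2 ^ (τ i : ℕ) * ((a i : ℤ) - x i) < n := by
  set σ := Tuple.sort a
  let ε : ℕ → Fin t := fun m => σ ⟨min m (t - 1), by omega⟩
  have hε : ∀ i : Fin t, ε i = σ i := fun i => by
    have := i.2
    simp only [ε]
    congr 2
    omega
  have hinj : ∀ i < t, ∀ j < t, i ≠ j → ε i ≠ ε j := by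
    intro i hi j hj hij h
    have := σ.injective h
    simp only [Fin.mk.injEq] at this
    omega
  have hsum : ∀ f : Fin t → ℤ, ∑ i ∈ range t, f (ε i) = ∑ i, f i := by
    intro f
    rw [sum_range, ← Equiv.sum_comp σ f]
    simp [hε]
  have hmain : ∀ m ≤ t, 0 ≤ ∑ i ∈ range m,
      (a (ε i) : ℤ) * (x (ε i) - ∑ j ∈ range i, (a (ε j) : ℤ)) := by
    intro m hm
    have h1 : ∀ m ≤ t, ∑ i ∈ range m, a (ε i) * ∑ j ∈ range i, a (ε j) ≤
        ∑ i ∈ range m, ∑ j ∈ range m, e (ε i) (ε j) := by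
      intro m
      induction m with
      | zero => simp
      | succ m ih =>
        intro hm
        have h2 : a (ε m) * ∑ j ∈ range m, a (ε j) ≤
            ∑ j ∈ range m, e (ε m) (ε j) + ∑ j ∈ range m, e (ε j) (ε m) := by
          rw [mul_sum, ← sum_add_distrib]
          refine sum_le_sum fun i hi => he _ _ (hinj _ (by omega) _ ?_ ?_) <;>
            · rw [mem_range] at hi
              omega
        have h3 := ih (by omega)
        simp only [sum_range_succ, sum_add_distrib]
        omega
    have h2 : ∑ i ∈ range m, ∑ j ∈ range m, e (ε i) (ε j) ≤
        ∑ i ∈ range m, a (ε i) * x (ε i) := by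
      refine sum_le_sum fun i _ => le_trans ?_ (hx (ε i))
      have h3 := hsum fun j => (e (ε i) j : ℤ)
      have h4 : ∑ j ∈ range t, e (ε i) (ε j) = ∑ j, e (ε i) j := by exact_mod_cast h3
      rw [← h4]
      exact sum_le_sum_of_subset (range_subset_range.2 hm)
    have h3 : ((∑ i ∈ range m, a (ε i) * ∑ j ∈ range i, a (ε j) : ℕ) : ℤ) ≤
        (∑ i ∈ range m, a (ε i) * x (ε i) : ℕ) := by exact_mod_cast (h1 m hm).trans h2
    push_cast at h3
    simp only [mul_sub, sum_sub_distrib]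
    linarith
  have key := sum_two_pow_mul_sub_lt_of_monotone ht (n := n) (a := fun m => (a (ε m) : ℤ))
    (x := fun m => (x (ε m) : ℤ))
    (fun i j hij => by
      have : Monotone (a ∘ σ) := Tuple.monotone_sort a
      have h : (⟨min i (t - 1), by omega⟩ : Fin t) ≤ ⟨min j (t - 1), by omega⟩ :=
        Fin.mk_le_mk.2 (min_le_min_right _ hij)
      exact Int.ofNat_le.2 (this h))
    (fun i => by exact_mod_cast hpos _) hmain (fun i _ => by exact_mod_cast hlt _)
    (by
      rw [hsum fun i => (a i : ℤ)]
      exact_mod_cast hn)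
  refine ⟨σ.symm.trans Fin.revPerm, lt_of_eq_of_lt ?_ key⟩
  rw [sum_range, ← Equiv.sum_comp σ]
  refine sum_congr rfl fun i _ => ?_
  simp only [Equiv.trans_apply, Equiv.symm_apply_apply, Fin.revPerm_apply, Fin.val_rev, hε]
  congr 2
  omega

/-- The graph of the edges which do not receive colour `i`. -/
def SimpleGraph.avoiding {V κ : Type*} (c : Sym2 V → κ) (i : κ) : SimpleGraph V where
  Adj u v := u ≠ v ∧ c s(u, v) ≠ i
  symm := ⟨fun u v h => ⟨h.1.symm, by rw [Sym2.eq_swap]; exact h.2⟩⟩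
  loopless := ⟨fun _ h => h.1 rfl⟩

theorem AvoidsPath.of_hasPathOn {n t s : ℕ} {c : Sym2 (Fin n) → Fin t} {i : Fin t}
    (h : (SimpleGraph.avoiding c i).HasPathOn s) : AvoidsPath n t s c i := by
  obtain ⟨l, hnd, hch, rfl⟩ := h
  refine ⟨l.get, List.nodup_iff_injective_get.1 hnd, fun k hk => ?_⟩
  exact (List.isChain_iff_getElem.1 hch k hk).2

theorem exists_perm_sum_two_pow_mul_lt_card {V : Type*} [Fintype V] {t : ℕ} (ht : 0 < t)
    {c : Sym2 V → Fin t} {L : Fin t → ℕ} (hL : ∀ i, L i ≤ Fintype.card V)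
    (hc : ∀ i, ¬(SimpleGraph.avoiding c i).HasPathOn (L i)) :
    ∃ τ : Equiv.Perm (Fin t),
      ∑ i, 2 ^ (τ i : ℕ) * ((Fintype.card V : ℤ) + 1 - L i) < Fintype.card V := by
  choose G hG hGL hdeg using fun i =>
    SimpleGraph.exists_le_forall_degree_add_degree _ (hc i)
  have hadj : ∀ i j, i ≠ j → ∀ u v, u ≠ v → (G i).Adj u v ∨ (G j).Adj u v := by
    intro i j hij u v huv
    by_cases h : c s(u, v) = i
    · exact Or.inr (hG j ⟨huv, fun h' => hij (h.symm.trans h')⟩)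
    · exact Or.inl (hG i ⟨huv, h⟩)
  let H : Fin t → Finset V := fun i => {v | 2 * #{w | (G i).Adj v w} + 2 ≤ Fintype.card V}
  have hH : ∀ i, ∀ u ∉ H i, ∀ v ∉ H i, u ≠ v → (G i).Adj u v := by
    intro i u hu v hv huv
    by_contra h
    have := hdeg i u v huv h
    simp only [H, mem_filter, mem_univ, true_and] at hu hv
    omega
  have hdisj : ∀ i j, i ≠ j → Disjoint (H i) (H j) := by
    intro i j hij
    rw [disjoint_left]
    intro v hi hj
    simp only [H, mem_filter, mem_univ, true_and] at hi hj
    have h1 : univ.erase v ⊆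
        ({w | (G i).Adj v w} : Finset V) ∪ ({w | (G j).Adj v w} : Finset V) := by
      intro w hw
      simpa using hadj i j hij v w (ne_of_mem_erase hw).symm
    have h2 := (card_le_card h1).trans (card_union_le _ _)
    rw [card_erase_of_mem (mem_univ v), card_univ] at h2
    omega
  choose x A hAH hA hlt hdegA using fun i =>
    (G i).exists_small_degrees_compl (H i) (hH i) (s := L i) (D := Fintype.card V + 1 - L i)
      (hL i) (by have := hL i; omega) (hGL i)
  have hAd : ∀ i j, i ≠ j → Disjoint (A i) (A j) := fun i j hij =>
    (hdisj i j hij).mono (hAH i) (hAH j)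
  let e : Fin t → Fin t → ℕ := fun i j =>
    if i = j then 0 else ∑ u ∈ A i, #{v ∈ A j | (G i).Adj u v}
  obtain ⟨τ, hτ⟩ := exists_perm_sum_two_pow_mul_sub_lt ht (n := Fintype.card V)
    (a := fun i => #(A i)) (x := x) (e := e)
    (fun i => by have := hL i; simp only [hA]; omega)
    (by
      intro i j hij
      simp only [e, if_neg hij, if_neg hij.symm]
      have h1 : ∑ v ∈ A j, #{u ∈ A i | (G j).Adj v u} =
          ∑ u ∈ A i, #{v ∈ A j | (G j).Adj u v} := by
        refine (sum_card_bipartiteAbove_eq_sum_card_bipartiteBelow (G j).Adj).trans ?_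
        exact sum_congr rfl fun u _ => congrArg card (filter_congr fun v _ => (G j).adj_comm v u)
      rw [h1, ← sum_add_distrib, ← smul_eq_mul, ← sum_const]
      refine sum_le_sum fun u hu => le_trans (card_le_card fun v hv => ?_) (card_union_le _ _)
      have huv : u ≠ v := fun h => disjoint_left.1 (hAd i j hij) hu (h ▸ hv)
      simpa [hv] using hadj i j hij u v huv)
    (by
      intro i
      have h1 : ∑ j, e i j = ∑ u ∈ A i, ∑ j ∈ univ.erase i, #{v ∈ A j | (G i).Adj u v} := by
        rw [sum_comm, ← add_sum_erase univ _ (mem_univ i)]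
        simp only [e, if_true, zero_add]
        exact sum_congr rfl fun j hj => if_neg (ne_of_mem_erase hj).symm
      rw [h1, ← smul_eq_mul, ← sum_const]
      refine sum_le_sum fun u hu => le_trans ?_ (hdegA i u hu)
      rw [← card_biUnion fun j _ k _ hjk =>
        (hAd j k hjk).mono (filter_subset _ _) (filter_subset _ _)]
      refine card_le_card fun v hv => ?_
      obtain ⟨j, hj, hv⟩ := mem_biUnion.1 hv
      rw [mem_filter] at hv ⊢
      refine ⟨mem_compl.2 fun h => ?_, hv.2⟩
      exact disjoint_left.1 (hdisj _ _ (ne_of_mem_erase hj)) (hAH j hv.1) h)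
    hlt
    (by
      rw [← card_biUnion fun i _ j _ hij => hAd i j hij]
      exact card_le_univ _)
  refine ⟨τ, lt_of_eq_of_lt (sum_congr rfl fun i _ => ?_) hτ⟩
  have := hL i
  have := hA i
  congr 1
  omega

theorem lt_sVal_sub {t : ℕ} (ht : 3 ≤ t) {ℓ ℓ' : Fin t → ℕ} (hmono : Monotone ℓ) {k n : ℕ}
    {j : Fin t} (hℓ' : ∀ i, ℓ' i = if i = j then ℓ i else ℓ i - 2 * k) (h2' : ∀ i, 2 ≤ ℓ' i)
    (τ : Equiv.Perm (Fin t)) (hτ : ∑ i, 2 ^ (τ i : ℕ) * ((n : ℤ) + 1 - ℓ' i) < n) :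
    n < sVal t ℓ - k := by
  have hgeom : ∑ i : Fin t, (2 : ℤ) ^ (i : ℕ) = 2 ^ t - 1 := by
    rw [← sum_range fun i => (2 : ℤ) ^ i]
    linarith [mul_geom_sum (2 : ℤ) t]
  have hpow : ∑ i, (2 : ℤ) ^ (τ i : ℕ) = 2 ^ t - 1 := by
    rw [← hgeom]
    exact Equiv.sum_comp τ fun i => (2 : ℤ) ^ (i : ℕ)
  have hrearr : ∑ i, (2 : ℤ) ^ (τ i : ℕ) * ℓ i ≤ ∑ i : Fin t, 2 ^ (i : ℕ) * (ℓ i : ℤ) := by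
    refine Monovary.sum_comp_perm_mul_le_sum_mul (f := fun i : Fin t => (2 : ℤ) ^ (i : ℕ))
      (g := fun i => (ℓ i : ℤ)) (Monotone.monovary ?_ ?_)
    · exact fun i i' h => pow_le_pow_right₀ (by norm_num) h
    · exact fun i i' h => Int.ofNat_le.2 (hmono h)
  have hcast : ∀ i, (ℓ' i : ℤ) = ℓ i - 2 * k + if i = j then 2 * (k : ℤ) else 0 := by
    intro i
    have := hℓ' i
    have := h2' i
    split_ifs at * <;> omega
  have hsum : ∑ i, (2 : ℤ) ^ (τ i : ℕ) * ((n : ℤ) + 1 - ℓ' i) =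
      (n + 1 + 2 * k) * (2 ^ t - 1) - ∑ i, (2 : ℤ) ^ (τ i : ℕ) * ℓ i -
        2 ^ (τ j : ℕ) * (2 * k) := by
    have : ∀ i, (2 : ℤ) ^ (τ i : ℕ) * ((n : ℤ) + 1 - ℓ' i) =
        (n + 1 + 2 * k) * 2 ^ (τ i : ℕ) - 2 ^ (τ i : ℕ) * ℓ i -
          if i = j then (2 : ℤ) ^ (τ i : ℕ) * (2 * k) else 0 := by
      intro i
      rw [hcast]
      split_ifs <;> ring
    simp only [this, sum_sub_distrib, ← mul_sum, hpow]
    simp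
  obtain ⟨m, rfl⟩ : ∃ m, t = m + 1 := ⟨t - 1, by omega⟩
  have hτj : (2 : ℤ) ^ (τ j : ℕ) * (2 * k) ≤ 2 ^ m * (2 * k) := by
    have : (τ j : ℕ) ≤ m := by omega
    gcongr
    norm_num
  have hbig : ((n : ℤ) + k + 1) * (2 ^ (m + 1) - 2) + 2 ≤
      ∑ i : Fin (m + 1), 2 ^ (i : ℕ) * (ℓ i : ℤ) := by
    rw [hsum] at hτ
    have := pow_succ (2 : ℤ) m
    nlinarith
  have h4 : 4 ≤ 2 ^ (m + 1) := by
    calc 4 = 2 ^ 2 := rfl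
      _ ≤ 2 ^ (m + 1) := Nat.pow_le_pow_right (by norm_num) (by omega)
  have hnat : (n + k + 1) * (2 ^ (m + 1) - 2) + 2 ≤
      ∑ i : Fin (m + 1), 2 ^ (i : ℕ) * ℓ i := by
    zify [show 2 ≤ 2 ^ (m + 1) by omega]
    exact hbig
  have : n + k + 1 ≤ sVal (m + 1) ℓ := by
    rw [sVal, Nat.le_div_iff_mul_le (by omega)]
    omega
  omega

end ChromaticPaths

/-- Claim 2: with `ℓ'_j = ℓ_j` and `ℓ'_i = ℓ_i - 2k` for `i ≠ j`, all at least `2`, we have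
`p(ℓ'₁,…,ℓ'_t) ≤ max{ℓ'₁, …, ℓ'_t, s(ℓ₁,…,ℓ_t) - k}`. -/
theorem pRamsey_shrunk_le (t : ℕ) (ht : 3 ≤ t) (ℓ : Fin t → ℕ)
    (hmono : Monotone ℓ) (h2 : 2 ≤ ℓ ⟨0, by omega⟩)
    (k : ℕ) (hk : 1 ≤ k) (j : Fin t)
    (ℓ' : Fin t → ℕ) (hℓ' : ∀ i, ℓ' i = if i = j then ℓ i else ℓ i - 2 * k)
    (h2' : ∀ i, 2 ≤ ℓ' i) :
    pRamsey t ℓ' ≤ max (Finset.univ.sup ℓ') (sVal t ℓ - k) := by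
  refine Nat.sInf_le fun c => ?_
  by_contra! hc
  obtain ⟨τ, hτ⟩ := exists_perm_sum_two_pow_mul_lt_card (by omega) (c := c) (L := ℓ')
    (fun i => by
      rw [Fintype.card_fin]
      exact (Finset.le_sup (Finset.mem_univ i)).trans (le_max_left _ _))
    (fun i h => hc i (.of_hasPathOn h))
  rw [Fintype.card_fin] at hτ
  exact (lt_sVal_sub ht hmono hℓ' h2' τ hτ).not_ge (le_max_right _ _)
end

section
/- Let t ≥ 3, let 2 ≤ ℓ₁ ≤ ℓ₂ ≤ ... ≤ ℓ_t be integers, let k ≥ 1 be an integer, and fix j ∈ {1,...,t}. Define ℓ'_j = ℓ_j and ℓ'_i = ℓ_i − 2k for every i ≠ j, assume ℓ'_i ≥ 2 for all i, and let ℓ''₁ ≤ ℓ''₂ ≤ ... ≤ ℓ''_t be the nondecreasing rearrangement of ℓ'₁,...,ℓ'_t. Then s(ℓ''₁,...,ℓ''_t) ≤ s(ℓ₁,...,ℓ_t) − k. -/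
/-- Decreasing all but one entry of a monotone tuple by `2 * k` and permuting the result lowers
the sum with weights `2 ^ i` by at least `(2 ^ t - 2) * k`. -/
theorem sum_two_pow_mul_rearranged_add_le {t : ℕ} {ℓ ℓ' : Fin t → ℕ} (hmono : Monotone ℓ)
    {k : ℕ} {j : Fin t} (hℓ' : ∀ i, ℓ' i + 2 * k = ℓ i + if i = j then 2 * k else 0)
    (σ : Equiv.Perm (Fin t)) :
    ∑ i : Fin t, 2 ^ (i : ℕ) * ℓ' (σ i) + (2 ^ t - 2) * k ≤ ∑ i : Fin t, 2 ^ (i : ℕ) * ℓ i := by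
  have hpow : Monotone fun i : Fin t ↦ 2 ^ (i : ℕ) := fun a b hab ↦
    Nat.pow_le_pow_right two_pos hab
  have hrearr : ∑ i : Fin t, 2 ^ (i : ℕ) * ℓ (σ i) ≤ ∑ i : Fin t, 2 ^ (i : ℕ) * ℓ i :=
    (hpow.monovary hmono).sum_mul_comp_perm_le_sum_mul
  have hgeom : ∑ i : Fin t, 2 ^ (i : ℕ) + 1 = 2 ^ t := by
    rw [Fin.sum_univ_eq_sum_range (fun i ↦ 2 ^ i), Nat.geomSum_eq le_rfl, Nat.div_one]
    exact Nat.sub_add_cancel Nat.one_le_two_pow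
  have hsum : ∑ i : Fin t, 2 ^ (i : ℕ) * ℓ' (σ i) + (∑ i : Fin t, 2 ^ (i : ℕ)) * (2 * k) =
      ∑ i : Fin t, 2 ^ (i : ℕ) * ℓ (σ i) + 2 ^ (σ.symm j : ℕ) * (2 * k) := by
    rw [Finset.sum_mul, ← Finset.sum_add_distrib]
    simp only [← mul_add, hℓ']
    simp only [mul_add, Finset.sum_add_distrib, ← Equiv.eq_symm_apply, mul_ite, mul_zero,
      Finset.sum_ite_eq', Finset.mem_univ, if_true]
  have htop : 2 * 2 ^ (σ.symm j : ℕ) ≤ 2 ^ t := by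
    rw [← pow_succ']
    exact Nat.pow_le_pow_right two_pos (σ.symm j).isLt
  obtain ⟨d, hd⟩ : ∃ d, 2 ^ t = d + 2 :=
    Nat.exists_eq_add_of_le' <| by have := Nat.one_le_two_pow (n := (σ.symm j : ℕ)); omega
  rw [hd, Nat.add_sub_cancel]
  rw [hd] at hgeom htop
  nlinarith [Nat.mul_le_mul_right k htop, congrArg (· * k) hgeom]

/-- Claim 2 (arithmetic part): with `ℓ'_j = ℓ_j` and `ℓ'_i = ℓ_i - 2k` for `i ≠ j`, all at
least `2`, and `ℓ''` the nondecreasing rearrangement of `ℓ'`, we have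
`s(ℓ''₁,…,ℓ''_t) ≤ s(ℓ₁,…,ℓ_t) - k`. -/
theorem sVal_rearranged_le (t : ℕ) (ht : 3 ≤ t) (ℓ : Fin t → ℕ)
    (hmono : Monotone ℓ) (h2 : 2 ≤ ℓ ⟨0, by omega⟩)
    (k : ℕ) (hk : 1 ≤ k) (j : Fin t)
    (ℓ' : Fin t → ℕ) (hℓ' : ∀ i, ℓ' i = if i = j then ℓ i else ℓ i - 2 * k)
    (h2' : ∀ i, 2 ≤ ℓ' i)
    (ℓ'' : Fin t → ℕ) (hmono'' : Monotone ℓ'')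
    (σ : Equiv.Perm (Fin t)) (hσ : ∀ i, ℓ'' i = ℓ' (σ i)) :
    sVal t ℓ'' ≤ sVal t ℓ - k := by
  have hshift : ∀ i, ℓ' i + 2 * k = ℓ i + if i = j then 2 * k else 0 := fun i ↦ by
    have := h2' i
    have := hℓ' i
    split_ifs at * <;> omega
  have hle := sum_two_pow_mul_rearranged_add_le hmono hshift σ
  simp only [sVal, hσ]
  rw [← Nat.sub_mul_div]
  exact Nat.div_le_div_right (by omega)
end

section
/- Let t ≥ 3, let q ≥ 1 be an integer, let 2q + 2 ≤ ℓ₁ ≤ ℓ₂ ≤ ... ≤ ℓ_t be integers, fix j ∈ {1,...,t}, and assume s(ℓ₁,...,ℓ_t) = q + ℓ_j − 1. Then p(ℓ₁ − 2q, ..., ℓ_{j−1} − 2q, ℓ_{j+1} − 2q, ..., ℓ_t − 2q) ≤ max{ℓ_t − 2q, ℓ_j − 1}, where p here refers to (t−1)-colourings with the t−1 listed path lengths. -/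
section PathLists

variable {V : Type*} {G : SimpleGraph V}

/-- `l` lists the vertices of a path of `G`, in order. -/
structure IsPathList (G : SimpleGraph V) (l : List V) : Prop where
  nodup : l.Nodup
  chain : l.IsChain G.Adj

theorem isPathList_append {l₁ l₂ : List V} :
    IsPathList G (l₁ ++ l₂) ↔ IsPathList G l₁ ∧ IsPathList G l₂ ∧ (∀ x ∈ l₁, x ∉ l₂) ∧
      ∀ x ∈ l₁.getLast?, ∀ y ∈ l₂.head?, G.Adj x y := by
  constructor
  · rintro ⟨hn, hc⟩
    rw [List.isChain_append] at hc
    rw [List.nodup_append] at hn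
    exact ⟨⟨hn.1, hc.1⟩, ⟨hn.2.1, hc.2.1⟩, fun x hx hx' => hn.2.2 x hx x hx' rfl, hc.2.2⟩
  · rintro ⟨h1, h2, h3, h4⟩
    refine ⟨List.nodup_append.2 ⟨h1.1, h2.1, ?_⟩, List.isChain_append.2 ⟨h1.2, h2.2, h4⟩⟩
    rintro x hx _ hy rfl
    exact h3 x hx hy

theorem isPathList_singleton (x : V) : IsPathList G [x] := ⟨by simp, by simp⟩

theorem isPathList_nil : IsPathList G [] := ⟨by simp, by simp⟩

theorem isPathList_cons {x : V} {l : List V} :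
    IsPathList G (x :: l) ↔ IsPathList G l ∧ x ∉ l ∧ ∀ y ∈ l.head?, G.Adj x y := by
  rw [← List.singleton_append, isPathList_append]
  simp [isPathList_singleton]

theorem IsPathList.reverse {l : List V} (h : IsPathList G l) : IsPathList G l.reverse := by
  refine ⟨List.nodup_reverse.2 h.1, ?_⟩
  rw [List.isChain_reverse]
  exact h.2.imp fun _ _ hab => hab.symm

/-- Replacing the segment `m` of a path by a disjoint path `w`. -/
theorem IsPathList.replace {l₁ m l₂ w : List V} (h : IsPathList G (l₁ ++ m ++ l₂))
    (hw : IsPathList G w) (hne : w ≠ []) (hd : ∀ x ∈ w, x ∉ l₁ ∧ x ∉ l₂)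
    (h₁ : ∀ x ∈ l₁.getLast?, ∀ y ∈ w.head?, G.Adj x y)
    (h₂ : ∀ x ∈ w.getLast?, ∀ y ∈ l₂.head?, G.Adj x y) :
    IsPathList G (l₁ ++ w ++ l₂) := by
  simp only [isPathList_append] at h ⊢
  cases w using List.reverseRecOn with
  | nil => exact absurd rfl hne
  | append_singleton => grind

/-- Reversing the segment `m` of a path, with `w` and `w'` inserted before and after it. -/
theorem IsPathList.rotate {l₁ m l₂ w w' : List V} (h : IsPathList G (l₁ ++ m ++ l₂)) (hm : m ≠ [])
    (hw : IsPathList G w) (hw' : IsPathList G w') (hne : w ≠ [])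
    (hd : ∀ x ∈ w, x ∉ l₁ ∧ x ∉ m ∧ x ∉ l₂ ∧ x ∉ w') (hd' : ∀ x ∈ w', x ∉ l₁ ∧ x ∉ m ∧ x ∉ l₂)
    (h₁ : ∀ x ∈ l₁.getLast?, ∀ y ∈ w.head?, G.Adj x y)
    (h₂ : ∀ x ∈ w.getLast?, ∀ y ∈ m.getLast?, G.Adj x y)
    (h₃ : ∀ x ∈ m.head?, ∀ y ∈ (w' ++ l₂).head?, G.Adj x y)
    (h₄ : ∀ x ∈ w'.getLast?, ∀ y ∈ l₂.head?, G.Adj x y) :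
    IsPathList G (l₁ ++ w ++ m.reverse ++ (w' ++ l₂)) := by
  have hr : IsPathList G m.reverse :=
    ((isPathList_append.1 (isPathList_append.1 h).1).2.1).reverse
  simp only [isPathList_append] at h ⊢
  cases w using List.reverseRecOn with
  | nil => exact absurd rfl hne
  | append_singleton w a =>
    cases m with
    | nil => exact absurd rfl hm
    | cons b m => 
      refine ⟨⟨⟨h.1.1, hw, ?_, h₁⟩, hr, ?_, ?_⟩, ⟨hw', h.2.1, ?_, h₄⟩, ?_, ?_⟩
      · grind
      · grind
      · intro x hx y hy
        refine h₂ x ?_ y ?_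
        · simpa using hx
        · simpa [List.head?_reverse, -List.reverse_cons] using hy
      · grind
      · grind
      · intro x hx y hy
        rw [List.reverse_cons, ← List.append_assoc, List.getLast?_concat] at hx
        exact h₃ x hx y hy

theorem countP_cons_le_of_succ (N S : V → Prop) [DecidablePred N] [DecidablePred S] :
    ∀ (q : List V) (x : V), (∀ l₁ y z l₂, x :: q = l₁ ++ y :: z :: l₂ → N y → S z) →
      (∀ l₁ y, x :: q = l₁ ++ [y] → ¬ N y) →
      (x :: q).countP (fun y => decide (N y)) ≤ q.countP (fun y => decide (S y)) := by
  intro q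
  induction q with
  | nil => 
    intro x _ h3
    have := h3 [] x rfl
    simp [this]
  | cons y q ih =>
    intro x h2 h3
    have h := ih y (fun l₁ a b l₂ he => h2 (x :: l₁) a b l₂ (by simp [he]))
      (fun l₁ a he => h3 (x :: l₁) a (by simp [he]))
    have hxy := h2 [] x y q rfl
    rw [List.countP_cons, List.countP_cons (p := fun y => decide (S y))]
    by_cases hx : N x
    · simpa [hx, hxy hx] using h
    · simp only [hx, decide_false, Bool.false_eq_true, if_false]
      omega

theorem add_countP_le_countP (N S : V → Prop) [DecidablePred N] [DecidablePred S]
    {B : List V} {μ : ℕ} (hμ : 1 ≤ μ) (hμB : μ ≤ B.length)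
    (hS : ∀ l₁ x l₂, B = l₁ ++ x :: l₂ → l₁.length < μ → S x)
    (hN : ∀ l₁ x l₂, B = l₁ ++ x :: l₂ → l₁.length + 1 < μ → ¬ N x)
    (hsucc : ∀ l₁ x y l₂, B = l₁ ++ x :: y :: l₂ → N x → S y)
    (hlast : ∀ l₁ x, B = l₁ ++ [x] → ¬ N x) :
    μ + B.countP (fun y => decide (N y)) ≤ B.countP (fun y => decide (S y)) := by
  obtain ⟨p, q, rfl, hp⟩ : ∃ p q, B = p ++ q ∧ p.length + 1 = μ :=
    ⟨B.take (μ - 1), B.drop (μ - 1), by simp, by simp; omega⟩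
  cases q with
  | nil => simp at hμB; omega
  | cons x q =>
    have h := countP_cons_le_of_succ N S q x
      (fun l₁ a b l₂ he => hsucc (p ++ l₁) a b l₂ (by simp [he]))
      (fun l₁ a he => hlast (p ++ l₁) a (by simp [he]))
    have hx : S x := hS p x q rfl (by omega)
    have hpN : p.countP (fun y => decide (N y)) = 0 := by
      rw [List.countP_eq_zero]
      intro a ha
      obtain ⟨s, t, rfl⟩ := List.append_of_mem ha
      have := hN s a (t ++ x :: q) (by simp) (by simp at hp; omega)
      simpa using this
    have hpS : p.countP (fun y => decide (S y)) = p.length := by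
      rw [List.countP_eq_length]
      intro a ha
      obtain ⟨s, t, rfl⟩ := List.append_of_mem ha
      have := hS s a (t ++ x :: q) (by simp) (by simp at hp; omega)
      simpa using this
    rw [List.countP_append, List.countP_append, hpN, hpS,
      List.countP_cons (l := q) (p := fun y => decide (S y))]
    simp [hx]; omega

theorem IsPathList.insert {l₁ l₂ w : List V} (h : IsPathList G (l₁ ++ l₂))
    (hw : IsPathList G w) (hne : w ≠ []) (hd : ∀ x ∈ w, x ∉ l₁ ∧ x ∉ l₂)
    (h₁ : ∀ x ∈ l₁.getLast?, ∀ y ∈ w.head?, G.Adj x y)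
    (h₂ : ∀ x ∈ w.getLast?, ∀ y ∈ l₂.head?, G.Adj x y) :
    IsPathList G (l₁ ++ w ++ l₂) :=
  IsPathList.replace (m := []) (by simpa using h) hw hne hd h₁ h₂

/-- Two occurrences of distinct elements in a list split it into three parts. -/
theorem append_cons_eq_append_cons {l₁ l₂ l₃ l₄ : List V} {a b : V}
    (h : l₁ ++ a :: l₂ = l₃ ++ b :: l₄) (hab : a ≠ b) :
    (∃ m, l₃ = l₁ ++ a :: m ∧ l₂ = m ++ b :: l₄) ∨
      ∃ m, l₁ = l₃ ++ b :: m ∧ l₄ = m ++ a :: l₂ := by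
  rcases List.append_eq_append_iff.1 h with ⟨m, h1, h2⟩ | ⟨m, h1, h2⟩
  · cases m with
    | nil => simp at h2; exact absurd h2.1 hab
    | cons c m => simp at h2; left; exact ⟨m, by simp [h1, h2.1], h2.2⟩
  · cases m with
    | nil => simp at h2; exact absurd h2.1.symm hab
    | cons c m => simp at h2; right; exact ⟨m, by simp [h1, h2.1], h2.2⟩

open scoped Classical in
theorem countP_mem_eq_card {B : List V} (hB : B.Nodup) (S : Finset V) :
    B.countP (fun y => decide (y ∈ S)) = (S.filter (· ∈ B)).card := by
  rw [List.countP_eq_length_filter, ← List.toFinset_card_of_nodup (hB.filter _)]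
  congr 1
  ext x
  simp [and_comm]

open scoped Classical in
theorem add_card_le_card {B : List V} (hB : B.Nodup) (N S : Finset V) {μ : ℕ} (hμ : 1 ≤ μ)
    (hμB : μ ≤ B.length)
    (hS : ∀ l₁ x l₂, B = l₁ ++ x :: l₂ → l₁.length < μ → x ∈ S)
    (hN : ∀ l₁ x l₂, B = l₁ ++ x :: l₂ → l₁.length + 1 < μ → x ∉ N)
    (hsucc : ∀ l₁ x y l₂, B = l₁ ++ x :: y :: l₂ → x ∈ N → y ∈ S)
    (hlast : ∀ l₁ x, B = l₁ ++ [x] → x ∉ N) :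
    μ + (N.filter (· ∈ B)).card ≤ (S.filter (· ∈ B)).card := by
  rw [← countP_mem_eq_card hB, ← countP_mem_eq_card hB]
  exact add_countP_le_countP (· ∈ N) (· ∈ S) hμ hμB hS hN hsucc hlast

/-- A clique is spanned by a path with any prescribed last vertex. -/
theorem exists_isPathList_of_clique [DecidableEq V] (K : Finset V)
    (hK : ∀ x ∈ K, ∀ y ∈ K, x ≠ y → G.Adj x y) {w : V} (hw : w ∈ K) :
    ∃ P, IsPathList G P ∧ P.getLast? = some w ∧ (∀ x, x ∈ P ↔ x ∈ K) ∧ P.length = K.card := by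
  have hnd : ((K.erase w).toList ++ [w]).Nodup := by
    simpa [List.nodup_append, Finset.nodup_toList] using fun _ h _ => h
  have hmem : ∀ x, x ∈ (K.erase w).toList ++ [w] ↔ x ∈ K := by
    intro x
    by_cases hx : x = w <;> simp [hx, hw]
  refine ⟨(K.erase w).toList ++ [w], ⟨hnd, List.Pairwise.isChain ?_⟩, by simp, hmem, ?_⟩
  · exact hnd.imp_of_mem fun ha hb hab => hK _ ((hmem _).1 ha) _ ((hmem _).1 hb) hab
  · rw [← List.toFinset_card_of_nodup hnd]
    congr 1
    ext x
    rw [List.mem_toFinset, hmem]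

/-- A graph whose degrees inside `H` are at least `L - 1` has a path on `L` vertices of `H`
ending at any prescribed vertex of `H`. -/
theorem exists_isPathList_of_le_degree [DecidableEq V] (H : Finset V) (N : V → Finset V)
    (hN : ∀ w ∈ H, ∀ x ∈ N w, x ∈ H ∧ G.Adj w x) {L : ℕ}
    (hL : ∀ w ∈ H, L ≤ (N w).card + 1) {w : V} (hw : w ∈ H) :
    ∀ t, 1 ≤ t → t ≤ L → ∃ P, IsPathList G P ∧ P.getLast? = some w ∧ (∀ x ∈ P, x ∈ H) ∧
      P.length = t := by
  intro t ht
  induction t, ht using Nat.le_induction with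
  | base => exact fun _ => ⟨[w], isPathList_singleton w, rfl, by simpa using hw, rfl⟩
  | succ t ht ih =>
    intro htL
    obtain ⟨P, hP, hlast, hPH, hlen⟩ := ih (by omega)
    cases P with
    | nil => simp at hlast
    | cons x P =>
      have hx : x ∈ H := hPH x (by simp)
      have hP' := isPathList_cons.1 hP
      have hlt : P.toFinset.card < (N x).card := by
        have := hL x hx
        have := P.toFinset_card_le
        simp at hlen
        omega
      obtain ⟨y, hy, hyP⟩ := Finset.exists_mem_notMem_of_card_lt_card hlt
      have hxy := (hN x hx y hy)
      refine ⟨y :: x :: P, isPathList_cons.2 ⟨hP, ?_, ?_⟩, ?_, ?_, ?_⟩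
      · have := hxy.2.ne
        simp at hyP
        simp [hyP, this.symm]
      · simpa using hxy.2.symm
      · rw [List.getLast?_cons, hlast]; rfl
      · intro z hz
        rcases List.mem_cons.1 hz with rfl | hz
        exacts [hxy.1, hPH z hz]
      · simp at hlen ⊢; omega

/-- Vertices of a component of the graph with the set `R` deleted are joined by paths in it. -/
theorem exists_component (G : SimpleGraph V) [Fintype V] (R : List V) {v : V} (hv : v ∉ R) :
    ∃ H : Finset V, v ∈ H ∧ (∀ h ∈ H, h ∉ R) ∧ (∀ h ∈ H, ∀ x, G.Adj h x → x ∉ R → x ∈ H) ∧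
      ∀ h ∈ H, ∀ h' ∈ H, ∃ P, IsPathList G P ∧ P.head? = some h ∧ P.getLast? = some h' ∧
        ∀ x ∈ P, x ∈ H := by
  classical
  let G' : SimpleGraph V :=
    { Adj := fun x y => G.Adj x y ∧ x ∉ R ∧ y ∉ R
      symm := ⟨fun x y h => ⟨h.1.symm, h.2.2, h.2.1⟩⟩
      loopless := ⟨fun x h => h.1.ne rfl⟩ }
  have hR : ∀ x, G'.Reachable v x → x ∉ R := by
    intro x hx
    rw [SimpleGraph.reachable_iff_reflTransGen] at hx
    induction hx with
    | refl => exact hv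
    | tail _ h _ => exact h.2.2
  refine ⟨Finset.univ.filter (G'.Reachable v), by simp, by simpa using hR, ?_, ?_⟩
  · intro h hh x hx hxR
    simp only [Finset.mem_filter, Finset.mem_univ, true_and] at hh ⊢
    exact hh.trans (SimpleGraph.Adj.reachable ⟨hx, hR h hh, hxR⟩)
  · intro h hh h' hh'
    simp only [Finset.mem_filter, Finset.mem_univ, true_and] at hh hh' ⊢
    obtain ⟨p, hp⟩ := (hh.symm.trans hh').exists_isPath
    refine ⟨p.support, ⟨hp.support_nodup, ?_⟩, ?_, ?_, ?_⟩
    · exact p.isChain_adj_support.imp fun _ _ hab => hab.1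
    · cases p <;> simp
    · rw [List.getLast?_eq_getLast_of_ne_nil p.support_ne_nil, p.getLast_support]
    · intro x hx
      exact hh.trans ⟨p.takeUntil x hx⟩

/-- Let `R` be a longest red path and `H` a red-connected set avoiding it. The successors on `R` of
the red neighbours of `H`, together with the first vertex of `R`, have no red neighbour in `H`, and
all of them lie on any blue path `B` that is at most one vertex shorter than a longest one. -/
theorem exists_successor_set [Fintype V] {red blue : SimpleGraph V}
    (hcov : ∀ x y, x ≠ y → red.Adj x y ∨ blue.Adj x y) {R B : List V}
    (hR : IsPathList red R) (hRmax : ∀ P, IsPathList red P → P.length ≤ R.length)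
    (hB : IsPathList blue B) (hBmax : ∀ P, IsPathList blue P → P.length ≤ B.length + 1)
    {H : Finset V} (hHR : ∀ h ∈ H, h ∉ R) {v : V} (hv : v ∈ H) (hvB : v ∉ B)
    (hHc : ∀ h ∈ H, ∀ h' ∈ H, ∃ P, IsPathList red P ∧ P.head? = some h ∧ P.getLast? = some h' ∧
      ∀ x ∈ P, x ∈ H)
    {S : Finset V} (hS : ∀ x, x ∈ S ↔ x ∈ R ∧ ∃ h ∈ H, red.Adj h x) :
    ∃ I : Finset V, S.card + 1 ≤ I.card ∧ ∀ x ∈ I, x ∈ R ∧ x ∈ B ∧ ∀ h ∈ H, ¬ red.Adj h x := by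
  classical
  let I : Finset V := Finset.univ.filter fun x =>
    ∃ l₁ l₂, R = l₁ ++ x :: l₂ ∧ ∀ y ∈ l₁.getLast?, y ∈ S
  have hI : ∀ x, x ∈ I ↔ ∃ l₁ l₂, R = l₁ ++ x :: l₂ ∧ ∀ y ∈ l₁.getLast?, y ∈ S := by simp [I]
  have hIR : ∀ x ∈ I, x ∈ R := by
    intro x hx
    obtain ⟨l₁, l₂, rfl, -⟩ := (hI x).1 hx
    simp
  have hconn : ∀ l₁ : List V, (∀ y ∈ l₁.getLast?, y ∈ S) → ∀ h' ∈ H, ∃ P, IsPathList red P ∧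
      P ≠ [] ∧ P.getLast? = some h' ∧ (∀ x ∈ P, x ∈ H) ∧
      ∀ x ∈ l₁.getLast?, ∀ y ∈ P.head?, red.Adj x y := by
    intro l₁ hl h' hh'
    cases hlast : l₁.getLast? with
    | none => exact ⟨[h'], isPathList_singleton _, by simp, rfl, by simpa using hh', by simp⟩
    | some y =>
      obtain ⟨-, h, hh, hhy⟩ := (hS y).1 (hl y hlast)
      obtain ⟨P, hP, h1, h2, h3⟩ := hHc h hh h' hh'
      refine ⟨P, hP, by rintro rfl; simp at h1, h2, h3, ?_⟩
      simp [h1, hhy.symm]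
  have hIH : ∀ x ∈ I, ∀ h ∈ H, ¬ red.Adj h x := by
    intro x hx h hh hadj
    obtain ⟨l₁, l₂, rfl, hl⟩ := (hI x).1 hx
    obtain ⟨P, hP, hne, hPl, hPH, hj⟩ := hconn l₁ hl h hh
    have hlen := hRmax _ (hR.insert hP hne (fun y hy => by simpa using hHR y (hPH y hy)) hj
      (by simpa [hPl] using hadj))
    have hpos := List.length_pos_iff.2 hne
    simp only [List.length_append] at hlen
    omega
  have hclique : ∀ a ∈ I, ∀ b ∈ I, a ≠ b → blue.Adj a b := by
    have key : ∀ a b l₁ m l₂, R = l₁ ++ a :: m ++ b :: l₂ → (∀ y ∈ l₁.getLast?, y ∈ S) →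
        (∀ y ∈ (l₁ ++ a :: m).getLast?, y ∈ S) → ¬ red.Adj a b := by
      rintro a b l₁ m l₂ rfl h1 h2 hadj
      obtain ⟨c, hc⟩ : ∃ c, (a :: m).getLast? = some c := ⟨_, List.getLast?_cons⟩
      have hcS : c ∈ S := h2 c (by rw [List.getLast?_append, hc]; rfl)
      obtain ⟨-, h', hh', hhc⟩ := (hS c).1 hcS
      obtain ⟨P, hP, hne, hPl, hPH, hj⟩ := hconn l₁ h1 h' hh'
      have hlen := hRmax _ (hR.rotate (w' := []) (by simp) hP isPathList_nil hne
        (fun y hy => by simpa [and_assoc] using hHR y (hPH y hy)) (by simp) hj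
        (by simpa [hPl, hc] using hhc) (by simpa using hadj) (by simp))
      have hpos := List.length_pos_iff.2 hne
      simp at hlen
      omega
    intro a ha b hb hab
    obtain ⟨l₁, l₂, h1, h1'⟩ := (hI a).1 ha
    obtain ⟨l₃, l₄, h2, h2'⟩ := (hI b).1 hb
    refine (hcov a b hab).resolve_left ?_
    rcases append_cons_eq_append_cons (h1.symm.trans h2) hab with ⟨m, rfl, rfl⟩ | ⟨m, rfl, rfl⟩
    · exact key a b l₁ m l₄ (by simpa using h1) h1' h2'
    · exact fun h => key b a l₃ m l₂ (by simpa using h1) h2' h1' h.symm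
  have hRpos : 1 ≤ R.length := hRmax [v] (isPathList_singleton v)
  have hSI : S.card + 1 ≤ I.card := by
    have h := add_card_le_card hR.nodup S I le_rfl hRpos
      (fun l₁ x l₂ h hlen => (hI x).2 ⟨l₁, l₂, h, by
        have : l₁ = [] := by simpa using hlen
        simp [this]⟩)
      (fun l₁ x l₂ h hlen => by simp at hlen)
      (fun l₁ x y l₂ h hx => (hI y).2 ⟨l₁ ++ [x], l₂, by simp [h], by simpa using hx⟩)
      (fun l₁ x h hx => by
        obtain ⟨-, u, hu, hadj⟩ := (hS x).1 hx
        have hp : IsPathList red (R ++ [u]) := isPathList_append.2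
          ⟨hR, isPathList_singleton u, fun y hy hyu => hHR u hu (by simp at hyu; rwa [← hyu]),
            by simpa [h] using hadj.symm⟩
        have := hRmax _ hp
        simp at this)
    rw [Finset.filter_true_of_mem fun x hx => ((hS x).1 hx).1,
      Finset.filter_true_of_mem hIR] at h
    omega
  refine ⟨I, hSI, fun x hx => ⟨hIR x hx, ?_, hIH x hx⟩⟩
  by_contra hxB
  have hvR := hHR v hv
  have hblue : ∀ y ∈ I, blue.Adj y v := fun y hy =>
    (hcov y v (by rintro rfl; exact hvR (hIR _ hy))).resolve_left fun h => hIH y hy v hv h.symm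
  let K : Finset V := insert v (I.filter (· ∉ B))
  have hvK : v ∉ I.filter (· ∉ B) := fun h => hvR (hIR v (Finset.mem_filter.1 h).1)
  have hKcard : K.card = (I.filter (· ∉ B)).card + 1 := Finset.card_insert_of_notMem hvK
  have hKpos : 1 ≤ (I.filter (· ∉ B)).card := Finset.card_pos.2 ⟨x, by simp [hx, hxB]⟩
  have hKB : ∀ y ∈ K, y ∉ B := by
    intro y hy
    rcases Finset.mem_insert.1 hy with rfl | hy
    exacts [hvB, (Finset.mem_filter.1 hy).2]
  have hKclique : ∀ a ∈ K, ∀ b ∈ K, a ≠ b → blue.Adj a b := by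
    intro a ha b hb hab
    rcases Finset.mem_insert.1 ha with ha | ha <;> rcases Finset.mem_insert.1 hb with hb | hb
    · exact absurd (ha.trans hb.symm) hab
    · exact ha ▸ (hblue b (Finset.mem_filter.1 hb).1).symm
    · exact hb ▸ hblue a (Finset.mem_filter.1 ha).1
    · exact hclique a (Finset.mem_filter.1 ha).1 b (Finset.mem_filter.1 hb).1 hab
  have hIK : ∀ a ∈ I, a ∈ B → ∀ b ∈ K, blue.Adj a b := by
    intro a ha haB b hb
    rcases Finset.mem_insert.1 hb with rfl | hb
    · exact hblue a ha
    · exact hclique a ha b (Finset.mem_filter.1 hb).1 fun h => (Finset.mem_filter.1 hb).2 (h ▸ haB)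
  have hdS : ∀ d ∈ B, (∀ w ∈ K, ¬ blue.Adj w d) → d ∈ S ∧ d ∉ I := by
    intro d hdB hd
    have hredd : ∀ w ∈ K, red.Adj w d := fun w hw =>
      (hcov w d fun h => hKB w hw (h ▸ hdB)).resolve_right (hd w hw)
    have hredv := hredd v (Finset.mem_insert_self _ _)
    have hredx : red.Adj x d := hredd x (by simp [K, hx, hxB])
    refine ⟨(hS d).2 ⟨?_, v, hv, hredv⟩, fun h => hd v (Finset.mem_insert_self _ _)
      (hblue d h).symm⟩
    by_contra hdR
    have hdH : d ∉ H := fun h => hIH x hx d h hredx.symm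
    obtain ⟨l₁, l₂, rfl, hl⟩ := (hI x).1 hx
    obtain ⟨P, hP, hne, hPl, hPH, hj⟩ := hconn l₁ hl v hv
    have hPd : IsPathList red (P ++ [d]) := isPathList_append.2 ⟨hP, isPathList_singleton d,
      fun y hy hyd => hdH (by simp at hyd; exact hyd ▸ hPH y hy), by simpa [hPl] using hredv⟩
    have := hRmax _ (hR.insert hPd (by simp) (fun y hy => by
        rcases List.mem_append.1 hy with hy | hy
        · simpa using hHR y (hPH y hy)
        · simp at hy; subst hy; simpa using hdR)
      (by rwa [List.head?_append_of_ne_nil _ hne]) (by simpa using hredx.symm))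
    simp at this
    omega
  have hlong : ∀ l₁ m d l₂, B = l₁ ++ m ++ d :: l₂ → m.length + 2 ≤ K.card →
      (∀ y ∈ l₁.getLast?, ∀ w ∈ K, blue.Adj y w) → ∀ w ∈ K, ¬ blue.Adj w d := by
    intro l₁ m d l₂ h hm hl w hw hadj
    obtain ⟨P, hP, hPl, hPK, hlen⟩ := exists_isPathList_of_clique K hKclique hw
    have hne : P ≠ [] := by rintro rfl; simp at hPl
    rw [h] at hB
    have := hBmax _ (hB.replace hP hne (fun y hy => by
        have := hKB y ((hPK y).1 hy)
        rw [h] at this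
        simp at this ⊢
        tauto)
      (fun y hy z hz => hl y hy z ((hPK z).1 (List.mem_of_mem_head? hz)))
      (by simpa [hPl] using hadj))
    simp [h] at this
    omega
  have hlenB : K.card ≤ B.length + 1 := by
    obtain ⟨P, hP, -, -, hlen⟩ := exists_isPathList_of_clique K hKclique
      (Finset.mem_insert_self v _)
    exact hlen ▸ hBmax P hP
  have h := add_card_le_card hB.nodup I S hKpos (by omega)
    (fun l₁ d l₂ h hlen => (hdS d (by simp [h])
      (hlong [] l₁ d l₂ (by simpa using h) (by omega) (by simp))).1)
    (fun l₁ d l₂ h hlen => (hdS d (by simp [h])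
      (hlong [] l₁ d l₂ (by simpa using h) (by omega) (by simp))).2)
    (fun l₁ y d l₂ h hy => (hdS d (by simp [h])
      (hlong (l₁ ++ [y]) [] d l₂ (by simpa using h) (by simp; omega)
        (by simpa using hIK y hy (by simp [h])))).1)
    (fun l₁ y h hy => by
      obtain ⟨P, hP, -, hPK, hlen⟩ := exists_isPathList_of_clique K hKclique
        (Finset.mem_insert_self v _)
      have := hBmax (B ++ P) (isPathList_append.2 ⟨hB, hP,
        fun z hz hz' => hKB z ((hPK z).1 hz') hz, fun z hz u hu => by
          simp [h] at hz
          exact hz ▸ hIK y hy (by simp [h]) u ((hPK u).1 (List.mem_of_mem_head? hu))⟩)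
      simp at this
      omega)
  have h1 := Finset.card_filter_add_card_filter_not (s := I) (· ∈ B)
  have h2 := Finset.card_filter_le S (· ∈ B)
  omega

/-- A longest red path and a longest blue path together cover all vertices. -/
theorem mem_or_mem_of_longest [Fintype V] {red blue : SimpleGraph V}
    (hcov : ∀ x y, x ≠ y → red.Adj x y ∨ blue.Adj x y) {R B : List V}
    (hR : IsPathList red R) (hRmax : ∀ P, IsPathList red P → P.length ≤ R.length)
    (hB : IsPathList blue B) (hBmax : ∀ P, IsPathList blue P → P.length ≤ B.length) (v : V) :
    v ∈ R ∨ v ∈ B := by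
  classical
  by_contra! hv
  obtain ⟨hvR, hvB⟩ := hv
  have key : ∀ (red blue : SimpleGraph V), (∀ x y, x ≠ y → red.Adj x y ∨ blue.Adj x y) →
      ∀ R B : List V, IsPathList red R → (∀ P, IsPathList red P → P.length ≤ R.length) →
      IsPathList blue B → (∀ P, IsPathList blue P → P.length ≤ B.length) → v ∉ R → v ∉ B →
      (Finset.univ.filter fun x => x ∈ R ∧ red.Adj v x).card + 1 ≤
        (Finset.univ.filter fun x => x ∈ B ∧ blue.Adj v x).card := by
    intro red blue hcov R B hR hRmax hB hBmax hvR hvB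
    obtain ⟨I, hI, hI'⟩ := exists_successor_set hcov hR hRmax hB
      (fun P hP => (hBmax P hP).trans (by omega)) (H := {v}) (by simpa using hvR)
      (Finset.mem_singleton_self v) hvB
      (by simpa using ⟨[v], isPathList_singleton v, by simp⟩)
      (S := Finset.univ.filter fun x => x ∈ R ∧ red.Adj v x) (by simp)
    refine hI.trans (Finset.card_le_card fun x hx => ?_)
    obtain ⟨hxR, hxB, hx⟩ := hI' x hx
    simp only [Finset.mem_filter, Finset.mem_univ, true_and]
    exact ⟨hxB, (hcov v x (by rintro rfl; exact hvR hxR)).resolve_left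
      (hx v (Finset.mem_singleton_self v))⟩
  have h1 := key red blue hcov R B hR hRmax hB hBmax hvR hvB
  have h2 := key blue red (fun x y h => (hcov x y h).symm) B R hB hBmax hR hRmax hvB hvR
  omega

open scoped Classical in
/-- If `H` is a component of the complement of a longest path and all its vertices have degree at
least `σ`, then more than `σ` vertices outside `H` have no neighbour in `H`. -/
theorem lt_card_of_component [Fintype V] {G : SimpleGraph V} {R : List V}
    (hR : IsPathList G R) (hRmax : ∀ P, IsPathList G P → P.length ≤ R.length)
    {H : Finset V} (hHR : ∀ h ∈ H, h ∉ R) {v : V} (hv : v ∈ H)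
    (hHcl : ∀ h ∈ H, ∀ x, G.Adj h x → x ∉ R → x ∈ H)
    (hHc : ∀ h ∈ H, ∀ h' ∈ H, ∃ P, IsPathList G P ∧ P.head? = some h ∧ P.getLast? = some h' ∧
      ∀ x ∈ P, x ∈ H)
    {σ : ℕ} (hσ : ∀ h ∈ H, σ ≤ (Finset.univ.filter (G.Adj h)).card)
    {Z : Finset V} (hZ : ∀ x, x ∈ Z ↔ x ∉ H ∧ ∀ h ∈ H, ¬ G.Adj h x) :
    σ < Z.card := by
  let S : Finset V := Finset.univ.filter fun x => x ∈ R ∧ ∃ h ∈ H, G.Adj h x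
  have hS : ∀ x, x ∈ S ↔ x ∈ R ∧ ∃ h ∈ H, G.Adj h x := by simp [S]
  have hdeg : ∀ w ∈ H, σ - S.card + 1 ≤ (H.filter (G.Adj w)).card + 1 := by
    intro w hw
    have h1 : Finset.univ.filter (G.Adj w) ⊆ H.filter (G.Adj w) ∪ S := by
      intro x hx
      have hx : G.Adj w x := by simpa using hx
      by_cases hxR : x ∈ R
      · exact Finset.mem_union_right _ ((hS x).2 ⟨hxR, w, hw, hx⟩)
      · exact Finset.mem_union_left _ (by simp [hHcl w hw x hx hxR, hx])
    have h2 := (Finset.card_le_card h1).trans (Finset.card_union_le _ _)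
    have h3 := hσ w hw
    omega
  have hpath : ∀ w ∈ H, ∃ P, IsPathList G P ∧ P.getLast? = some w ∧ (∀ x ∈ P, x ∈ H) ∧
      P.length = σ - S.card + 1 := fun w hw =>
    exists_isPathList_of_le_degree H (fun w => H.filter (G.Adj w))
      (fun w _ x hx => by simpa using hx) hdeg hw _ (by omega) le_rfl
  have hL : σ - S.card + 1 ≤ R.length := by
    obtain ⟨P, hP, -, -, hlen⟩ := hpath v hv
    exact hlen ▸ hRmax P hP
  have hmem : ∀ x ∈ R, (∀ h ∈ H, ¬ G.Adj h x) → x ∈ Z := fun x hx h =>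
    (hZ x).2 ⟨fun hxH => hHR x hxH hx, h⟩
  have hpre : ∀ l₁ x l₂, R = l₁ ++ x :: l₂ → l₁.length < σ - S.card + 1 →
      ∀ h ∈ H, ¬ G.Adj h x := by
    rintro l₁ x l₂ rfl hlt h hh hadj
    obtain ⟨P, hP, hPl, hPH, hlen⟩ := hpath h hh
    have := hRmax (P ++ x :: l₂) (isPathList_append.2 ⟨hP, (isPathList_append.1 hR).2.1,
      fun y hy hy' => hHR y (hPH y hy) (List.mem_append_right _ hy'), by simpa [hPl] using hadj⟩)
    simp at this
    omega
  have h := add_card_le_card hR.nodup S Z (by omega) hL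
    (fun l₁ x l₂ h hlt => hmem x (by simp [h]) (hpre l₁ x l₂ h hlt))
    (fun l₁ x l₂ h hlt hx => by
      obtain ⟨-, w, hw, hadj⟩ := (hS x).1 hx
      exact hpre l₁ x l₂ h (by omega) w hw hadj)
    (fun l₁ x y l₂ h hx => hmem y (by simp [h]) fun w hw hadj => by
      obtain ⟨-, u, hu, hux⟩ := (hS x).1 hx
      obtain ⟨P, hP, hPh, hPl, hPH⟩ := hHc u hu w hw
      have hne : P ≠ [] := by rintro rfl; simp at hPh
      have hpos := List.length_pos_iff.2 hne
      have hR' : IsPathList G ((l₁ ++ [x]) ++ y :: l₂) := by simpa [h] using hR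
      have hlen := hRmax _ (hR'.insert hP hne
        (fun z hz => by
          have := hHR z (hPH z hz)
          simp [h] at this ⊢
          tauto)
        (by simpa [hPh] using hux.symm) (by simpa [hPl] using hadj))
      simp only [h, List.length_append, List.length_cons, List.length_nil] at hlen
      omega)
    (fun l₁ x h hx => by
      obtain ⟨-, u, hu, hux⟩ := (hS x).1 hx
      have := hRmax (R ++ [u]) (isPathList_append.2 ⟨hR, isPathList_singleton u,
        fun y hy hyu => hHR u hu (by simp at hyu; rwa [← hyu]), by simpa [h] using hux.symm⟩)
      simp at this)
  rw [Finset.filter_true_of_mem (s := S) fun x hx => ((hS x).1 hx).1] at h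
  have := Finset.card_filter_le Z (· ∈ R)
  omega

theorem IsPathList.length_insert_le {G : SimpleGraph V} {B l₁ l₂ w : List V} {n : ℕ}
    (hB : IsPathList G B) (hmax : ∀ P, IsPathList G P → P.length ≤ B.length + n)
    (h : B = l₁ ++ l₂) (hw : IsPathList G w) (hd : ∀ x ∈ w, x ∉ B)
    (h₁ : ∀ x ∈ l₁.getLast?, ∀ y ∈ w.head?, G.Adj x y)
    (h₂ : ∀ x ∈ w.getLast?, ∀ y ∈ l₂.head?, G.Adj x y) : w.length ≤ n := by
  subst h
  rcases eq_or_ne w [] with rfl | hne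
  · simp
  have := hmax _ (hB.insert hw hne (by simpa using hd) h₁ h₂)
  simp at this
  omega

theorem isPathList_pair {G : SimpleGraph V} {x y : V} (h : G.Adj x y) : IsPathList G [x, y] :=
  isPathList_cons.2 ⟨isPathList_singleton y, by simpa using h.ne, by simpa using h⟩

theorem exists_longest [Fintype V] (p : List V → Prop) (hp : ∀ P, p P → P.Nodup) {P₀ : List V}
    (h₀ : p P₀) : ∃ W, p W ∧ ∀ P, p P → P.length ≤ W.length := by
  let s : Set ℕ := {n | ∃ P, p P ∧ P.length = n}
  have hbdd : BddAbove s := ⟨Fintype.card V, by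
    rintro _ ⟨P, hP, rfl⟩
    exact (hp P hP).length_le_card⟩
  obtain ⟨W, hW, hlen⟩ := Nat.sSup_mem (s := s) ⟨_, P₀, h₀, rfl⟩ hbdd
  exact ⟨W, hW, fun P hP => hlen ▸ le_csSup hbdd ⟨P, hP, rfl⟩⟩

open scoped Classical in
/-- In the following situation `v` can be inserted between two consecutive vertices of `B`, and
some vertex outside `B` has fewer than `S.card` blue neighbours. -/
theorem exists_degree_lt_of_consecutive [Fintype V] {blue : SimpleGraph V} {B : List V} {v : V}
    (hB : IsPathList blue B) (hvB : v ∉ B)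
    (hBmax : ∀ P, IsPathList blue P → P.length ≤ B.length + 1)
    {S : Finset V} (hSv : ∀ x, x ≠ v → x ∉ S → blue.Adj v x) {l₁ l₂ : List V} {x x' : V}
    (hBx : B = l₁ ++ x :: x' :: l₂) (hx : x ∉ S) (hx' : x' ∉ S) {z₀ : V} (hz₀B : z₀ ∉ B)
    (hz₀v : z₀ ≠ v) (hz₀S : z₀ ∉ S) :
    ∃ z, z ∉ B ∧ z ≠ v ∧ (Finset.univ.filter (blue.Adj z)).card < S.card := by
  have hSB : ∀ y ∈ B, y ∉ S → blue.Adj v y := fun y hy hyS =>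
    hSv y (by rintro rfl; exact hvB hy) hyS
  obtain ⟨W, ⟨hW, hWT⟩, hWmax⟩ := exists_longest
    (fun P => IsPathList blue P ∧ ∀ y ∈ P, y ∉ B ∧ y ≠ v ∧ y ∉ S) (fun P hP => hP.1.nodup)
    (P₀ := [z₀]) ⟨isPathList_singleton z₀, by simp [hz₀B, hz₀v, hz₀S]⟩
  obtain _ | ⟨z, W'⟩ := W
  · have := hWmax [z₀] ⟨isPathList_singleton z₀, by simp [hz₀B, hz₀v, hz₀S]⟩
    simp at this
  obtain ⟨hzB, hzv, hzS⟩ := hWT z (by simp)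
  refine ⟨z, hzB, hzv, ?_⟩
  set N : Finset V := Finset.univ.filter (blue.Adj z) with hN
  have hmemN : ∀ y, y ∈ N ↔ blue.Adj z y := by simp [hN]
  have hvz : blue.Adj v z := hSv z hzv hzS
  set W : List V := z :: W' with hWdef
  have hWv : ∀ y ∈ W, blue.Adj y v := fun y hy => (hSv y (hWT y hy).2.1 (hWT y hy).2.2).symm
  have hvW : v ∉ W := fun h => (hWT v h).2.1 rfl
  have hrep : ∀ p d s, B = p ++ d :: s → ∀ w u, IsPathList blue w → (∀ y ∈ w, y = v ∨ y ∈ W) →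
      w.getLast? = some u → blue.Adj u d → w.length ≤ p.length + 1 := by
    intro p d s h w u hw hwW hwl hud
    have hne : w ≠ [] := by rintro rfl; simp at hwl
    have hB' : IsPathList blue ([] ++ p ++ d :: s) := by simpa [h] using hB
    have hlen := hBmax _ (hB'.replace hw hne (fun y hy => by
      have : y ∉ B := by
        rcases hwW y hy with rfl | hy
        exacts [hvB, (hWT y hy).1]
      simp [h] at this ⊢
      tauto) (by simp) (by simpa [hwl] using hud))
    simp [h] at hlen
    omega
  have hpreS : ∀ p d s, B = p ++ d :: s → p.length < W.length → d ∈ S := by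
    intro p d s h hlt
    by_contra hd
    have := hrep p d s h (W ++ [v]) v (isPathList_append.2 ⟨hW, isPathList_singleton v,
      fun y hy hyv => hvW (by simp at hyv; rwa [← hyv]),
      fun y hy u hu => by
        simp at hu
        exact hu ▸ hWv y (List.mem_of_mem_getLast? hy)⟩)
      (fun y hy => by simp at hy ⊢; tauto) (by simp) (hSB d (by simp [h]) hd)
    simp at this
    omega
  have hpreN : ∀ p d s, B = p ++ d :: s → p.length < W.length → d ∉ N := by
    intro p d s h hlt hd
    have := hrep p d s h (v :: W.reverse) z (isPathList_cons.2 ⟨hW.reverse, by simpa using hvW,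
      fun y hy => (hWv y (List.mem_reverse.1 (List.mem_of_mem_head? hy))).symm⟩)
      (fun y hy => by simpa using hy) (by simp [hWdef, List.getLast?_cons])
      ((hmemN d).1 hd)
    simp at this
    omega
  have hzv' : ∀ y ∈ [z, v], y ∉ B := by simp [hzB, hvB]
  have hvz' : ∀ y ∈ [v, z], y ∉ B := by simp [hzB, hvB]
  have hsucc : ∀ p a b s, B = p ++ a :: b :: s → a ∈ N → b ∈ S := by
    intro p a b s h ha
    by_contra hb
    have := hB.length_insert_le hBmax (l₁ := p ++ [a]) (l₂ := b :: s) (by simp [h])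
      (isPathList_pair hvz.symm) hzv' (by simpa using ((hmemN a).1 ha).symm)
      (by simpa using hSB b (by simp [h]) hb)
    simp at this
  have hpred : ∀ p a b s, B = p ++ a :: b :: s → b ∈ N → a ∈ S := by
    intro p a b s h hb
    by_contra ha
    have := hB.length_insert_le hBmax (l₁ := p ++ [a]) (l₂ := b :: s) (by simp [h])
      (isPathList_pair hvz) hvz' (by simpa using (hSB a (by simp [h]) ha).symm)
      (by simpa using (hmemN b).1 hb)
    simp at this
  have hlast : ∀ p a, B = p ++ [a] → a ∈ S := by
    intro p a h
    by_contra ha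
    have := hB.length_insert_le hBmax (l₁ := p ++ [a]) (l₂ := []) (by simp [h])
      (isPathList_pair hvz) hvz' (by simpa using (hSB a (by simp [h]) ha).symm) (by simp)
    simp at this
  have hl₁ : W.length ≤ l₁.length := by
    by_contra! hlt
    exact hx (hpreS l₁ x (x' :: l₂) hBx hlt)
  have hBx₁ : ∀ t, l₁ ++ [x] = t → B = t ++ x' :: l₂ := by
    rintro _ rfl
    simp [hBx]
  have hcount₁ := add_countP_le_countP (· ∈ N) (· ∈ S) (B := l₁ ++ [x]) (μ := W.length)
    (by simp [hWdef]) (by simp; omega)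
    (fun p d s h hlt => hpreS p d (s ++ x' :: l₂)
      ((hBx₁ _ h).trans (by simp)) hlt)
    (fun p d s h hlt => hpreN p d (s ++ x' :: l₂)
      ((hBx₁ _ h).trans (by simp))
      (by omega))
    (fun p a b s h => hsucc p a b (s ++ x' :: l₂)
      ((hBx₁ _ h).trans (by simp)))
    (fun p a h ha => by
      obtain ⟨-, rfl⟩ : l₁ = p ∧ x = a := by simpa using h
      exact hx' (hsucc l₁ x x' l₂ hBx ha))
  have hcount₂ := add_countP_le_countP (· ∈ N) (· ∈ S) (B := (x' :: l₂).reverse) (μ := 1)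
    le_rfl (by simp)
    (fun p d s h hlt => by
      obtain rfl : p = [] := by simpa using hlt
      have h' := congrArg List.reverse h
      rw [List.reverse_reverse] at h'
      exact hlast (l₁ ++ x :: s.reverse) d (by rw [hBx, h']; simp))
    (fun p d s h hlt => by simp at hlt)
    (fun p a b s h => by
      have h' := congrArg List.reverse h
      rw [List.reverse_reverse] at h'
      exact hpred (l₁ ++ x :: s.reverse) b a p.reverse (by rw [hBx, h']; simp))
    (fun p a h ha => by
      obtain ⟨-, rfl⟩ : l₂.reverse = p ∧ x' = a := by simpa using h
      exact hx (hpred l₁ x x' l₂ hBx ha))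
  have hNB := countP_mem_eq_card hB.nodup N
  have hSB' := countP_mem_eq_card hB.nodup S
  rw [show B = (l₁ ++ [x]) ++ x' :: l₂ by simp [hBx], List.countP_append] at hNB hSB'
  rw [show (l₁ ++ [x]) ++ x' :: l₂ = B by simp [hBx]] at hNB hSB'
  rw [List.countP_reverse, List.countP_reverse] at hcount₂
  have hsub : N ⊆ {v} ∪ N.filter (· ∈ B) ∪ W'.toFinset ∪ S.filter (· ∉ B) := by
    intro u hu
    have hzu := (hmemN u).1 hu
    simp only [Finset.mem_union, Finset.mem_singleton, Finset.mem_filter, List.mem_toFinset]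
    by_contra! hcon
    obtain ⟨⟨⟨huv, huB⟩, huW'⟩, huS⟩ := hcon
    have huB := huB hu
    have huS : u ∉ S := fun h => huB (huS h)
    have := hWmax (u :: W) ⟨isPathList_cons.2 ⟨hW, by simp [hWdef, hzu.ne', huW'],
      by simpa [hWdef] using hzu.symm⟩, by
        intro y hy
        rcases List.mem_cons.1 hy with rfl | hy
        exacts [⟨huB, huv, huS⟩, hWT y hy]⟩
    simp at this
  have h1 := Finset.card_le_card hsub
  have h2 := Finset.card_union_le ({v} ∪ N.filter (· ∈ B) ∪ W'.toFinset) (S.filter (· ∉ B))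
  have h3 := Finset.card_union_le ({v} ∪ N.filter (· ∈ B)) W'.toFinset
  have h4 := Finset.card_union_le {v} (N.filter (· ∈ B))
  have h5 := W'.toFinset_card_le
  have h6 := Finset.card_filter_add_card_filter_not (s := S) (· ∈ B)
  have h7 : W.length = W'.length + 1 := rfl
  rw [Finset.card_singleton] at h4
  omega

open scoped Classical in
/-- If `S` contains all vertices outside `B` other than `v`, and `B` is a longest blue path avoiding
`v`, then the vertices outside `B` other than `v` have fewer than `S.card` blue neighbours. -/
theorem degree_lt_of_forall_mem [Fintype V] {blue : SimpleGraph V} {B : List V} {v : V}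
    (hB : IsPathList blue B) (hvB : v ∉ B) (hBne : B ≠ [])
    (hBmax : ∀ P, IsPathList blue P → P.length ≤ B.length + 1)
    (hBv : ∀ P, IsPathList blue P → v ∉ P → P.length ≤ B.length)
    {S : Finset V} (hSv : ∀ x, x ≠ v → x ∉ S → blue.Adj v x)
    (hout : ∀ z, z ∉ B → z ≠ v → z ∈ S) {z : V} (hzB : z ∉ B) (hzv : z ≠ v) :
    (Finset.univ.filter (blue.Adj z)).card < S.card := by
  set N : Finset V := Finset.univ.filter (blue.Adj z) with hN
  have hmemN : ∀ y, y ∈ N ↔ blue.Adj z y := by simp [hN]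
  by_contra! hcard
  let I : Finset V := Finset.univ.filter fun x =>
    ∃ l₁ l₂, B = l₁ ++ x :: l₂ ∧ ∀ y ∈ l₁.getLast?, y ∈ N
  have hI : ∀ x, x ∈ I ↔ ∃ l₁ l₂, B = l₁ ++ x :: l₂ ∧ ∀ y ∈ l₁.getLast?, y ∈ N := by simp [I]
  have hIB : ∀ x ∈ I, x ∈ B := by
    intro x hx
    obtain ⟨l₁, l₂, h, -⟩ := (hI x).1 hx
    simp [h]
  have hIv : ∀ x ∈ I, x ∉ S → blue.Adj v x := fun x hx hxS =>
    hSv x (by rintro rfl; exact hvB (hIB _ hx)) hxS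
  have hcount := add_card_le_card hB.nodup N I le_rfl (List.length_pos_iff.2 hBne)
    (fun l₁ x l₂ h hlen => (hI x).2 ⟨l₁, l₂, h, by
      have : l₁ = [] := by simpa using hlen
      simp [this]⟩)
    (fun l₁ x l₂ h hlen => by simp at hlen)
    (fun l₁ x y l₂ h hx => (hI y).2 ⟨l₁ ++ [x], l₂, by simp [h], by simpa using hx⟩)
    (fun l₁ x h hx => by
      have := hBv (B ++ [z]) (isPathList_append.2 ⟨hB, isPathList_singleton z,
        fun y hy hyz => hzB (by simp at hyz; rwa [← hyz]),
        by simpa [h] using ((hmemN x).1 hx).symm⟩) (by simp [hvB, hzv.symm])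
      simp at this)
  rw [Finset.filter_true_of_mem hIB] at hcount
  have h6 := Finset.card_filter_add_card_filter_not (s := S) (· ∈ B)
  have hsub : ∀ u ∈ N, u = v ∨ u ∈ N.filter (· ∈ B) ∪ (S.filter (· ∉ B)).erase z := by
    intro u hu
    have hzu := ((hmemN u).1 hu).ne'
    by_cases huv : u = v
    · exact Or.inl huv
    by_cases huB : u ∈ B
    · simp [hu, huB]
    · simp [huB, hzu, hout u huB huv]
  have hzS : z ∈ S.filter (· ∉ B) := by simp [hzB, hout z hzB hzv]
  have h7 := Finset.card_erase_of_mem hzS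
  have h8 := Finset.card_pos.2 ⟨z, hzS⟩
  have h9 := Finset.card_union_le (N.filter (· ∈ B)) ((S.filter (· ∉ B)).erase z)
  by_cases hvz : blue.Adj z v
  · have h10 : N ⊆ insert v (N.filter (· ∈ B) ∪ (S.filter (· ∉ B)).erase z) := fun u hu =>
      Finset.mem_insert.2 (hsub u hu)
    have h11 := (Finset.card_le_card h10).trans (Finset.card_insert_le _ _)
    obtain ⟨a, haI, haS⟩ := Finset.exists_mem_notMem_of_card_lt_card
      (show (S.filter (· ∈ B)).card < I.card by omega)
    have haS : a ∉ S := fun h => haS (Finset.mem_filter.2 ⟨h, hIB a haI⟩)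
    obtain ⟨l₁, l₂, h, hl⟩ := (hI a).1 haI
    have := hB.length_insert_le hBmax h (isPathList_pair hvz) (by simp [hzB, hvB])
      (fun y hy => by simpa using ((hmemN y).1 (hl y hy)).symm) (by simpa using hIv a haI haS)
    simp at this
  · have h10 : N ⊆ N.filter (· ∈ B) ∪ (S.filter (· ∉ B)).erase z := fun u hu =>
      (hsub u hu).resolve_left fun h => hvz ((hmemN v).1 (h ▸ hu))
    have h11 := Finset.card_le_card h10
    have h12 := Finset.le_card_sdiff (S.filter (· ∈ B)) I
    obtain ⟨a, b, ha, hb, hab⟩ := Finset.one_lt_card_iff.1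
      (show 1 < (I \ S.filter (· ∈ B)).card by omega)
    have hmem : ∀ a ∈ I \ S.filter (· ∈ B), a ∈ I ∧ blue.Adj v a := by
      intro a ha
      obtain ⟨haI, haS⟩ := Finset.mem_sdiff.1 ha
      exact ⟨haI, hIv a haI fun h => haS (Finset.mem_filter.2 ⟨h, hIB a haI⟩)⟩
    have key : ∀ a b l₁ m l₂, B = l₁ ++ a :: m ++ b :: l₂ → (∀ y ∈ l₁.getLast?, y ∈ N) →
        (∀ y ∈ (l₁ ++ a :: m).getLast?, y ∈ N) → blue.Adj v a → blue.Adj v b → False := by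
      intro a b l₁ m l₂ h h1 h2 hva hvb
      rw [h] at hB hzB hvB
      have hlen := hBmax _ (hB.rotate (w := [z]) (w' := [v]) (by simp) (isPathList_singleton z)
        (isPathList_singleton v) (by simp) (by simpa [and_assoc, hzv] using hzB)
        (by simpa [and_assoc] using hvB)
        (by simpa using fun y hy => ((hmemN y).1 (h1 y hy)).symm)
        (fun x hx y hy => by
          obtain rfl : z = x := by simpa using hx
          exact (hmemN y).1 (h2 y (by rw [List.getLast?_append, hy]; rfl)))
        (by simpa using hva.symm) (by simpa using hvb))
      simp [h] at hlen
      omega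
    obtain ⟨haI, hva⟩ := hmem a ha
    obtain ⟨hbI, hvb⟩ := hmem b hb
    obtain ⟨l₁, l₂, h1, h1'⟩ := (hI a).1 haI
    obtain ⟨l₃, l₄, h2, h2'⟩ := (hI b).1 hbI
    rcases append_cons_eq_append_cons (h1.symm.trans h2) hab with ⟨m, rfl, rfl⟩ | ⟨m, rfl, rfl⟩
    · exact key a b l₁ m l₄ (by simpa using h1) h1' h2' hva hvb
    · exact key b a l₃ m l₂ (by simpa using h2) h2' h1' hvb hva

open scoped Classical in
/-- If `v` has minimal red degree among the vertices missed by a longest red path, and no vertex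
missed by a longest blue path has smaller blue degree, then removing `v` shortens the longest blue
paths by at least two. -/
theorem length_add_two_le_of_minimal [Fintype V] {red blue : SimpleGraph V}
    (hcov : ∀ x y, x ≠ y → red.Adj x y ∨ blue.Adj x y) {R : List V} {v : V} {a : ℕ}
    (hR : IsPathList red R) (hRmax : ∀ P, IsPathList red P → P.length ≤ R.length) (hvR : v ∉ R)
    (hred : ∀ z, z ∉ R →
      (Finset.univ.filter (red.Adj v)).card ≤ (Finset.univ.filter (red.Adj z)).card)
    (ha : ∀ P, IsPathList blue P → P.length ≤ a)
    (hblue : ∀ P, IsPathList blue P → P.length = a → ∀ z, z ∉ P →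
      (Finset.univ.filter (red.Adj v)).card ≤ (Finset.univ.filter (blue.Adj z)).card)
    (haV : a < Fintype.card V) {B : List V} (hB : IsPathList blue B) (hvB : v ∉ B) :
    B.length + 2 ≤ a := by
  have hlt : ∀ P, IsPathList blue P → v ∉ P → P.length < a := by
    intro P hP hvP
    by_contra! h
    exact (mem_or_mem_of_longest hcov hR hRmax hP (fun Q hQ => (ha Q hQ).trans h) v).elim hvR hvP
  by_contra! hcon
  have hBa : B.length + 1 = a := by
    have := hlt B hB hvB
    omega
  subst hBa
  have hBv : ∀ P, IsPathList blue P → v ∉ P → P.length ≤ B.length := fun P hP hvP =>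
    Nat.lt_succ_iff.1 (hlt P hP hvP)
  set S : Finset V := Finset.univ.filter (red.Adj v) with hSdef
  have hS : ∀ x, x ∈ S ↔ red.Adj v x := by simp [hSdef]
  have hSv : ∀ x, x ≠ v → x ∉ S → blue.Adj v x := fun x hxv hxS =>
    (hcov v x hxv.symm).resolve_left fun h => hxS ((hS x).2 h)
  have hSB : ∀ x ∈ B, x ∉ S → blue.Adj v x := fun x hx hxS =>
    hSv x (by rintro rfl; exact hvB hx) hxS
  have hins : ∀ l₁ l₂, B = l₁ ++ l₂ → (∀ x ∈ l₁.getLast?, x ∉ S) → (∀ x ∈ l₂.head?, x ∉ S) →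
      ∀ z, z ∉ B → z ≠ v → S.card ≤ (Finset.univ.filter (blue.Adj z)).card := by
    intro l₁ l₂ h h₁ h₂ z hzB hzv
    have hP : IsPathList blue (l₁ ++ [v] ++ l₂) := by
      refine IsPathList.insert (h ▸ hB) (isPathList_singleton v) (by simp) ?_ ?_ ?_
      · simpa [h] using hvB
      · intro x hx y hy
        obtain rfl : v = y := by simpa using hy
        exact (hSB x (by simp [h, List.mem_of_mem_getLast? hx]) (h₁ x hx)).symm
      · intro x hx y hy
        obtain rfl : v = x := by simpa using hx
        exact hSB y (by simp [h, List.mem_of_mem_head? hy]) (h₂ y hy)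
    refine hblue _ hP (by simp [h]; omega) z ?_
    simp [h] at hzB ⊢
    tauto
  obtain ⟨H, hvH, hHR, hHcl, hHc⟩ := exists_component red R hvR
  let Z : Finset V := Finset.univ.filter fun x => x ∉ H ∧ ∀ h ∈ H, ¬ red.Adj h x
  have hZ : ∀ x, x ∈ Z ↔ x ∉ H ∧ ∀ h ∈ H, ¬ red.Adj h x := by simp [Z]
  have hZcard : S.card < Z.card :=
    lt_card_of_component hR hRmax hHR hvH hHcl hHc (fun h hh => hred h (hHR h hh)) hZ
  have hZv : ∀ x ∈ Z, x ≠ v := by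
    rintro _ hx rfl
    exact ((hZ _).1 hx).1 hvH
  have hZS : ∀ x ∈ Z, x ∉ S := fun x hx h => ((hZ x).1 hx).2 v hvH ((hS x).1 h)
  have hZcount : B ≠ [] → (∀ d s, B = d :: s → d ∈ S) → (∀ p d, B = p ++ [d] → d ∈ S) →
      (∀ p x y s, B = p ++ x :: y :: s → x ∉ S → y ∈ S) → ∃ z ∈ Z, z ∉ B := by
    intro hne hhead hlast hcons
    by_contra! hZB
    have h := add_card_le_card hB.nodup Z S le_rfl (List.length_pos_iff.2 hne)
      (fun p d s h hlen => by
        obtain rfl : p = [] := by simpa using hlen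
        exact hhead d s h)
      (fun p d s h hlen => by simp at hlen)
      (fun p x y s h hx => hcons p x y s h (hZS x hx))
      (fun p d h hd => hZS d hd (hlast p d h))
    rw [Finset.filter_true_of_mem hZB] at h
    have := Finset.card_filter_le S (· ∈ B)
    omega
  by_cases hM : ∃ z, z ∉ B ∧ z ≠ v ∧ z ∉ S
  · obtain ⟨z₀, hz₀B, hz₀v, hz₀S⟩ := hM
    by_cases hZZ : ∃ p x y s, B = p ++ x :: y :: s ∧ x ∉ S ∧ y ∉ S
    · obtain ⟨p, x, y, s, h, hx, hy⟩ := hZZ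
      obtain ⟨z, hzB, hzv, hz⟩ := exists_degree_lt_of_consecutive hB hvB ha hSv h hx hy
        hz₀B hz₀v hz₀S
      exact hz.not_ge (hins (p ++ [x]) (y :: s) (by simp [h]) (by simpa using hx)
        (by simpa using hy) z hzB hzv)
    · push Not at hZZ
      have hvz₀ := hSv z₀ hz₀v hz₀S
      have hne : B ≠ [] := by
        rintro rfl
        have := ha _ (isPathList_pair hvz₀)
        simp at this
      have hhead : ∀ d s, B = d :: s → d ∈ S := by
        intro d s h
        by_contra hd
        have := hB.length_insert_le ha (l₁ := []) (l₂ := d :: s) h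
          (isPathList_pair hvz₀.symm) (by simp [hvB, hz₀B]) (by simp)
          (by simpa using hSB d (by simp [h]) hd)
        simp at this
      have hlast : ∀ p d, B = p ++ [d] → d ∈ S := by
        intro p d h
        by_contra hd
        have := hB.length_insert_le ha (l₁ := p ++ [d]) (l₂ := []) (by simp [h])
          (isPathList_pair hvz₀) (by simp [hvB, hz₀B])
          (by simpa using (hSB d (by simp [h]) hd).symm) (by simp)
        simp at this
      obtain ⟨z, hzZ, hzB⟩ := hZcount hne hhead hlast fun p x y s h hx => hZZ p x y s h hx
      have hvz := hSv z (hZv z hzZ) (hZS z hzZ)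
      have hzH : ∀ h ∈ H, blue.Adj z h := fun h hh =>
        (hcov z h (by rintro rfl; exact ((hZ _).1 hzZ).1 hh)).resolve_left
          fun hadj => ((hZ z).1 hzZ).2 h hh hadj.symm
      have hpair : ∀ y ∈ [v, z], y ∉ B := by simp [hvB, hzB]
      let T : Finset V := Finset.univ.filter fun x => x ∈ R ∧ ∃ h ∈ H, red.Adj h x
      have hT : ∀ x, x ∈ T ↔ x ∈ R ∧ ∃ h ∈ H, red.Adj h x := by simp [T]
      have hST : ∀ x ∈ S, x ∉ H → x ∈ T := by
        intro x hx hxH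
        have hx := (hS x).1 hx
        refine (hT x).2 ⟨?_, v, hvH, hx⟩
        by_contra hxR
        exact hxH (hHcl v hvH x hx hxR)
      have hcount := add_card_le_card hB.nodup Z T le_rfl (List.length_pos_iff.2 hne)
        (fun p d s h hlen => by
          obtain rfl : p = [] := by simpa using hlen
          refine hST d (hhead d s h) fun hdH => ?_
          have := hB.length_insert_le ha (l₁ := []) (l₂ := d :: s) h
            (isPathList_pair hvz) hpair (by simp) (by simpa using hzH d hdH)
          simp at this)
        (fun p d s h hlen => by simp at hlen)
        (fun p x y s h hx => by
          refine hST y (hZZ p x y s h (hZS x hx)) fun hyH => ?_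
          have := hB.length_insert_le ha (l₁ := p ++ [x]) (l₂ := y :: s) (by simp [h])
            (isPathList_pair hvz) hpair (by simpa using (hSv x (hZv x hx) (hZS x hx)).symm)
            (by simpa using hzH y hyH)
          simp at this)
        (fun p d h hd => hZS d hd (hlast p d h))
      obtain ⟨I, hI, hI'⟩ := exists_successor_set hcov hR hRmax hB ha hHR hvH hvB hHc hT
      have hIZ : I ⊆ Z.filter (· ∈ B) := by
        intro x hx
        obtain ⟨hxR, hxB, hxH⟩ := hI' x hx
        exact Finset.mem_filter.2 ⟨(hZ x).2 ⟨fun h => hHR x h hxR, hxH⟩, hxB⟩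
      have h1 := Finset.card_le_card hIZ
      have h2 := Finset.card_filter_le T (· ∈ B)
      omega
  · push Not at hM
    have hZB : ∀ x ∈ Z, x ∈ B := by
      intro x hx
      by_contra hxB
      exact hZS x hx (hM x hxB (hZv x hx))
    obtain ⟨x, hx⟩ := Finset.card_pos.1 (Nat.zero_lt_of_lt hZcard)
    have hne : B ≠ [] := List.ne_nil_of_mem (hZB x hx)
    obtain ⟨z, hz⟩ : ∃ z, z ∉ insert v B.toFinset := by
      by_contra! h
      have h1 := Finset.card_insert_le v B.toFinset
      have h2 := B.toFinset_card_le
      rw [Finset.eq_univ_iff_forall.2 h, Finset.card_univ] at h1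
      omega
    obtain ⟨hzv, hzB⟩ : z ≠ v ∧ z ∉ B := by simpa using hz
    have hdeg := degree_lt_of_forall_mem hB hvB hne ha hBv hSv hM hzB hzv
    have hno : ∀ l₁ l₂, B = l₁ ++ l₂ → (∀ x ∈ l₁.getLast?, x ∉ S) → ¬ ∀ x ∈ l₂.head?, x ∉ S :=
      fun l₁ l₂ h h₁ h₂ => hdeg.not_ge (hins l₁ l₂ h h₁ h₂ z hzB hzv)
    obtain ⟨u, huZ, huB⟩ := hZcount hne
      (fun d s h => by simpa using hno [] (d :: s) h (by simp))
      (fun p d h => by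
        by_contra hd
        exact hno (p ++ [d]) [] (by simp [h]) (by simpa using hd) (by simp))
      (fun p x y s h hx => by
        simpa using hno (p ++ [x]) (y :: s) (by simp [h]) (by simpa using hx))
    exact huB (hZB u huZ)

theorem IsPathList.map_val {s : Set V} {P : List s}
    (hP : IsPathList (G.induce s) P) : IsPathList G (P.map Subtype.val) :=
  ⟨hP.nodup.map Subtype.val_injective, (List.isChain_map _).2 (hP.chain.imp fun _ _ h => h)⟩

/-- `a` is the number of vertices of a longest path of `G`. -/
structure IsLongestPathLength (G : SimpleGraph V) (a : ℕ) : Prop where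
  exists_eq : ∃ P, IsPathList G P ∧ P.length = a
  le : ∀ P, IsPathList G P → P.length ≤ a

theorem exists_isLongestPathLength [Fintype V] (G : SimpleGraph V) :
    ∃ a, IsLongestPathLength G a := by
  obtain ⟨W, hW, hmax⟩ := exists_longest (IsPathList G) (fun _ h => h.nodup) isPathList_nil
  exact ⟨W.length, ⟨W, hW, rfl⟩, hmax⟩

/-- If any two of the graphs `G i` cover the complete graph, then deleting a suitable vertex `v` keeps
the length of a longest path in one of them and decreases it by at least two in all others. -/
theorem exists_vertex_shortening [Fintype V] {ι : Type*} {G : ι → SimpleGraph V} {I : Finset ι}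
    (hI : I.Nonempty)
    (hcov : ∀ i ∈ I, ∀ k ∈ I, i ≠ k → ∀ x y, x ≠ y → (G i).Adj x y ∨ (G k).Adj x y)
    {a : ι → ℕ} (ha : ∀ i ∈ I, IsLongestPathLength (G i) (a i))
    (haV : ∀ i ∈ I, a i < Fintype.card V) :
    ∃ i ∈ I, ∃ v, (∃ R, IsPathList (G i) R ∧ R.length = a i ∧ v ∉ R) ∧
      ∀ k ∈ I, k ≠ i → ∀ B, IsPathList (G k) B → v ∉ B → B.length + 2 ≤ a k := by
  classical
  let deg : ι → V → ℕ := fun i z => (Finset.univ.filter ((G i).Adj z)).card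
  let s : Set ℕ := {d | ∃ i ∈ I, ∃ R, IsPathList (G i) R ∧ R.length = a i ∧ ∃ z ∉ R, deg i z = d}
  have hs : s.Nonempty := by
    obtain ⟨i, hi⟩ := hI
    obtain ⟨R, hR, hRa⟩ := (ha i hi).exists_eq
    obtain ⟨z, hz⟩ : ∃ z, z ∉ R := by
      by_contra! h
      have h1 := R.toFinset_card_le
      rw [Finset.eq_univ_iff_forall.2 fun x => List.mem_toFinset.2 (h x), Finset.card_univ] at h1
      have := haV i hi
      omega
    exact ⟨_, i, hi, R, hR, hRa, z, hz, rfl⟩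
  obtain ⟨i, hi, R, hR, hRa, v, hv, hdeg⟩ := Nat.sInf_mem hs
  refine ⟨i, hi, v, ⟨R, hR, hRa, hv⟩, fun k hk hki B hB hvB => ?_⟩
  refine length_add_two_le_of_minimal (hcov i hi k hk hki.symm) hR
    (fun P hP => hRa ▸ (ha i hi).le P hP) hv (fun z hz => ?_) (ha k hk).le
    (fun P hP hPa z hz => ?_) (haV k hk) hB hvB
  · convert hdeg.le.trans (Nat.sInf_le ⟨i, hi, R, hR, hRa, z, hz, rfl⟩)
  · convert hdeg.le.trans (Nat.sInf_le ⟨k, hk, P, hP, hPa, z, hz, rfl⟩)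

theorem sum_two_pow_of_injOn {ι : Type*} {I : Finset ι} {π : ι → ℕ} (hinj : Set.InjOn π I)
    (hlt : ∀ i ∈ I, π i < I.card) : ∑ i ∈ I, 2 ^ π i + 1 = 2 ^ I.card := by
  classical
  have himg : I.image π = Finset.range I.card :=
    Finset.eq_of_subset_of_card_le
      (fun x hx => by
        obtain ⟨i, hi, rfl⟩ := Finset.mem_image.1 hx
        exact Finset.mem_range.2 (hlt i hi))
      (by rw [Finset.card_image_of_injOn hinj, Finset.card_range])
  rw [← Finset.sum_image (f := fun x => 2 ^ x) hinj, himg]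
  exact Nat.geomSum_eq (le_refl 2) _ ▸ by
    have := Nat.one_le_two_pow (n := I.card)
    omega

open Function in
/-- If any two of the graphs `G i` on `n` vertices cover the complete graph, then the numbers of
vertices missed by their longest paths have, with distinct powers of two as weights, a sum below
`n`. -/
theorem exists_weights {ι : Type*} (I : Finset ι) (hI : I.Nonempty) (n : ℕ) :
    ∀ {V : Type*} [Fintype V], Fintype.card V = n → ∀ {G : ι → SimpleGraph V},
    (∀ i ∈ I, ∀ k ∈ I, i ≠ k → ∀ x y, x ≠ y → (G i).Adj x y ∨ (G k).Adj x y) →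
    ∀ {a : ι → ℕ}, (∀ i ∈ I, IsLongestPathLength (G i) (a i)) → (∀ i ∈ I, a i < n) →
    ∃ π : ι → ℕ, Set.InjOn π I ∧ (∀ i ∈ I, π i < I.card) ∧
      ∑ i ∈ I, 2 ^ π i * (n - a i) < n := by
  classical
  induction n generalizing I with
  | zero =>
    intro V _ _ G _ a _ haV
    obtain ⟨i, hi⟩ := hI
    exact absurd (haV i hi) (Nat.not_lt_zero _)
  | succ n ih =>
    intro V _ hV G hcov a ha haV
    obtain ⟨i, hi, v, ⟨R, hR, hRa, hvR⟩, hB⟩ := exists_vertex_shortening hI hcov ha (by rwa [hV])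
    have hV' : Fintype.card ({v}ᶜ : Set V) = n := by
      rw [Fintype.card_compl_set, hV, Fintype.card_unique, Nat.add_sub_cancel]
    choose b hb using fun k => exists_isLongestPathLength ((G k).induce ({v}ᶜ : Set V))
    have hcov' : ∀ i ∈ I, ∀ k ∈ I, i ≠ k → ∀ x y : ({v}ᶜ : Set V), x ≠ y →
        ((G i).induce {v}ᶜ).Adj x y ∨ ((G k).induce {v}ᶜ).Adj x y :=
      fun i hi k hk hik x y hxy => hcov i hi k hk hik x y (Subtype.coe_injective.ne hxy)
    have hbi : b i ≤ a i := by
      obtain ⟨P, hP, hPb⟩ := (hb i).exists_eq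
      simpa [hPb] using (ha i hi).le _ hP.map_val
    have hbk : ∀ k ∈ I, k ≠ i → b k + 2 ≤ a k := by
      intro k hk hki
      obtain ⟨P, hP, hPb⟩ := (hb k).exists_eq
      simpa [hPb] using hB k hk hki _ hP.map_val (by simp)
    have hle : ∀ k ∈ I.erase i, n + 1 - a k + 1 ≤ n - b k := by
      intro k hk
      obtain ⟨hki, hk⟩ := Finset.mem_erase.1 hk
      have := hbk k hk hki
      have := haV k hk
      omega
    have hai : a i < n + 1 := haV i hi
    have herase : ∀ π : ι → ℕ, ∑ k ∈ I.erase i, 2 ^ π k * (n + 1 - a k) +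
        ∑ k ∈ I.erase i, 2 ^ π k ≤ ∑ k ∈ I.erase i, 2 ^ π k * (n - b k) := by
      intro π
      rw [← Finset.sum_add_distrib]
      refine Finset.sum_le_sum fun k hk => ?_
      rw [← Nat.mul_succ]
      exact Nat.mul_le_mul_left _ (hle k hk)
    by_cases hin : a i < n
    · obtain ⟨π, hinj, hlt, hsum⟩ := ih I hI hV' hcov' (fun k _ => hb k) (fun k hk => by
        by_cases hki : k = i
        · subst hki; omega
        · have := hbk k hk hki
          have := haV k hk
          omega)
      refine ⟨π, hinj, hlt, ?_⟩
      have h2 := sum_two_pow_of_injOn hinj hlt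
      have h3 : 2 ^ (π i + 1) ≤ 2 ^ I.card := Nat.pow_le_pow_right two_pos (hlt i hi)
      have h4 := herase π
      have h5 : 2 ^ π i * (n + 1 - a i) ≤ 2 ^ π i * (n - b i) + 2 ^ π i := by
        rw [← Nat.mul_succ]
        exact Nat.mul_le_mul_left _ (by omega)
      rw [← Finset.add_sum_erase _ _ hi] at h2 hsum ⊢
      rw [pow_succ] at h3
      omega
    · have hain : n + 1 - a i = 1 := by omega
      by_cases hIi : (I.erase i).Nonempty
      · obtain ⟨π, hinj, hlt, hsum⟩ := ih (I.erase i) hIi hV'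
          (fun k hk l hl => hcov' k (Finset.mem_of_mem_erase hk) l (Finset.mem_of_mem_erase hl))
          (fun k _ => hb k) (fun k hk => by have := hle k hk; omega)
        have hcard := Finset.card_erase_add_one hi
        have h2 := sum_two_pow_of_injOn hinj hlt
        have h4 := herase π
        have hupd : ∀ k ∈ I.erase i, update π i (I.erase i).card k = π k :=
          fun k hk => update_of_ne (Finset.ne_of_mem_erase hk) _ _
        refine ⟨update π i (I.erase i).card, ?_, ?_, ?_⟩
        · suffices h : Set.InjOn (update π i (I.erase i).card) (insert i (I.erase i) : Finset ι) by
            rwa [Finset.insert_erase hi] at h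
          rw [Finset.coe_insert, Set.injOn_insert (by simp)]
          refine ⟨hinj.congr fun k hk => (hupd k hk).symm, ?_⟩
          rintro ⟨k, hk, hki⟩
          rw [update_self, hupd k hk] at hki
          exact (hlt k hk).ne hki
        · intro k hk
          by_cases hki : k = i
          · subst hki; simp; omega
          · have hk' := Finset.mem_erase.2 ⟨hki, hk⟩
            rw [hupd k hk']
            have := hlt k hk'
            omega
        · rw [← Finset.add_sum_erase _ _ hi, update_self, hain,
            Finset.sum_congr rfl fun k hk => by rw [hupd k hk]]
          omega
      · have hIi' : I = {i} := by
          rw [Finset.not_nonempty_iff_eq_empty] at hIi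
          rw [← Finset.insert_erase hi, hIi]
          rfl
        refine ⟨fun _ => 0, by simp [hIi'], by simp [hIi'], ?_⟩
        have h1 := (ha i hi).le [v] (isPathList_singleton v)
        simp [hIi'] at h1 ⊢
        omega

end PathLists

theorem avoidsPath_of_isPathList {n t ℓ : ℕ} {c : Sym2 (Fin n) → Fin t} {i : Fin t}
    {G : SimpleGraph (Fin n)} (hG : ∀ x y, G.Adj x y → c s(x, y) ≠ i) {P : List (Fin n)}
    (hP : IsPathList G P) (hℓ : ℓ ≤ P.length) : AvoidsPath n t ℓ c i := by
  refine ⟨fun k => P[k.val]'(k.isLt.trans_le hℓ), fun x y hxy => ?_, fun k h => ?_⟩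
  · exact Fin.ext ((hP.nodup.getElem_inj_iff).1 hxy)
  · exact hG _ _ (List.isChain_iff_getElem.1 hP.chain k (h.trans_le hℓ))

/-- A weighted upper bound on the path lengths which forces a path avoiding some colour. -/
theorem isChromRamsey_of_sum_lt {m n : ℕ} (hm : 0 < m) {L : Fin m → ℕ} (hL : Monotone L)
    (hLn : ∀ i, L i ≤ n) (hsum : ∑ i : Fin m, 2 ^ (i : ℕ) * L i + 2 * n < 2 ^ m * (n + 1)) :
    IsChromRamsey m L n := by
  intro c
  by_contra! hc
  let G : Fin m → SimpleGraph (Fin n) := fun i =>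
    { Adj := fun x y => x ≠ y ∧ c s(x, y) ≠ i
      symm := ⟨fun x y h => ⟨h.1.symm, by rw [Sym2.eq_swap]; exact h.2⟩⟩
      loopless := ⟨fun x h => h.1 rfl⟩ }
  choose a ha using fun i => exists_isLongestPathLength (G i)
  have haL : ∀ i, a i < L i := by
    intro i
    obtain ⟨P, hP, hPa⟩ := (ha i).exists_eq
    by_contra! h
    exact hc i (avoidsPath_of_isPathList (G := G i) (fun x y h => h.2) hP (hPa ▸ h))
  have : Nonempty (Fin m) := ⟨⟨0, hm⟩⟩
  obtain ⟨π, hinj, hlt, hπ⟩ := exists_weights (Finset.univ : Finset (Fin m)) Finset.univ_nonempty n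
    (Fintype.card_fin n) (G := G)
    (fun i _ k _ hik x y hxy => by
      by_cases h : c s(x, y) = i
      · exact Or.inr ⟨hxy, h.trans_ne hik⟩
      · exact Or.inl ⟨hxy, h⟩)
    (fun i _ => ha i) (fun i _ => (haL i).trans_le (hLn i))
  have hlt' : ∀ i, π i < m := fun i => by simpa using hlt i (Finset.mem_univ i)
  let σ : Equiv.Perm (Fin m) := Equiv.ofBijective (fun i => ⟨π i, hlt' i⟩)
    (Finite.injective_iff_bijective.1 fun x y hxy =>
      hinj (by simp) (by simp) (Fin.ext_iff.1 hxy))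
  have hanti : Antivary (fun i : Fin m => 2 ^ (i : ℕ)) (fun i => n + 1 - L i) :=
    Monotone.antivary (fun x y h => Nat.pow_le_pow_right two_pos h)
      (fun x y h => Nat.sub_le_sub_left (hL h) _)
  have h1 := hanti.sum_smul_le_sum_comp_perm_smul (σ := σ)
  have h2 : ∑ i, 2 ^ (σ i : ℕ) * (n + 1 - L i) ≤ ∑ i, 2 ^ π i * (n - a i) :=
    Finset.sum_le_sum fun i _ => Nat.mul_le_mul_left _ (by have := haL i; omega)
  have h3 : ∑ i : Fin m, 2 ^ (i : ℕ) * (n + 1 - L i) + ∑ i : Fin m, 2 ^ (i : ℕ) * L i =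
      (∑ i : Fin m, 2 ^ (i : ℕ)) * (n + 1) := by
    rw [← Finset.sum_add_distrib, Finset.sum_mul]
    refine Finset.sum_congr rfl fun i _ => ?_
    rw [← mul_add, Nat.sub_add_cancel ((hLn i).trans n.le_succ)]
  have h4 := sum_two_pow_of_injOn (I := (Finset.univ : Finset (Fin m))) (π := fun i => (i : ℕ))
    Fin.val_injective.injOn (by simp)
  rw [Finset.card_univ, Fintype.card_fin] at h4
  rw [← h4, add_mul] at hsum
  simp only [smul_eq_mul] at h1
  omega

theorem sum_succAbove_add_le {m : ℕ} {ℓ : Fin (m + 1) → ℕ} (hℓ : Monotone ℓ) (j : Fin (m + 1)) :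
    ∑ i : Fin m, 2 ^ (i : ℕ) * ℓ (j.succAbove i) + 2 ^ m * ℓ j ≤
      ∑ i : Fin (m + 1), 2 ^ (i : ℕ) * ℓ i := by
  have hterm : ∀ i : Fin m, 2 ^ (i : ℕ) * ℓ (j.succAbove i) + 2 ^ (j.succAbove i : ℕ) * ℓ j ≤
      2 ^ (j.succAbove i : ℕ) * ℓ (j.succAbove i) + 2 ^ (i : ℕ) * ℓ j := by
    intro i
    rcases lt_or_ge i.castSucc j with h | h
    · simp [Fin.succAbove_of_castSucc_lt _ _ h]
    · rw [Fin.succAbove_of_le_castSucc _ _ h]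
      have := Nat.mul_le_mul_left (2 ^ (i : ℕ)) (hℓ (h.trans i.castSucc_lt_succ.le))
      rw [Fin.val_succ, pow_succ]
      linarith
  have h1 := Finset.sum_le_sum fun i (_ : i ∈ Finset.univ) => hterm i
  simp only [Finset.sum_add_distrib, ← Finset.sum_mul] at h1
  have h2 := Fin.sum_univ_succAbove (fun i : Fin (m + 1) => 2 ^ (i : ℕ)) j
  have h3 := Fin.sum_univ_castSucc (fun i : Fin (m + 1) => 2 ^ (i : ℕ))
  rw [Fin.sum_univ_succAbove _ j]
  simp only [Fin.val_castSucc, Fin.val_last] at h3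
  have h4 : 2 ^ (j : ℕ) + ∑ i : Fin m, 2 ^ (j.succAbove i : ℕ) =
      ∑ i : Fin m, 2 ^ (i : ℕ) + 2 ^ m := h2.symm.trans h3
  have h5 := congrArg (· * ℓ j) h4
  simp only [add_mul] at h5
  omega

/-- Claim 3: if `2q + 2 ≤ ℓ₁ ≤ ⋯ ≤ ℓ_t` and `s(ℓ₁,…,ℓ_t) = q + ℓ_j - 1`, then
`p(ℓ₁ - 2q, …, ℓ_{j-1} - 2q, ℓ_{j+1} - 2q, …, ℓ_t - 2q) ≤ max(ℓ_t - 2q, ℓ_j - 1)`,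
where `p` here refers to `(t-1)`-colourings with the `t-1` listed path lengths. -/
theorem pRamsey_delete_le (t : ℕ) (ht : 3 ≤ t) (q : ℕ) (hq : 1 ≤ q) (ℓ : Fin t → ℕ)
    (hmono : Monotone ℓ) (h2 : 2 * q + 2 ≤ ℓ ⟨0, by omega⟩) (j : Fin t)
    (hs : sVal t ℓ = q + ℓ j - 1) :
    pRamsey (t - 1)
        (fun i => (if (i : ℕ) < (j : ℕ) then ℓ ⟨(i : ℕ), by have := i.isLt; omega⟩
          else ℓ ⟨(i : ℕ) + 1, by have := i.isLt; omega⟩) - 2 * q)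
      ≤ max (ℓ ⟨t - 1, by omega⟩ - 2 * q) (ℓ j - 1) := by
  obtain ⟨m, rfl⟩ : ∃ m, t = m + 1 := ⟨t - 1, by omega⟩
  have hL : (fun i : Fin (m + 1 - 1) =>
      (if (i : ℕ) < (j : ℕ) then ℓ ⟨(i : ℕ), by have := i.isLt; omega⟩
        else ℓ ⟨(i : ℕ) + 1, by have := i.isLt; omega⟩) - 2 * q) =
      fun i : Fin m => ℓ (j.succAbove i) - 2 * q := by
    funext i
    rw [Fin.succAbove]
    simp only [Fin.lt_def, Fin.val_castSucc]
    split_ifs <;> rfl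
  rw [hL]
  have hlast : ∀ i, ℓ i ≤ ℓ ⟨m + 1 - 1, by omega⟩ := fun i => hmono (Fin.le_last i)
  have hfirst : ∀ i, 2 * q ≤ ℓ i := fun i =>
    (Nat.le_of_add_right_le h2).trans (hmono (Fin.zero_le i))
  refine Nat.sInf_le (isChromRamsey_of_sum_lt (by omega)
    (fun x y h => Nat.sub_le_sub_right (hmono ((Fin.strictMono_succAbove j).monotone h)) _)
    (fun i => le_max_of_le_left (Nat.sub_le_sub_right (hlast _) _)) ?_)
  set n := max (ℓ ⟨m + 1 - 1, by omega⟩ - 2 * q) (ℓ j - 1)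
  have hn : ℓ j ≤ n + 1 := Nat.le_add_of_sub_le (le_max_right _ _)
  have h1 := sum_succAbove_add_le hmono j
  have h2m : 4 ≤ 2 ^ m := Nat.pow_le_pow_right two_pos (show 2 ≤ m by omega)
  have hS : ∑ i : Fin (m + 1), 2 ^ (i : ℕ) * ℓ i ≤ (2 * 2 ^ m - 2) * (q + ℓ j) + 1 := by
    have h : sVal (m + 1) ℓ < q + ℓ j := by omega
    rw [sVal, Nat.div_lt_iff_lt_mul (by rw [pow_succ]; omega), pow_succ, mul_comm (2 ^ m),
      mul_comm (q + ℓ j)] at h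
    omega
  have h3 : ∑ i : Fin m, 2 ^ (i : ℕ) * (ℓ (j.succAbove i) - 2 * q) +
      (∑ i : Fin m, 2 ^ (i : ℕ)) * (2 * q) = ∑ i : Fin m, 2 ^ (i : ℕ) * ℓ (j.succAbove i) := by
    rw [Finset.sum_mul, ← Finset.sum_add_distrib]
    refine Finset.sum_congr rfl fun i _ => ?_
    rw [← mul_add, Nat.sub_add_cancel (hfirst _)]
  have h4 := sum_two_pow_of_injOn (I := (Finset.univ : Finset (Fin m))) (π := fun i => (i : ℕ))
    Fin.val_injective.injOn (by simp)
  rw [Finset.card_univ, Fintype.card_fin] at h4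
  obtain ⟨M, hM⟩ : ∃ M, 2 ^ m = M + 2 := ⟨2 ^ m - 2, by omega⟩
  have h5 : ∑ i : Fin m, 2 ^ (i : ℕ) = M + 1 := by omega
  rw [h5] at h3
  change ∑ i : Fin m, 2 ^ (i : ℕ) * (ℓ (j.succAbove i) - 2 * q) + 2 * n < 2 ^ m * (n + 1)
  rw [hM] at h1 hS ⊢
  rw [show 2 * (M + 2) - 2 = 2 * M + 2 by omega] at hS
  nlinarith [Nat.mul_le_mul_left M hn]
end

section
/- Let t ≥ 3, let q ≥ 1 be an integer, let 2q + 2 ≤ ℓ₁ ≤ ℓ₂ ≤ ... ≤ ℓ_t be integers, fix j ∈ {1,...,t}, and assume s(ℓ₁,...,ℓ_t) = q + ℓ_j − 1. Then ⌊((ℓ₁ − 2q) + 2(ℓ₂ − 2q) + ... + 2^{j−2}(ℓ_{j−1} − 2q) + 2^{j−1}(ℓ_{j+1} − 2q) + ... + 2^{t−2}(ℓ_t − 2q) − 2)/(2^{t−1} − 2)⌋ ≤ ℓ_j − 1. -/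
theorem Fin.sum_two_pow (m : ℕ) : ∑ i : Fin m, 2 ^ (i : ℕ) + 1 = 2 ^ m := by
  rw [Fin.sum_univ_eq_sum_range (fun i => 2 ^ i) m, Nat.geomSum_eq le_rfl]
  have := Nat.one_le_two_pow (n := m)
  omega

/-- Deleting the term `ℓ j` from a dyadically weighted sum of a monotone sequence, and shifting
the later weights down, decreases the sum by at least `2 ^ m * ℓ j`. -/
theorem Monotone.sum_two_pow_mul_succAbove_add_le {m : ℕ} {ℓ : Fin (m + 1) → ℕ}
    (hmono : Monotone ℓ) (j : Fin (m + 1)) :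
    ∑ i : Fin m, 2 ^ (i : ℕ) * ℓ (j.succAbove i) + 2 ^ m * ℓ j ≤
      ∑ i : Fin (m + 1), 2 ^ (i : ℕ) * ℓ i := by
  have hterm : ∀ i : Fin m,
      2 ^ (i : ℕ) * ℓ (j.succAbove i) + 2 ^ (j.succAbove i : ℕ) * ℓ j ≤
        2 ^ (j.succAbove i : ℕ) * ℓ (j.succAbove i) + 2 ^ (i : ℕ) * ℓ j := by
    intro i
    rcases lt_or_ge i.castSucc j with h | h
    · simp [Fin.succAbove_of_castSucc_lt _ _ h]
    · rw [Fin.succAbove_of_le_castSucc _ _ h, Fin.val_succ, pow_succ]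
      have hle : ℓ j ≤ ℓ i.succ := hmono (h.trans i.castSucc_lt_succ.le)
      nlinarith [Nat.mul_le_mul_left (2 ^ (i : ℕ)) hle]
  have hsum := Finset.sum_le_sum fun i (_ : i ∈ Finset.univ) => hterm i
  simp only [Finset.sum_add_distrib, ← Finset.sum_mul] at hsum
  have hm := Fin.sum_two_pow m
  have hm' := Fin.sum_two_pow (m + 1)
  rw [Fin.sum_univ_succAbove _ j] at hm' ⊢
  have hpow : ∑ i : Fin m, 2 ^ (j.succAbove i : ℕ) + 2 ^ (j : ℕ) =
      ∑ i : Fin m, 2 ^ (i : ℕ) + 2 ^ m := by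
    rw [pow_succ] at hm'
    omega
  have hmul := congrArg (· * ℓ j) hpow
  simp only [add_mul] at hmul
  omega

/-- Claim 3 (arithmetic part): if `2q + 2 ≤ ℓ₁ ≤ ⋯ ≤ ℓ_t` and `s(ℓ₁,…,ℓ_t) = q + ℓ_j - 1`,
then the value `s` of the `t-1` lengths obtained by deleting `ℓ_j` and subtracting `2q` from
the rest is at most `ℓ_j - 1`. -/
theorem sVal_delete_le (t : ℕ) (ht : 3 ≤ t) (q : ℕ) (hq : 1 ≤ q) (ℓ : Fin t → ℕ)
    (hmono : Monotone ℓ) (h2 : 2 * q + 2 ≤ ℓ ⟨0, by omega⟩) (j : Fin t)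
    (hs : sVal t ℓ = q + ℓ j - 1) :
    sVal (t - 1)
        (fun i => (if (i : ℕ) < (j : ℕ) then ℓ ⟨(i : ℕ), by have := i.isLt; omega⟩
          else ℓ ⟨(i : ℕ) + 1, by have := i.isLt; omega⟩) - 2 * q)
      ≤ ℓ j - 1 := by
  obtain ⟨m, rfl⟩ : ∃ m, t = m + 1 := ⟨t - 1, by omega⟩
  have hdel : (fun i : Fin m => (if (i : ℕ) < (j : ℕ) then ℓ ⟨(i : ℕ), by omega⟩
      else ℓ ⟨(i : ℕ) + 1, by omega⟩) - 2 * q) = fun i => ℓ (j.succAbove i) - 2 * q := by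
    funext i
    simp only [Fin.succAbove, Fin.lt_def, Fin.val_castSucc]
    split_ifs <;> rfl
  refine (congrArg (sVal m) hdel).trans_le ?_
  have hge : ∀ i, 2 * q + 2 ≤ ℓ i := fun i => h2.trans (hmono (Fin.zero_le i))
  have hshift : ∑ i : Fin m, 2 ^ (i : ℕ) * (ℓ (j.succAbove i) - 2 * q) +
      (∑ i : Fin m, 2 ^ (i : ℕ)) * (2 * q) = ∑ i : Fin m, 2 ^ (i : ℕ) * ℓ (j.succAbove i) := by
    rw [Finset.sum_mul, ← Finset.sum_add_distrib]
    refine Finset.sum_congr rfl fun i _ => ?_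
    rw [← mul_add, Nat.sub_add_cancel (by have := hge (j.succAbove i); omega)]
  have hdrop := hmono.sum_two_pow_mul_succAbove_add_le j
  have hgeom := Fin.sum_two_pow m
  have hpow : 2 ^ 2 ≤ 2 ^ m := Nat.pow_le_pow_right two_pos (by omega)
  have hj := hge j
  obtain ⟨k, hk⟩ : ∃ k, 2 ^ m = k + 2 := ⟨2 ^ m - 2, by omega⟩
  have hs' : sVal (m + 1) ℓ < q + ℓ j := by omega
  suffices h : sVal m (fun i => ℓ (j.succAbove i) - 2 * q) < ℓ j by omega
  unfold sVal at hs' ⊢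
  rw [Nat.div_lt_iff_lt_mul (by rw [pow_succ]; omega)] at hs'
  rw [Nat.div_lt_iff_lt_mul (by omega)]
  have hgeom' : ∑ i : Fin m, 2 ^ (i : ℕ) = k + 1 := by omega
  have hden : 2 ^ (m + 1) - 2 = 2 * k + 2 := by rw [pow_succ]; omega
  rw [hgeom'] at hshift
  rw [hk] at hdrop ⊢
  rw [hden] at hs'
  rw [Nat.add_sub_cancel]
  have hpos : 0 < ℓ j * k := Nat.mul_pos (by omega) (by omega)
  ring_nf at hs' hshift hdrop hpos ⊢
  omega
end

section
/- Let t ≥ 3 and 4 ≤ ℓ₁ ≤ ℓ₂ ≤ ... ≤ ℓ_t be integers with ℓ_t ≤ s, where s = s(ℓ₁,...,ℓ_t). Let a t-colouring of the complete graph K_s on s vertices be given. If K_s contains a cycle on ℓ_j − 1 vertices avoiding colour j for some j ∈ {1,...,t}, then there exists j' ∈ {1,...,t} such that K_s contains a path on ℓ_{j'} vertices avoiding colour j'. -/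
/-- There is a cycle on `m` vertices in the complete graph on `Fin n`, all of whose edges
avoid colour `i` under the edge-colouring `c`. -/
def AvoidsCycle (n t m : ℕ) (c : Sym2 (Fin n) → Fin t) (i : Fin t) : Prop :=
  ∃ P : Fin m → Fin n, Function.Injective P ∧
    (∀ k : ℕ, ∀ h : k + 1 < m, c s(P ⟨k, Nat.lt_of_succ_lt h⟩, P ⟨k + 1, h⟩) ≠ i) ∧
    ∀ h : 0 < m, c s(P ⟨m - 1, Nat.sub_lt h Nat.one_pos⟩, P ⟨0, h⟩) ≠ i


open Finset

/-- `G` contains a path on at least `p` vertices. -/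
def HasPath {V : Type*} (G : SimpleGraph V) (p : ℕ) : Prop :=
  ∃ l : List V, l.Nodup ∧ l.IsChain G.Adj ∧ p ≤ l.length

theorem countP_add_countP_le {α : Type*} (P Q : α → Bool) (b : α) (l : List α)
    (hlast : P ((b :: l).getLast (by simp)) = false)
    (hchain : (b :: l).IsChain fun x y => ¬(P x = true ∧ Q y = true)) :
    (b :: l).countP P + l.countP Q ≤ l.length := by
  induction l generalizing b with
  | nil => simpa using hlast
  | cons c l ih =>
    rw [List.isChain_cons_cons] at hchain
    have := ih c (by simpa using hlast) hchain.2
    have h1 := hchain.1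
    rw [List.countP_cons, List.countP_cons (p := Q), List.length_cons]
    split_ifs with hP hQ <;> first | omega | exact absurd ⟨hP, hQ⟩ h1

section Closure

variable {V : Type*} {G : SimpleGraph V} {p : ℕ}

open Classical in
/-- Rotations of a path whose only missing edge is `uv` bound the neighbours of `u` and `v`
on the `v`-side of the path. -/
theorem countP_adj_add_countP_adj_le (hG : ¬HasPath G p) {u v : V} {A B : List V}
    (hA : (u :: A).IsChain G.Adj) (hB : (v :: B).IsChain G.Adj)
    (hnd : (u :: A ++ v :: B).Nodup) (hp : p ≤ (u :: A ++ v :: B).length) :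
    (v :: B).countP (fun x => decide (G.Adj u x)) +
      (v :: B).countP (fun x => decide (G.Adj v x)) ≤ B.length := by
  have hA' : (u :: A).reverse.IsChain G.Adj := by
    rw [List.isChain_reverse]
    exact hA.imp fun a b h => h.symm
  rw [List.countP_cons (p := fun x => decide (G.Adj v x))]
  simp only [SimpleGraph.irrefl, decide_false, Bool.false_eq_true, if_false, add_zero]
  apply countP_add_countP_le
  · rw [decide_eq_false_iff_not]
    intro h
    refine hG ⟨(u :: A).reverse ++ (v :: B).reverse, ?_, hA'.append ?_ ?_, ?_⟩
    · refine hnd.perm (List.Perm.append ?_ ?_) <;> exact (List.reverse_perm _).symm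
    · rw [List.isChain_reverse]
      exact hB.imp fun a b h => h.symm
    · intro x hx y hy
      simp only [List.getLast?_reverse, List.head?_cons, Option.mem_some_iff] at hx
      rw [List.head?_reverse, List.getLast?_eq_getLast_of_ne_nil (by simp)] at hy
      simp only [Option.mem_some_iff] at hy
      rw [← hx, ← hy]; exact h
    · simp at hp ⊢; omega
  · rw [List.isChain_iff_forall_rel_of_append_cons_cons]
    rintro x y X Y h ⟨hux, hvy⟩
    simp only [decide_eq_true_eq] at hux hvy
    have h' : v :: B = (X ++ [x]) ++ y :: Y := by simpa using h
    rw [h'] at hB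
    refine hG ⟨(u :: A).reverse ++ ((X ++ [x]).reverse ++ y :: Y), ?_,
      hA'.append (List.IsChain.append ?_ hB.right_of_append ?_) ?_, ?_⟩
    · rw [h'] at hnd
      exact hnd.perm ((List.reverse_perm _).symm.append
        ((List.reverse_perm _).symm.append_right _))
    · rw [List.isChain_reverse]
      exact hB.left_of_append.imp fun a b h => h.symm
    · intro a ha b hb
      have hv : (X ++ [x]).head? = some v := by
        cases X <;> simp_all
      rw [List.getLast?_reverse, hv] at ha
      simp only [List.head?_cons, Option.mem_some_iff] at ha hb
      rw [← ha, ← hb]; exact hvy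
    · intro a ha b hb
      simp only [List.getLast?_reverse, List.head?_cons, Option.mem_some_iff] at ha
      simp at hb
      rw [← ha, ← hb]; exact hux
    · rw [h'] at hp
      simp at hp ⊢; omega

variable [Fintype V]

open Classical in
theorem card_filter_eq_countP_add (P : V → Prop) {l : List V} (hl : l.Nodup) :
    #{x | P x} = l.countP (fun x => decide (P x)) + #{x | P x ∧ x ∉ l} := by
  rw [List.countP_eq_length_filter, ← List.toFinset_card_of_nodup (hl.filter _),
    ← card_union_of_disjoint]
  · congr 1
    ext x
    by_cases h : x ∈ l <;> simp [h]
  · rw [disjoint_left]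
    simp +contextual

open Classical in
theorem degree_add_degree_le_of_broken_path (hG : ¬HasPath G p) {u v : V} {A B : List V}
    (hA : (u :: A).IsChain G.Adj) (hB : (v :: B).IsChain G.Adj)
    (hnd : (u :: A ++ v :: B).Nodup) (hp : p ≤ (u :: A ++ v :: B).length) :
    G.degree u + G.degree v + 2 ≤ Fintype.card V := by
  have h1 := countP_adj_add_countP_adj_le hG hA hB hnd hp
  have h2 := countP_adj_add_countP_adj_le hG hB hA (List.nodup_append_comm.1 hnd)
    (by simpa [add_comm, add_left_comm, add_assoc] using hp)
  have hdis : Disjoint (univ.filter fun x => G.Adj u x ∧ x ∉ u :: A ++ v :: B)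
      (univ.filter fun x => G.Adj v x ∧ x ∉ u :: A ++ v :: B) := by
    rw [disjoint_left]
    intro w hw hw'
    simp only [mem_filter, mem_univ, true_and] at hw hw'
    refine hG ⟨(u :: A).reverse ++ w :: v :: B, ?_, List.IsChain.append ?_ ?_ ?_, ?_⟩
    · have : (w :: (u :: A ++ v :: B)).Nodup := List.nodup_cons.2 ⟨hw.2, hnd⟩
      refine this.perm (List.perm_middle.symm.trans ?_)
      exact (List.reverse_perm _).symm.append_right _
    · rw [List.isChain_reverse]
      exact hA.imp fun a b h => h.symm
    · exact List.isChain_cons_cons.2 ⟨hw'.1.symm, hB⟩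
    · intro a ha b hb
      simp only [List.getLast?_reverse, List.head?_cons, Option.mem_some_iff] at ha hb
      rw [← ha, ← hb]; exact hw.1
    · simp at hp ⊢; omega
  have h3 : #{x | G.Adj u x ∧ x ∉ u :: A ++ v :: B} + #{x | G.Adj v x ∧ x ∉ u :: A ++ v :: B} +
      (u :: A ++ v :: B).length ≤ Fintype.card V := by
    rw [← card_union_of_disjoint hdis, ← List.toFinset_card_of_nodup hnd,
      ← card_union_of_disjoint]
    · exact card_le_univ _
    · rw [disjoint_left]
      intro x hx
      simp only [mem_union, mem_filter, mem_univ, true_and] at hx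
      rw [List.mem_toFinset]
      tauto
  have hd : ∀ w, G.degree w = #{x | G.Adj w x} := fun w => by
    rw [← G.card_neighborFinset_eq_degree, G.neighborFinset_eq_filter]
  rw [hd, hd, card_filter_eq_countP_add _ hnd, card_filter_eq_countP_add (G.Adj v) hnd,
    List.countP_append, List.countP_append]
  simp only [List.length_append, List.length_cons] at h3
  omega

open Classical in
/-- Bondy–Chvátal stability of the length of a longest path. -/
theorem degree_add_degree_le_of_hasPath_sup_edge (hG : ¬HasPath G p) {u v : V}
    (h : HasPath (G ⊔ SimpleGraph.edge u v) p) :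
    G.degree u + G.degree v + 2 ≤ Fintype.card V := by
  obtain ⟨l, hnd, hl, hp⟩ := h
  have hnl : ¬l.IsChain G.Adj := fun h => hG ⟨l, hnd, h, hp⟩
  rw [List.isChain_iff_forall_rel_of_append_cons_cons] at hnl
  push Not at hnl
  obtain ⟨a, b, L₁, L₂, rfl, hab⟩ := hnl
  have hadj := List.isChain_iff_forall_rel_of_append_cons_cons.1 hl rfl
  have hkeep : ∀ l' : List V, l'.IsChain (G ⊔ SimpleGraph.edge u v).Adj → (a ∉ l' ∨ b ∉ l') →
      l'.IsChain G.Adj := by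
    intro l' hl' hab'
    refine hl'.imp_of_mem_imp ?_
    intro x y hx hy hxy
    rw [SimpleGraph.sup_adj, SimpleGraph.edge_adj] at hxy hadj
    grind
  have h' : L₁ ++ a :: b :: L₂ = (L₁ ++ [a]) ++ b :: L₂ := by simp
  rw [h'] at hl hnd hp
  have hdis := List.disjoint_of_nodup_append hnd
  have h1 := hkeep _ hl.left_of_append (Or.inr fun hb => hdis hb (by simp))
  have h2 := hkeep _ hl.right_of_append (Or.inl fun ha => hdis (by simp) ha)
  have h1' : (a :: L₁.reverse).IsChain G.Adj := by
    have : (a :: L₁.reverse) = (L₁ ++ [a]).reverse := by simp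
    rw [this, List.isChain_reverse]
    exact h1.imp fun a b h => h.symm
  have key := degree_add_degree_le_of_broken_path hG h1' h2
    (hnd.perm (by
      have : (a :: L₁.reverse) = (L₁ ++ [a]).reverse := by simp
      rw [this]
      exact (List.reverse_perm _).symm.append_right _))
    (by simp at hp ⊢; omega)
  rw [SimpleGraph.sup_adj, SimpleGraph.edge_adj] at hadj
  rcases hadj with hadj | ⟨⟨rfl, rfl⟩ | ⟨rfl, rfl⟩, -⟩
  · exact absurd hadj hab
  · exact key
  · omega

end Closure

section DegreeCondition

variable {V : Type*}

theorem hasPath_of_injective {W : Type*} {G : SimpleGraph V} {H : SimpleGraph W} {p : ℕ}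
    (f : W → V) (hf : f.Injective) (hadj : ∀ a b, H.Adj a b → G.Adj (f a) (f b))
    (h : HasPath H p) : HasPath G p := by
  obtain ⟨l, hnd, hl, hp⟩ := h
  exact ⟨l.map f, hnd.map hf, List.isChain_map_of_isChain f hadj hl, by simpa using hp⟩

theorem hasPath_of_isClique {G : SimpleGraph V} (B : Finset V)
    (hB : ∀ x ∈ B, ∀ y ∈ B, x ≠ y → G.Adj x y) : HasPath G #B := by
  refine ⟨B.toList, B.nodup_toList, List.Pairwise.isChain ?_, by simp⟩
  refine List.Pairwise.imp_of_mem ?_ B.nodup_toList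
  intro a b ha hb hab
  exact hB a (by simpa using ha) b (by simpa using hb) hab

variable [Fintype V]

open Classical in
/-- A graph without a path on `p` vertices lies in one where non-adjacent vertices have small
degree sum. -/
theorem exists_closure {G : SimpleGraph V} {p : ℕ} (hG : ¬HasPath G p) :
    ∃ M : SimpleGraph V, G ≤ M ∧ ¬HasPath M p ∧
      ∀ u v, u ≠ v → ¬M.Adj u v → M.degree u + M.degree v + 2 ≤ Fintype.card V := by
  obtain ⟨M, hGM, hM⟩ := Finite.exists_le_maximal (p := fun M : SimpleGraph V => ¬HasPath M p) hG
  refine ⟨M, hGM, hM.prop, fun u v huv hadj => ?_⟩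
  refine degree_add_degree_le_of_hasPath_sup_edge hM.prop ?_
  by_contra h
  have := hM.le_of_ge h le_sup_left
  exact hadj (this (by simp [SimpleGraph.edge_adj, huv]))

open Classical in
/-- A weak form of Chvátal's degree condition for Hamiltonian paths. -/
theorem exists_low_degree_of_not_hasPath {G : SimpleGraph V}
    (hG : ¬HasPath G (Fintype.card V)) :
    ∃ h : ℕ, 2 * (h + 1) ≤ Fintype.card V ∧ h + 1 ≤ #{v | G.degree v ≤ h} := by
  obtain ⟨M, hGM, hM, hdeg⟩ := exists_closure hG
  let bad : Finset (V × V) := {e | e.1 ≠ e.2 ∧ ¬M.Adj e.1 e.2 ∧ M.degree e.1 ≤ M.degree e.2}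
  have hne : bad.Nonempty := by
    by_contra h
    rw [not_nonempty_iff_eq_empty] at h
    refine hM (hasPath_of_isClique univ fun x _ y _ hxy => ?_)
    by_contra hadj
    rcases le_total (M.degree x) (M.degree y) with hle | hle
    · have : (x, y) ∈ bad := by simp [bad, hxy, hadj, hle]
      simp [h] at this
    · have : (y, x) ∈ bad := by simp [bad, hxy.symm, M.adj_comm, hadj, hle]
      simp [h] at this
  obtain ⟨⟨u, v⟩, huv, hmax⟩ := exists_max_image bad (fun e => M.degree e.1 + M.degree e.2) hne
  simp only [bad, mem_filter, mem_univ, true_and] at huv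
  have hsum := hdeg u v huv.1 huv.2.1
  refine ⟨M.degree u, by omega, ?_⟩
  have hcompl : #(Mᶜ.neighborFinset v) = Fintype.card V - 1 - M.degree v := by
    rw [SimpleGraph.card_neighborFinset_eq_degree, SimpleGraph.degree_compl]
  have hsub : Mᶜ.neighborFinset v ⊆ ({w | G.degree w ≤ M.degree u} : Finset V) := by
    intro w hw
    rw [SimpleGraph.mem_neighborFinset, SimpleGraph.compl_adj] at hw
    rw [mem_filter]
    refine ⟨mem_univ _, (SimpleGraph.degree_le_of_le hGM).trans ?_⟩
    rcases le_total (M.degree w) (M.degree v) with hle | hle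
    · have := hmax (w, v) (by simp [bad, hw.1.symm, M.adj_comm, hw.2, hle])
      simp at this; omega
    · have := hmax (v, w) (by simp [bad, hw.1, hw.2, hle])
      simp at this; omega
  have := card_le_card hsub
  omega

theorem exists_lower_subset {α : Type*} (A : Finset α) (f : α → ℕ) (m : ℕ) (hm : m ≤ #A) :
    ∃ R ⊆ A, #R = m ∧ ∀ r ∈ R, ∀ v ∈ A, v ∉ R → f r ≤ f v := by
  classical
  induction m with
  | zero => exact ⟨∅, by simp, by simp, by simp⟩
  | succ m ih =>
    obtain ⟨R, hRA, hR, hlow⟩ := ih (by omega)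
    have hne : (A \ R).Nonempty := by
      rw [← card_pos, card_sdiff_of_subset hRA]; omega
    obtain ⟨a, ha, hmin⟩ := exists_min_image (A \ R) f hne
    rw [mem_sdiff] at ha
    refine ⟨insert a R, insert_subset ha.1 hRA, by rw [card_insert_of_notMem ha.2, hR], ?_⟩
    intro r hr v hv hvR
    rw [mem_insert, not_or] at hvR
    rcases mem_insert.1 hr with rfl | hr
    · exact hmin v (mem_sdiff.2 ⟨hv, hvR.2⟩)
    · exact hlow r hr v hv hvR.2

open Classical in
/-- If every path of `G` misses at least `x` vertices, then some `x + h` low-degree vertices have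
at most `h` neighbours each outside a set `A` of low-degree vertices containing them. -/
theorem exists_deficient_set {G : SimpleGraph V} {x : ℕ} (hx : 1 ≤ x) (hxn : x ≤ Fintype.card V)
    (hG : ¬HasPath G (Fintype.card V - x + 1)) :
    ∃ A S : Finset V, ∃ h : ℕ, S ⊆ A ∧ (∀ v ∈ A, 2 * G.degree v + 2 ≤ Fintype.card V) ∧
      #S = h + x ∧ #S + h + 1 ≤ Fintype.card V ∧ ∀ v ∈ S, #{w | G.Adj v w ∧ w ∉ A} ≤ h := by
  obtain ⟨M, hGM, hM, hdeg⟩ := exists_closure hG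
  set n := Fintype.card V with hn
  let A : Finset V := {v | 2 * M.degree v + 2 ≤ n}
  have hA : ∀ v, v ∈ A ↔ 2 * M.degree v + 2 ≤ n := by simp [A]
  have hclique : ∀ x ∈ Aᶜ, ∀ y ∈ Aᶜ, x ≠ y → M.Adj x y := by
    intro x hx y hy hxy
    by_contra hadj
    have := hdeg x y hxy hadj
    rw [mem_compl, hA] at hx hy
    omega
  have hAcard : x ≤ #A := by
    by_contra hlt
    have h1 := card_compl A
    have h2 := card_le_univ A
    obtain ⟨l, hl⟩ := hasPath_of_isClique Aᶜ hclique
    exact hM ⟨l, hl.1, hl.2.1, by omega⟩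
  let f : V → ℕ := fun v => #{w | M.Adj v w ∧ w ∉ A}
  obtain ⟨R, hRA, hR, hlow⟩ := exists_lower_subset A f (x - 1) (by omega)
  obtain ⟨H, hHadj⟩ : ∃ H : SimpleGraph {v // v ∉ R},
      ∀ a b, H.Adj a b ↔ M.Adj a b ∧ ¬(a.1 ∈ A ∧ b.1 ∈ A) :=
    ⟨{ Adj := fun a b => M.Adj a b ∧ ¬(a.1 ∈ A ∧ b.1 ∈ A)
       symm := ⟨fun a b h => ⟨h.1.symm, fun h' => h.2 h'.symm⟩⟩
       loopless := ⟨fun a h => M.irrefl h.1⟩ }, fun _ _ => Iff.rfl⟩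
  have hcardW : Fintype.card {v // v ∉ R} = n - x + 1 := by
    rw [Fintype.card_subtype_compl, Fintype.card_coe, hR]; omega
  have hH : ¬HasPath H (Fintype.card {v // v ∉ R}) := by
    rw [hcardW]
    exact fun h => hM (hasPath_of_injective Subtype.val Subtype.val_injective
      (fun a b h => ((hHadj a b).1 h).1) h)
  obtain ⟨h, hh, hlowdeg⟩ := exists_low_degree_of_not_hasPath hH
  rw [hcardW] at hh
  have hfdeg : ∀ a : {v // v ∉ R}, a.1 ∈ A → f a.1 = H.degree a := by
    intro a ha
    rw [← SimpleGraph.card_neighborFinset_eq_degree, SimpleGraph.neighborFinset_eq_filter]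
    symm
    refine card_bij (fun b _ => b.1) ?_ (fun a _ b _ h => Subtype.ext h) ?_
    · intro b hb
      simp only [mem_filter, mem_univ, true_and, hHadj] at hb ⊢
      exact ⟨hb.1, fun h' => hb.2 ⟨ha, h'⟩⟩
    · intro b hb
      simp only [mem_filter, mem_univ, true_and] at hb
      exact ⟨⟨b, fun h' => hb.2 (hRA h')⟩, by simp [hHadj, hb.1, hb.2], rfl⟩
  have hT : h + 1 ≤ #{v | v ∈ A \ R ∧ f v ≤ h} := by
    by_cases hall : ∀ a : {v // v ∉ R}, H.degree a ≤ h → a.1 ∈ A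
    · refine hlowdeg.trans ?_
      rw [← card_map (Function.Embedding.subtype _)]
      refine card_le_card ?_
      intro v hv
      simp only [mem_map, mem_filter, mem_univ, true_and, Function.Embedding.subtype_apply] at hv
      obtain ⟨a, ha, rfl⟩ := hv
      have := hall a ha
      simp only [mem_filter, mem_univ, true_and, mem_sdiff]
      exact ⟨⟨this, a.2⟩, by rwa [hfdeg a this]⟩
    · push Not at hall
      obtain ⟨w, hw, hwA⟩ := hall
      have hclW : #(Aᶜ.erase w.1) + #{v | v ∈ A \ R ∧ M.Adj w v} ≤ H.degree w := by
        rw [← SimpleGraph.card_neighborFinset_eq_degree,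
          ← card_map (Function.Embedding.subtype _), ← card_union_of_disjoint]
        · refine card_le_card ?_
          intro v hv
          simp only [mem_union, mem_erase, mem_compl, mem_filter, mem_univ, true_and,
            mem_sdiff] at hv
          simp only [mem_map, SimpleGraph.mem_neighborFinset, hHadj,
            Function.Embedding.subtype_apply]
          rcases hv with ⟨hvw, hvA⟩ | ⟨⟨hvA, hvR⟩, hadj⟩
          · exact ⟨⟨v, fun h' => hvA (hRA h')⟩, ⟨hclique _ (by simpa using hwA) _
              (by simpa using hvA) (Ne.symm hvw), fun h' => hwA h'.1⟩, rfl⟩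
          · exact ⟨⟨v, hvR⟩, ⟨hadj, fun h' => hwA h'.1⟩, rfl⟩
        · rw [disjoint_left]
          intro v hv
          simp only [mem_erase, mem_compl, mem_filter, mem_univ, true_and, mem_sdiff] at hv ⊢
          tauto
      rw [card_erase_of_mem (by simpa using hwA)] at hclW
      have hBpos : 0 < #Aᶜ := card_pos.2 ⟨w.1, by simpa using hwA⟩
      have hcompl := card_compl A
      have hAle := card_le_univ A
      have hAR : #(A \ R) = #A - (x - 1) := by rw [card_sdiff_of_subset hRA, hR]
      have hfle : ∀ v ∈ A \ R, f v ≤ h := by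
        intro v hv
        by_cases hadj : M.Adj w v
        · have h1 : f v ≤ #Aᶜ := card_le_card fun z hz => by
            simp only [mem_filter, mem_univ, true_and] at hz
            simpa using hz.2
          have h2 : 0 < #{v | v ∈ A \ R ∧ M.Adj w v} :=
            card_pos.2 ⟨v, by simp [hadj]; simpa using hv⟩
          omega
        · have h1 : f v ≤ #(Aᶜ.erase w.1) := card_le_card fun z hz => by
            simp only [mem_filter, mem_univ, true_and] at hz
            rw [mem_erase, mem_compl]
            refine ⟨?_, hz.2⟩
            rintro rfl
            exact hadj hz.1.symm
          rw [card_erase_of_mem (by simpa using hwA)] at h1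
          omega
      have : ({v | v ∈ A \ R ∧ f v ≤ h} : Finset V) = A \ R := by
        ext v
        simp only [mem_filter, mem_univ, true_and, and_iff_left_iff_imp]
        exact hfle v
      rw [this]
      omega
  obtain ⟨T, hTsub, hTcard⟩ := exists_subset_card_eq hT
  have hTmem : ∀ v ∈ T, (v ∈ A ∧ v ∉ R) ∧ f v ≤ h := by
    intro v hv
    simpa using hTsub hv
  have hRT : Disjoint R T := disjoint_left.2 fun v hv hv' => (hTmem v hv').1.2 hv
  have hcardS : #(R ∪ T) = h + x := by
    rw [card_union_of_disjoint hRT]; omega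
  have hfS : ∀ v ∈ R ∪ T, f v ≤ h := by
    intro v hv
    rcases mem_union.1 hv with hv | hv
    · obtain ⟨z, hz⟩ : T.Nonempty := by rw [← card_pos]; omega
      exact (hlow v hv z (hTmem z hz).1.1 (hTmem z hz).1.2).trans (hTmem z hz).2
    · exact (hTmem v hv).2
  refine ⟨A, R ∪ T, h, union_subset hRA fun v hv => (hTmem v hv).1.1, ?_, hcardS, by omega, ?_⟩
  · intro v hv
    have := SimpleGraph.degree_le_of_le (v := v) hGM
    have := (hA v).1 hv
    omega
  · intro v hv
    refine (card_le_card ?_).trans (hfS v hv)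
    intro w hw
    simp only [mem_filter, mem_univ, true_and] at hw ⊢
    exact ⟨hGM hw.1, hw.2⟩

end DegreeCondition

section Counting

/-- If the partial sums of `k i * (h i - ∑ l < i, k l)` are nonnegative and `k` is increasing,
then the differences `x = k - h` satisfy a geometrically weighted bound. -/
theorem sum_two_pow_mul_lt {n : ℤ} {t : ℕ} (ht : 0 < t) (k h x : ℕ → ℤ)
    (hk : ∀ i < t, k i = h i + x i) (hpos : ∀ i < t, 0 < k i)
    (hmono : ∀ i, i + 1 < t → k i ≤ k (i + 1)) (hn : ∀ i < t, k i + h i < n)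
    (hsum : ∑ i ∈ range t, k i ≤ n)
    (hE : ∀ m ≤ t, ∑ i ∈ range m, k i * ∑ l ∈ range i, k l ≤ ∑ i ∈ range m, k i * h i) :
    ∑ i ∈ range t, 2 ^ (t - 1 - i) * x i < n := by
  let K : ℕ → ℤ := fun m => ∑ i ∈ range m, k i
  let X : ℕ → ℤ := fun m => ∑ i ∈ range m, 2 ^ (m - 1 - i) * x i
  let E : ℕ → ℤ := fun m => ∑ i ∈ range m, k i * h i - ∑ i ∈ range m, k i * ∑ l ∈ range i, k l
  have hEnn : ∀ m ≤ t, 0 ≤ E m := fun m hm => sub_nonneg.2 (hE m hm)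
  have hK : ∀ m, K (m + 1) = K m + k m := fun m => sum_range_succ _ _
  have hX : ∀ m, X (m + 1) = 2 * X m + x m := by
    intro m
    simp only [X]
    rw [sum_range_succ, mul_sum]
    congr 1
    · refine sum_congr rfl fun i hi => ?_
      rw [mem_range] at hi
      rw [show m + 1 - 1 - i = (m - 1 - i) + 1 by omega, pow_succ]
      ring
    · simp
  have hEs : ∀ m, E (m + 1) = E m + k m * (h m - K m) := by
    intro m
    simp only [E, K]
    rw [sum_range_succ, sum_range_succ]
    ring
  have hY : ∀ m < t, K (m + 1) - X (m + 1) = 2 * (K m - X m) + (h m - K m) := by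
    intro m hm
    rw [hK, hX]
    linarith [hk m hm]
  have inv : ∀ m < t, E m ≤ k m * (K m - X m) := by
    intro m
    induction m with
    | zero => intro _; simp [E, K, X]
    | succ m ih =>
      intro hm
      have hm' : m < t := by omega
      have h1 := ih hm'
      have h0 : 0 ≤ K m - X m :=
        nonneg_of_mul_nonneg_right ((hEnn m hm'.le).trans h1) (hpos m hm')
      have h2 : E (m + 1) ≤ k m * (K (m + 1) - X (m + 1)) := by
        rw [hY m hm', hEs]
        nlinarith [mul_nonneg (hpos m hm').le h0]
      have h3 : 0 ≤ K (m + 1) - X (m + 1) :=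
        nonneg_of_mul_nonneg_right ((hEnn _ hm.le).trans h2) (hpos m hm')
      exact h2.trans (mul_le_mul_of_nonneg_right (hmono m hm) h3)
  obtain ⟨m, rfl⟩ : ∃ m, t = m + 1 := ⟨t - 1, by omega⟩
  have hm : m < m + 1 := by omega
  have h1 := inv m hm
  have h0 : 0 ≤ K m - X m := nonneg_of_mul_nonneg_right ((hEnn m hm.le).trans h1) (hpos m hm)
  have h2 : k m * (K m - X m) ≤ k m * (K (m + 1) - X (m + 1)) := by
    have := hEnn (m + 1) le_rfl
    rw [hEs] at this
    rw [hY m hm]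
    nlinarith
  have h3 := le_of_mul_le_mul_left h2 (hpos m hm)
  have h4 := hn m hm
  have h5 := hY m hm
  have h6 := hK m
  change X (m + 1) < n
  change K (m + 1) ≤ n at hsum
  by_contra hcon
  have h7 : K m - X m = 0 := by linarith
  have h8 : K (m + 1) - X (m + 1) = 0 := by linarith
  linarith

variable {V : Type*} [Fintype V]

open Classical in
/-- Disjoint vertex sets `S i`, whose vertices have at most `h i` neighbours in `G i` outside
`A i ⊇ S i`, satisfy a counting inequality when every edge lies in all but at most one `G i`. -/
theorem sum_card_mul_sum_card_le (G : ℕ → SimpleGraph V) (A S : ℕ → Finset V) (h : ℕ → ℕ) (m : ℕ)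
    (hG : ∀ i < m, ∀ l < m, i ≠ l → ∀ v w, v ≠ w → (G i).Adj v w ∨ (G l).Adj v w)
    (hSA : ∀ i < m, S i ⊆ A i) (hA : ∀ i < m, ∀ l < m, i ≠ l → Disjoint (A i) (A l))
    (hdeg : ∀ i < m, ∀ v ∈ S i, #{w | (G i).Adj v w ∧ w ∉ A i} ≤ h i) :
    ∑ i ∈ range m, #(S i) * ∑ l ∈ range i, #(S l) ≤ ∑ i ∈ range m, #(S i) * h i := by
  let e : ℕ → ℕ → ℕ := fun i l =>
    if i = l then 0 else ∑ v ∈ S i, ∑ w ∈ S l, if (G i).Adj v w then 1 else 0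
  have hdisS : ∀ i < m, ∀ l < m, i ≠ l → Disjoint (S i) (S l) := fun i hi l hl hil =>
    disjoint_of_subset_left (hSA i hi) (disjoint_of_subset_right (hSA l hl) (hA i hi l hl hil))
  have hpair : ∀ i < m, ∀ l < m, i ≠ l → #(S i) * #(S l) ≤ e i l + e l i := by
    intro i hi l hl hil
    simp only [e, if_neg hil, if_neg hil.symm]
    rw [sum_comm (s := S l), ← sum_add_distrib]
    calc #(S i) * #(S l) = ∑ v ∈ S i, ∑ w ∈ S l, 1 := by simp
      _ ≤ _ := by
        refine sum_le_sum fun v hv => ?_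
        rw [← sum_add_distrib]
        refine sum_le_sum fun w hw => ?_
        have hvw : v ≠ w := fun h => disjoint_left.1 (hdisS i hi l hl hil) hv (h ▸ hw)
        rcases hG i hi l hl hil v w hvw with h | h
        · simp [h]
        · simp [h.symm]
  have hout : ∀ i < m, ∑ l ∈ range m, e i l ≤ #(S i) * h i := by
    intro i hi
    have h1 : ∑ l ∈ range m, e i l =
        ∑ v ∈ S i, ∑ l ∈ (range m).erase i, #{w ∈ S l | (G i).Adj v w} := by
      rw [sum_comm, ← add_sum_erase _ _ (mem_range.2 hi)]
      simp only [e, if_true, zero_add]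
      refine sum_congr rfl fun l hl => ?_
      rw [if_neg (ne_of_mem_erase hl).symm]
      exact sum_congr rfl fun v _ => (card_filter _ _).symm
    rw [h1, ← smul_eq_mul]
    refine sum_le_card_nsmul _ _ _ fun v hv => ?_
    rw [← card_biUnion]
    · refine (card_le_card ?_).trans (hdeg i hi v hv)
      intro w hw
      simp only [mem_biUnion, mem_erase, mem_range, mem_filter, mem_univ, true_and] at hw ⊢
      obtain ⟨l, ⟨hli, hl⟩, hw, hadj⟩ := hw
      exact ⟨hadj, fun h' => disjoint_left.1 (hA i hi l hl hli.symm) h' (hSA l hl hw)⟩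
    · intro a ha b hb hab
      simp only [coe_erase, Set.mem_sdiff, mem_coe, mem_range] at ha hb
      exact disjoint_filter_filter (hdisS a ha.1 b hb.1 hab)
  have hacc : ∀ r ≤ m, ∑ i ∈ range r, #(S i) * ∑ l ∈ range i, #(S l) ≤
      ∑ i ∈ range r, ∑ l ∈ range r, e i l := by
    intro r
    induction r with
    | zero => simp
    | succ r ih =>
      intro hr
      have h1 := ih (by omega)
      have h2 : #(S r) * ∑ l ∈ range r, #(S l) ≤ ∑ l ∈ range r, (e r l + e l r) := by
        rw [mul_sum]
        refine sum_le_sum fun l hl => ?_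
        rw [mem_range] at hl
        exact hpair r (by omega) l (by omega) (by omega)
      rw [sum_add_distrib] at h2
      rw [sum_range_succ, sum_range_succ _ r]
      simp only [sum_range_succ _ r, sum_add_distrib]
      omega
  exact (hacc m le_rfl).trans (sum_le_sum fun i hi => hout i (mem_range.1 hi))

open Classical in
/-- If every edge lies in all but at most one of the graphs `G i`, and every path of `G i` misses
at least `x i` vertices, then `∑ 2 ^ i * x i` is less than the number of vertices. -/
theorem sum_two_pow_mul_missing_lt {t : ℕ} (ht : 0 < t) (G : Fin t → SimpleGraph V)
    (hG : ∀ i l, i ≠ l → ∀ v w, v ≠ w → (G i).Adj v w ∨ (G l).Adj v w) (x : Fin t → ℕ)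
    (hx : ∀ i, 1 ≤ x i) (hxn : ∀ i, x i ≤ Fintype.card V) (hanti : Antitone x)
    (hpath : ∀ i, ¬HasPath (G i) (Fintype.card V - x i + 1)) :
    ∑ i : Fin t, 2 ^ (i : ℕ) * x i < Fintype.card V := by
  choose A S h hSA hAdeg hcard hlt hSdeg using
    fun i => exists_deficient_set (hx i) (hxn i) (hpath i)
  have hA : ∀ i l, i ≠ l → Disjoint (A i) (A l) := by
    intro i l hil
    rw [disjoint_left]
    intro v hvi hvl
    have h1 := hAdeg i v hvi
    have h2 := hAdeg l v hvl
    have h3 : (univ.erase v) ⊆ (G i).neighborFinset v ∪ (G l).neighborFinset v := by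
      intro w hw
      simpa using hG i l hil v w (ne_of_mem_erase hw).symm
    have h4 := (card_le_card h3).trans (card_union_le _ _)
    rw [card_erase_of_mem (mem_univ _), card_univ, SimpleGraph.card_neighborFinset_eq_degree,
      SimpleGraph.card_neighborFinset_eq_degree] at h4
    omega
  let σ := Tuple.sort fun i => #(S i)
  have hσ : Monotone fun i => #(S (σ i)) := Tuple.monotone_sort fun i => #(S i)
  let g : ℕ → Fin t := fun i => if hi : i < t then σ ⟨i, hi⟩ else ⟨0, ht⟩
  have hg : ∀ i : Fin t, g i = σ i := fun i => by simp [g]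
  have hgne : ∀ i < t, ∀ l < t, i ≠ l → g i ≠ g l := by
    intro i hi l hl hil
    simpa [g, hi, hl] using hil
  have hcount : ∀ m ≤ t, ∑ i ∈ range m, #(S (g i)) * ∑ l ∈ range i, #(S (g l)) ≤
      ∑ i ∈ range m, #(S (g i)) * h (g i) := fun m hm =>
    sum_card_mul_sum_card_le (fun i => G (g i)) (fun i => A (g i)) (fun i => S (g i))
      (fun i => h (g i)) m
      (fun i hi l hl hil => hG _ _ (hgne i (by omega) l (by omega) hil))
      (fun i _ => hSA _) (fun i hi l hl hil => hA _ _ (hgne i (by omega) l (by omega) hil))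
      (fun i _ => hSdeg _)
  have hsum : ∑ i ∈ range t, #(S (g i)) ≤ Fintype.card V := by
    rw [← card_biUnion]
    · exact card_le_univ _
    · intro i hi l hl hil
      simp only [coe_range, Set.mem_Iio] at hi hl
      exact disjoint_of_subset_left (hSA _)
        (disjoint_of_subset_right (hSA _) (hA _ _ (hgne i hi l hl hil)))
  have key := sum_two_pow_mul_lt (n := Fintype.card V) ht (fun i => (#(S (g i)) : ℤ))
    (fun i => (h (g i) : ℤ)) (fun i => (x (g i) : ℤ))
    (fun i _ => by rw [hcard]; push_cast; rfl)
    (fun i _ => by have := hcard (g i); have := hx (g i); omega)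
    (fun i hi => by
      have := hσ (a := ⟨i, by omega⟩) (b := ⟨i + 1, hi⟩) (by simp)
      simp only [g, hi, dif_pos (show i < t by omega), dif_pos]
      exact_mod_cast this)
    (fun i _ => by have := hlt (g i); omega)
    (by exact_mod_cast hsum) (fun m hm => by exact_mod_cast hcount m hm)
  have key' : ∑ i ∈ range t, 2 ^ (t - 1 - i) * x (g i) < Fintype.card V := by
    exact_mod_cast key
  refine lt_of_le_of_lt ?_ key'
  rw [sum_range]
  simp only [hg]
  have hvary : Antivary (fun i : Fin t => 2 ^ (i : ℕ)) x := by
    intro i l hil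
    have : l < i := hanti.reflect_lt hil
    exact Nat.pow_le_pow_right (by norm_num) this.le
  refine (hvary.sum_smul_le_sum_smul_comp_perm (σ := Fin.revPerm.trans σ)).trans_eq ?_
  refine Fintype.sum_equiv Fin.revPerm _ _ fun i => ?_
  have : t - 1 - (t - (i + 1)) = (i : ℕ) := by omega
  simp [Fin.val_rev, this]

end Counting

theorem avoidsPath_of_hasPath {n t ℓ : ℕ} {c : Sym2 (Fin n) → Fin t} {i : Fin t}
    {G : SimpleGraph (Fin n)} (hG : ∀ v w, G.Adj v w → c s(v, w) ≠ i) (h : HasPath G ℓ) :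
    AvoidsPath n t ℓ c i := by
  obtain ⟨l, hnd, hl, hp⟩ := h
  refine ⟨fun k => l[(k : ℕ)]'(k.2.trans_le hp), ?_, ?_⟩
  · intro a b hab
    exact Fin.ext ((hnd.getElem_inj_iff).1 hab)
  · intro k hk
    exact hG _ _ (hl.getElem k (hk.trans_le hp))

/-- Claim 8: if the `t`-coloured `K_s` (with `s = s(ℓ₁,…,ℓ_t)` and `ℓ_t ≤ s`) contains a
cycle on `ℓ_j - 1` vertices avoiding colour `j`, then it contains a path on `ℓ_{j'}` vertices
avoiding colour `j'` for some `j'`. -/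
theorem avoiding_cycle_gives_avoiding_path (t : ℕ) (ht : 3 ≤ t) (ℓ : Fin t → ℕ)
    (hmono : Monotone ℓ) (h4 : 4 ≤ ℓ ⟨0, by omega⟩) (hts : ℓ ⟨t - 1, by omega⟩ ≤ sVal t ℓ)
    (c : Sym2 (Fin (sVal t ℓ)) → Fin t) (j : Fin t)
    (hcyc : AvoidsCycle (sVal t ℓ) t (ℓ j - 1) c j) :
    ∃ j' : Fin t, AvoidsPath (sVal t ℓ) t (ℓ j') c j' := by
  clear hcyc
  revert c
  generalize hs : sVal t ℓ = s at hts ⊢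
  intro c
  by_contra hno
  push Not at hno
  have hℓs : ∀ i, ℓ i ≤ s := fun i =>
    (hmono (Fin.le_def.2 (by have := i.2; simp; omega))).trans hts
  have hℓ4 : ∀ i, 4 ≤ ℓ i := fun i => h4.trans (hmono (Fin.le_def.2 (by simp)))
  let G : Fin t → SimpleGraph (Fin s) := fun i =>
    { Adj := fun v w => v ≠ w ∧ c s(v, w) ≠ i
      symm := ⟨fun v w h => ⟨h.1.symm, Sym2.eq_swap (a := v) (b := w) ▸ h.2⟩⟩
      loopless := ⟨fun v h => h.1 rfl⟩ }
  have key := sum_two_pow_mul_missing_lt (by omega) G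
    (fun i l hil v w hvw => by
      by_cases h : c s(v, w) = i
      · exact Or.inr ⟨hvw, fun h' => hil (h ▸ h')⟩
      · exact Or.inl ⟨hvw, h⟩)
    (fun i => s + 1 - ℓ i) (fun i => by have := hℓs i; omega)
    (fun i => by have := hℓ4 i; rw [Fintype.card_fin]; omega)
    (fun i l hil => Nat.sub_le_sub_left (hmono hil) _)
    (fun i h => hno i (avoidsPath_of_hasPath (G := G i) (fun v w h => h.2) (by
      have h1 := hℓs i
      have h2 := hℓ4 i
      rw [Fintype.card_fin] at h
      rwa [show s - (s + 1 - ℓ i) + 1 = ℓ i by omega] at h)))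
  rw [Fintype.card_fin] at key
  have hgeom : ∑ i : Fin t, 2 ^ (i : ℕ) = 2 ^ t - 1 := by
    rw [Fin.sum_univ_eq_sum_range (fun i => 2 ^ i) t, Nat.geomSum_eq le_rfl]
    simp
  have hsplit : ∑ i : Fin t, 2 ^ (i : ℕ) * (s + 1 - ℓ i) + ∑ i : Fin t, 2 ^ (i : ℕ) * ℓ i =
      (2 ^ t - 1) * (s + 1) := by
    rw [← Finset.sum_add_distrib, ← hgeom, Finset.sum_mul]
    refine Finset.sum_congr rfl fun i _ => ?_
    rw [← mul_add, Nat.sub_add_cancel ((hℓs i).trans (Nat.le_succ s))]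
  have hpow : 2 ^ 3 ≤ 2 ^ t := Nat.pow_le_pow_right (by norm_num) ht
  obtain ⟨q, hq⟩ : ∃ q, 2 ^ t = q + 2 := ⟨2 ^ t - 2, by omega⟩
  have hlt : (∑ i : Fin t, 2 ^ (i : ℕ) * ℓ i) - 2 < q * (s + 1) := by
    have h1 : s < s + 1 := Nat.lt_succ_self s
    nth_rw 1 [← hs] at h1
    rw [sVal, hq, Nat.add_sub_cancel] at h1
    rw [mul_comm]
    exact (Nat.div_lt_iff_lt_mul (by omega)).1 h1
  rw [hq, show q + 2 - 1 = q + 1 by omega, add_mul, one_mul] at hsplit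
  omega
end

section
/- Let t ≥ 3 and 4 ≤ ℓ₁ ≤ ℓ₂ ≤ ... ≤ ℓ_t be integers with ℓ_t ≤ s, where s = s(ℓ₁,...,ℓ_t). Let a t-colouring of the complete graph G = K_s on s vertices be given, and choose a vertex x and a colour i such that the number of edges of colour i incident to x is maximal over all choices of a vertex and a colour. If there exist j ∈ {1,...,t} with j ≠ i and a path on ℓ_j − 2 vertices in G − x avoiding colour j, then there exists j' ∈ {1,...,t} such that G contains a path on ℓ_{j'} vertices avoiding colour j'. -/
/-- The number of edges of colour `i` at the vertex `x`. -/
def colourDeg (n t : ℕ) (c : Sym2 (Fin n) → Fin t) (x : Fin n) (i : Fin t) : ℕ :=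
  (Finset.univ.filter fun y => y ≠ x ∧ c s(x, y) = i).card

/-- The cyclic permutation of a duplicate-free list sends each entry to the following one. -/
theorem List.formPerm_apply_of_append_cons_cons {α : Type*} [DecidableEq α] (A B : List α)
    (u v : α) (h : (A ++ u :: v :: B).Nodup) : (A ++ u :: v :: B).formPerm u = v := by
  have := List.formPerm_apply_lt_getElem (A ++ u :: v :: B) h A.length (by simp)
  simpa using this

/-- Inserting two vertices `x` and `z` into a path by reversing the segment between two
neighbours `w₁`, `w₂` of `x` whose successors `v₁`, `v₂` are neighbours of `z`. -/
theorem SimpleGraph.not_adj_succ_of_adj_succ {V : Type*} [DecidableEq V]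
    (H : SimpleGraph V) {x z : V} {P A M C : List V} {w₁ w₂ v₂ : V}
    (hPe : P = A ++ w₁ :: (M ++ w₂ :: v₂ :: C))
    (hnd : P.Nodup) (hP : P.IsChain H.Adj) (hx : x ∉ P) (hz : z ∉ P) (hzx : z ≠ x)
    (hno : ∀ Q : List V, Q.Nodup → Q.IsChain H.Adj → Q.length ≠ P.length + 2)
    (hw₁ : H.Adj x w₁) (hw₂ : H.Adj x w₂) (hv₁ : H.Adj z (P.formPerm w₁)) :
    ¬ H.Adj z (P.formPerm w₂) := by
  intro hv₂
  have e₂ : P = (A ++ w₁ :: M) ++ w₂ :: v₂ :: C := by simp [hPe]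
  have hf₂ : P.formPerm w₂ = v₂ := by
    rw [e₂]
    exact List.formPerm_apply_of_append_cons_cons _ _ _ _ (e₂ ▸ hnd)
  rw [hf₂] at hv₂
  have e₃ : P = (A ++ [w₁]) ++ ((M ++ [w₂]) ++ v₂ :: C) := by simp [hPe]
  have hhead : ∀ a ∈ (M ++ [w₂]).head?, H.Adj z a := by
    obtain ⟨v, S, hS⟩ : ∃ v S, M ++ [w₂] = v :: S := by cases M <;> simp
    have e₄ : P = A ++ w₁ :: v :: (S ++ v₂ :: C) := by rw [e₃, hS]; simp
    have hf₁ : P.formPerm w₁ = v := by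
      rw [e₄]
      exact List.formPerm_apply_of_append_cons_cons _ _ _ _ (e₄ ▸ hnd)
    rw [hS]
    simpa [hf₁] using hv₁
  refine hno ((A ++ [w₁]) ++ (x :: ((M ++ [w₂]).reverse ++ z :: v₂ :: C))) ?_ ?_
    (by simp [hPe]; omega)
  · have hnd' : (z :: x :: P).Nodup := by simp [hnd, hx, hz, hzx]
    refine (List.Perm.nodup_iff (List.perm_iff_count.2 fun a => ?_)).1 hnd'
    simp only [hPe, List.count_cons, List.count_append, List.count_reverse, List.count_nil]
    omega
  · rw [e₃, List.isChain_append, List.isChain_append (l₁ := M ++ [w₂])] at hP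
    refine hP.1.append (List.isChain_cons.2 ⟨by simpa using hw₂, List.IsChain.append
      (List.isChain_reverse.2 ?_) (List.isChain_cons_cons.2 ⟨hv₂, hP.2.1.2.1⟩) ?_⟩)
      (by simpa using hw₁.symm)
    · simpa only [H.adj_comm] using hP.2.1.1
    · rw [List.getLast?_reverse]
      intro a ha b hb
      simp only [List.head?_cons, Option.mem_def, Option.some.injEq] at hb
      subst hb
      exact (hhead a ha).symm

section

variable {V : Type*} [Fintype V] [DecidableEq V] (H : SimpleGraph V) [DecidableRel H.Adj]

/-- Suppose a path ends in a path `p :: T` preceded by `Y ++ [x]` (the edge from `x` to `p`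
being absent), and no path covers all these vertices. If all neighbours of `p` lie on
`p :: T` or equal `x`, then `p` has more non-neighbours than `x` has neighbours. -/
theorem SimpleGraph.degree_lt_degree_compl_of_no_concat {x p : V} {Y T : List V}
    (hnd : ((Y ++ [x]) ++ p :: T).Nodup) (hX : (Y ++ [x]).IsChain H.Adj)
    (hP : (p :: T).IsChain H.Adj)
    (hno : ∀ Q : List V, Q.Nodup → Q.IsChain H.Adj →
      Q.length ≠ (Y ++ [x]).length + (p :: T).length)
    (hout : ∀ w, w ∉ p :: T → w ≠ x → ¬ H.Adj p w) :
    H.degree x < Hᶜ.degree p := by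
  have hxP : x ∉ p :: T := fun h => by simp at hnd; grind
  have hndP : (p :: T).Nodup := hnd.of_append_right
  have hpx : ¬ H.Adj x p := by
    intro h
    refine hno _ hnd ?_ List.length_append
    rw [List.isChain_append]
    exact ⟨hX, hP, by simpa using h⟩
  have key : ∀ w, H.Adj x w →
      (p :: T).formPerm w ≠ p ∧ ¬ H.Adj p ((p :: T).formPerm w) ∧ (p :: T).formPerm w ≠ x := by
    intro w hw
    by_cases hwP : w ∈ p :: T
    · have hne : (p :: T).formPerm w ≠ x := fun h =>
        hxP (h ▸ List.formPerm_apply_mem_of_mem hwP)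
      obtain ⟨A, C, hAC⟩ := List.append_of_mem hwP
      rw [hAC] at hno hndP hP hne hnd ⊢
      cases C with
      | nil =>
        exfalso
        refine hno ((Y ++ [x]) ++ (A ++ [w]).reverse) ?_ ?_ (by simp; omega)
        · exact (List.Perm.nodup_iff (List.Perm.append_left _ (List.reverse_perm _))).2 hnd
        · rw [List.isChain_append, List.isChain_reverse]
          simp only [H.adj_comm] at *
          refine ⟨hX, hP, by simpa using hw⟩
      | cons v B =>
        rw [List.formPerm_apply_of_append_cons_cons A B w v hndP] at hne ⊢
        refine ⟨?_, ?_, hne⟩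
        · rintro rfl
          cases A <;> simp at hAC hndP <;> grind
        · intro hpv
          refine hno ((Y ++ [x]) ++ ((A ++ [w]).reverse ++ v :: B)) ?_ ?_ (by simp; omega)
          · refine (List.Perm.nodup_iff (List.Perm.append_left _ ?_)).2 hnd
            rw [List.append_cons A w (v :: B)]
            exact (List.reverse_perm _).append_right _
          · rw [List.append_cons A w (v :: B), List.isChain_append] at hP
            have hhead : (A ++ [w]).head? = some p := by
              have := congrArg List.head? hAC
              cases A <;> simp_all
            refine hX.append (List.IsChain.append (List.isChain_reverse.2 ?_) hP.2.1 ?_)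
              (by simpa using hw)
            · simpa only [H.adj_comm] using hP.1
            · rw [List.getLast?_reverse, hhead]
              simpa using hpv
    · rw [List.formPerm_apply_of_notMem hwP]
      have hwx : w ≠ x := hw.ne'
      exact ⟨fun h => hwP (by simp [h]), hout w hwP hwx, hwx⟩
  rw [← SimpleGraph.card_neighborFinset_eq_degree, ← SimpleGraph.card_neighborFinset_eq_degree,
    ← Finset.card_map ((p :: T).formPerm.toEmbedding)]
  apply Finset.card_lt_card
  rw [Finset.ssubset_iff_of_subset]
  · refine ⟨x, ?_, ?_⟩
    · rw [SimpleGraph.mem_neighborFinset, SimpleGraph.compl_adj]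
      exact ⟨fun h => hxP (by simp [h]), fun h => hpx h.symm⟩
    · simp only [Finset.mem_map, SimpleGraph.mem_neighborFinset, not_exists, not_and]
      exact fun w hw => (key w hw).2.2
  · intro u hu
    simp only [Finset.mem_map, SimpleGraph.mem_neighborFinset] at hu
    obtain ⟨w, hw, rfl⟩ := hu
    rw [SimpleGraph.mem_neighborFinset, SimpleGraph.compl_adj]
    exact ⟨(key w hw).1.symm, (key w hw).2.1⟩

/-- If all neighbours of `x` lie on a path `P`, no path has two more vertices than `P`, and `z`
is a vertex off the path adjacent neither to `x` nor to the first vertex of `P`, then `z` has more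
non-neighbours than `x` has neighbours. -/
theorem SimpleGraph.degree_lt_degree_compl_of_no_insertion {x z p : V} {T : List V}
    (hnd : (p :: T).Nodup) (hP : (p :: T).IsChain H.Adj) (hx : x ∉ p :: T) (hz : z ∉ p :: T)
    (hzx : z ≠ x)
    (hno : ∀ Q : List V, Q.Nodup → Q.IsChain H.Adj → Q.length ≠ (p :: T).length + 2)
    (hN : ∀ w, H.Adj x w → w ∈ p :: T) (hxz : ¬ H.Adj z x) (hzp : ¬ H.Adj z p) :
    H.degree x < Hᶜ.degree z := by
  set P := p :: T with hPdef
  have hlast : P.formPerm (P.getLast (by simp [hPdef])) = p := List.formPerm_apply_getLast p T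
  have hmem : ∀ w, H.Adj x w → P.formPerm w ∈ P := fun w hw =>
    List.formPerm_apply_mem_of_mem (hN w hw)
  set N := (H.neighborFinset x).map P.formPerm.toEmbedding with hNdef
  have hNcard : N.card = H.degree x := by
    rw [hNdef, Finset.card_map, SimpleGraph.card_neighborFinset_eq_degree]
  have hNmem : ∀ u, u ∈ N ↔ ∃ w, H.Adj x w ∧ P.formPerm w = u := by
    intro u
    simp only [hNdef, Finset.mem_map, SimpleGraph.mem_neighborFinset]
    rfl
  have hxN : x ∉ N := by
    rw [hNmem]
    rintro ⟨w, hw, h⟩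
    exact hx (h ▸ hmem w hw)
  have hzN : ∀ u ∈ N, z ≠ u := by
    intro u hu h
    obtain ⟨w, hw, h'⟩ := (hNmem u).1 hu
    exact hz (h ▸ h' ▸ hmem w hw)
  rw [← hNcard, ← SimpleGraph.card_neighborFinset_eq_degree]
  have hxJ : x ∈ Hᶜ.neighborFinset z := by
    rw [SimpleGraph.mem_neighborFinset, SimpleGraph.compl_adj]
    exact ⟨hzx, hxz⟩
  by_cases hxe : H.Adj x (P.getLast (by simp [hPdef]))
  · apply Finset.card_lt_card
    rw [Finset.ssubset_iff_of_subset]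
    · exact ⟨x, hxJ, hxN⟩
    · intro u hu
      rw [SimpleGraph.mem_neighborFinset, SimpleGraph.compl_adj]
      refine ⟨hzN u hu, ?_⟩
      obtain ⟨w, hw, rfl⟩ := (hNmem u).1 hu
      obtain ⟨A, C, hAC⟩ := List.append_of_mem (hN w hw)
      cases C with
      | nil =>
        have : w = P.getLast (by simp [hPdef]) := by simp [hAC]
        rw [this, hlast]
        exact hzp
      | cons v B =>
        have hf : P.formPerm w = v := by
          rw [hAC]
          exact List.formPerm_apply_of_append_cons_cons _ _ _ _ (hAC ▸ hnd)
        rw [hf]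
        intro hzv
        have hl : P.getLast? = some (P.getLast (by simp [hPdef])) := List.getLast?_eq_some_getLast _
        set e := P.getLast (by simp [hPdef])
        have e₂ : P = (A ++ [w]) ++ v :: B := by simp [hAC]
        have hl' : (v :: B).getLast? = some e := by
          rw [e₂, List.getLast?_append_of_ne_nil _ (by simp)] at hl
          exact hl
        refine hno ((A ++ [w]) ++ x :: ((v :: B).reverse ++ [z])) ?_ ?_ (by simp [hAC]; omega)
        · have hnd' : (z :: x :: P).Nodup := by simp [hnd, hx, hz, hzx]
          refine (List.Perm.nodup_iff (List.perm_iff_count.2 fun a => ?_)).1 hnd'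
          simp only [hAC, List.count_cons, List.count_append, List.count_reverse, List.count_nil]
          omega
        · rw [e₂, List.isChain_append] at hP
          refine hP.1.append (List.isChain_cons.2 ⟨?_, List.IsChain.append
            (List.isChain_reverse.2 ?_) (by simp) ?_⟩) (by simpa using hw.symm)
          · rw [List.head?_append_of_ne_nil _ (by simp), List.head?_reverse, hl']
            simpa using hxe
          · simpa only [H.adj_comm] using hP.2.1
          · simpa using hzv.symm
  · have hsucc : ∀ w, H.Adj x w → ∀ A C, P = A ++ w :: C → ∃ v B, C = v :: B := by
      intro w hw A C hAC
      cases C with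
      | nil =>
        exfalso
        have : w = P.getLast (by simp [hPdef]) := by simp [hAC]
        exact hxe (this ▸ hw)
      | cons v B => exact ⟨v, B, rfl⟩
    have hpN : p ∉ N := by
      rw [hNmem]
      rintro ⟨w, hw, h⟩
      have : w = P.getLast (by simp [hPdef]) := P.formPerm.injective (h.trans hlast.symm)
      exact hxe (this ▸ hw)
    have hone : (N.filter (H.Adj z)).card ≤ 1 := by
      rw [Finset.card_le_one]
      intro a ha b hb
      rw [Finset.mem_filter, hNmem] at ha hb
      obtain ⟨⟨w₁, hw₁, rfl⟩, hz₁⟩ := ha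
      obtain ⟨⟨w₂, hw₂, rfl⟩, hz₂⟩ := hb
      by_contra hne
      have hww : w₂ ≠ w₁ := fun h => hne (h ▸ rfl)
      obtain ⟨A, C, hAC⟩ := List.append_of_mem (hN w₁ hw₁)
      have hw₂P := hN w₂ hw₂
      rw [hAC, List.mem_append, List.mem_cons] at hw₂P
      rcases hw₂P with h | h | h
      · obtain ⟨A', M, rfl⟩ := List.append_of_mem h
        obtain ⟨v, B, rfl⟩ := hsucc w₁ hw₁ _ _ hAC
        exact H.not_adj_succ_of_adj_succ (by simpa using hAC) hnd hP hx hz hzx hno hw₂ hw₁ hz₂ hz₁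
      · exact hww h
      · obtain ⟨M, C', rfl⟩ := List.append_of_mem h
        obtain ⟨v, B, rfl⟩ := hsucc w₂ hw₂ (A ++ w₁ :: M) C' (by simpa using hAC)
        exact H.not_adj_succ_of_adj_succ hAC hnd hP hx hz hzx hno hw₁ hw₂ hz₁ hz₂
    have hpJ : p ∈ Hᶜ.neighborFinset z := by
      rw [SimpleGraph.mem_neighborFinset, SimpleGraph.compl_adj]
      exact ⟨fun h => hz (by simp [h, hPdef]), hzp⟩
    have hpx : x ≠ p := fun h => hx (by simp [h, hPdef])
    have hsub : insert x (insert p (N.filter fun u => ¬ H.Adj z u)) ⊆ Hᶜ.neighborFinset z := by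
      intro u hu
      rw [Finset.mem_insert, Finset.mem_insert, Finset.mem_filter] at hu
      rcases hu with rfl | rfl | ⟨h, h'⟩
      · exact hxJ
      · exact hpJ
      · rw [SimpleGraph.mem_neighborFinset, SimpleGraph.compl_adj]
        exact ⟨hzN u h, h'⟩
    have hcard := Finset.card_le_card hsub
    rw [Finset.card_insert_of_notMem (by simp [hpx, hxN]),
      Finset.card_insert_of_notMem (by simp [hpN])] at hcard
    have hsum := Finset.card_filter_add_card_filter_not (s := N) (H.Adj z)
    omega

/-- If every vertex has at most as many non-neighbours as `x` has neighbours, then a nonempty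
path avoiding `x` and at least one more vertex can be replaced by a path with two more vertices. -/
theorem SimpleGraph.exists_path_length_add_two {x z : V} {P : List V} (hP0 : P ≠ [])
    (hnd : P.Nodup) (hP : P.IsChain H.Adj) (hx : x ∉ P) (hz : z ∉ P) (hzx : z ≠ x)
    (hdeg : ∀ y, Hᶜ.degree y ≤ H.degree x) :
    ∃ Q : List V, Q.Nodup ∧ Q.IsChain H.Adj ∧ Q.length = P.length + 2 := by
  by_contra! hno
  by_cases hA : ∃ Q : List V, Q.Nodup ∧ Q.IsChain H.Adj ∧ Q.length = P.length + 1 ∧ x ∉ Q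
  · obtain ⟨Q, hQnd, hQ, hQl, hxQ⟩ := hA
    obtain ⟨p, T, rfl⟩ : ∃ p T, Q = p :: T := List.exists_cons_of_length_eq_add_one hQl
    refine (hdeg p).not_gt (H.degree_lt_degree_compl_of_no_concat (Y := []) (T := T)
      (by simpa using ⟨by simpa using hxQ, by simpa using hQnd⟩) (by simp) hQ ?_ ?_)
    · intro S hS hS' hl
      refine hno S hS hS' ?_
      simp only [List.nil_append, List.length_singleton] at hl
      omega
    · intro w hw hwx h
      exact hno (w :: p :: T) (List.nodup_cons.2 ⟨hw, hQnd⟩)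
        (List.isChain_cons_cons.2 ⟨h.symm, hQ⟩) (by rw [List.length_cons, hQl])
  · push Not at hA
    obtain ⟨p, T, rfl⟩ := List.exists_cons_of_ne_nil hP0
    have hout : ∀ w, w ∉ p :: T → w ≠ x → ¬ H.Adj p w := by
      intro w hw hwx h
      have := hA (w :: p :: T) (List.nodup_cons.2 ⟨hw, hnd⟩)
        (List.isChain_cons_cons.2 ⟨h.symm, hP⟩) (by simp)
      grind
    by_cases hb : ∃ y, y ∉ p :: T ∧ H.Adj x y
    · obtain ⟨y, hy, hxy⟩ := hb
      refine (hdeg p).not_gt (H.degree_lt_degree_compl_of_no_concat (Y := [y]) (T := T)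
        ?_ (by simpa using hxy.symm) hP ?_ hout)
      · have := hxy.ne
        grind
      · intro S hS hS' hl
        refine hno S hS hS' ?_
        simp only [List.length_append, List.length_singleton] at hl
        omega
    · push Not at hb
      exact (hdeg z).not_gt (H.degree_lt_degree_compl_of_no_insertion hnd hP hx hz hzx
        hno (fun w hw => by_contra fun h => hb w h hw)
        (fun h => hb z hz h.symm) (fun h => hout z hz hzx h.symm))

end

/-- Claim 9: let `x` be a vertex and `i` a colour maximising the colour-`i` degree of `x`
over all choices of a vertex and a colour, in a `t`-coloured `K_s` with `s = s(ℓ₁,…,ℓ_t)`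
and `ℓ_t ≤ s`. If there is a path on `ℓ_j - 2` vertices in `G - x` avoiding some colour
`j ≠ i`, then there is a path on `ℓ_{j'}` vertices avoiding colour `j'` for some `j'`. -/
theorem max_degree_path_extension (t : ℕ) (ht : 3 ≤ t) (ℓ : Fin t → ℕ)
    (hmono : Monotone ℓ) (h4 : 4 ≤ ℓ ⟨0, by omega⟩) (hts : ℓ ⟨t - 1, by omega⟩ ≤ sVal t ℓ)
    (c : Sym2 (Fin (sVal t ℓ)) → Fin t) (x : Fin (sVal t ℓ)) (i : Fin t)
    (hmax : ∀ (y : Fin (sVal t ℓ)) (i' : Fin t),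
      colourDeg (sVal t ℓ) t c y i' ≤ colourDeg (sVal t ℓ) t c x i)
    (j : Fin t) (hji : j ≠ i)
    (hpath : ∃ P : Fin (ℓ j - 2) → Fin (sVal t ℓ), Function.Injective P ∧ (∀ k, P k ≠ x) ∧
      ∀ k : ℕ, ∀ h : k + 1 < ℓ j - 2,
        c s(P ⟨k, Nat.lt_of_succ_lt h⟩, P ⟨k + 1, h⟩) ≠ j) :
    ∃ j' : Fin t, AvoidsPath (sVal t ℓ) t (ℓ j') c j' := by
  classical
  obtain ⟨P, hPinj, hPx, hPc⟩ := hpath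
  have h4j : 4 ≤ ℓ j := h4.trans (hmono (Fin.mk_le_of_le_val (Nat.zero_le _)))
  have hjs : ℓ j ≤ sVal t ℓ :=
    (hmono (Fin.le_def.2 (by have := j.isLt; simp only; omega))).trans hts
  generalize sVal t ℓ = s at *
  let H : SimpleGraph (Fin s) :=
    { Adj := fun u v => u ≠ v ∧ c s(u, v) ≠ j
      symm := ⟨fun u v h => ⟨h.1.symm, by rw [Sym2.eq_swap]; exact h.2⟩⟩
      loopless := ⟨fun u h => h.1 rfl⟩ }
  have hdeg : ∀ y, Hᶜ.degree y ≤ H.degree x := by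
    intro y
    have h₁ : Hᶜ.degree y = colourDeg s t c y j := by
      rw [← SimpleGraph.card_neighborFinset_eq_degree, colourDeg]
      congr 1
      ext w
      simp only [SimpleGraph.mem_neighborFinset, SimpleGraph.compl_adj, Finset.mem_filter,
        Finset.mem_univ, true_and, H]
      grind
    have h₂ : colourDeg s t c x i ≤ H.degree x := by
      rw [← SimpleGraph.card_neighborFinset_eq_degree, colourDeg]
      refine Finset.card_le_card fun w hw => ?_
      simp only [Finset.mem_filter, Finset.mem_univ, true_and] at hw
      rw [SimpleGraph.mem_neighborFinset]
      exact ⟨hw.1.symm, by rw [hw.2]; exact hji.symm⟩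
    exact h₁ ▸ (hmax y j).trans h₂
  have hnd : (List.ofFn P).Nodup := List.nodup_ofFn.2 hPinj
  have hx : x ∉ List.ofFn P := by
    rw [List.mem_ofFn]
    rintro ⟨k, hk⟩
    exact hPx k hk
  have hchain : (List.ofFn P).IsChain H.Adj := by
    rw [List.isChain_iff_getElem]
    intro k hk
    rw [List.length_ofFn] at hk
    rw [List.getElem_ofFn, List.getElem_ofFn]
    exact ⟨fun h => by simpa using hPinj h, hPc k hk⟩
  obtain ⟨z, hz⟩ : ∃ z, z ∉ insert x (List.ofFn P).toFinset := by
    by_contra! hall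
    have h₁ := Finset.card_le_card fun (z : Fin s) (_ : z ∈ Finset.univ) => hall z
    have h₂ := Finset.card_insert_le x (List.ofFn P).toFinset
    have h₃ := (List.ofFn P).toFinset_card_le
    rw [Finset.card_univ, Fintype.card_fin] at h₁
    rw [List.length_ofFn] at h₃
    omega
  rw [Finset.mem_insert, List.mem_toFinset, not_or] at hz
  obtain ⟨Q, hQnd, hQ, hQl⟩ := H.exists_path_length_add_two
    (List.ne_nil_of_length_pos (by rw [List.length_ofFn]; omega)) hnd hchain hx hz.2 hz.1 hdeg
  rw [List.length_ofFn, Nat.sub_add_cancel (by omega)] at hQl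
  refine ⟨j, fun k => Q[k], fun a b hab => ?_, fun k hk => ?_⟩
  · exact Fin.ext ((List.Nodup.getElem_inj_iff hQnd).1 hab)
  · exact (List.isChain_iff_getElem.1 hQ k (by omega)).2
end

section
/- Let G be a graph whose vertex set is partitioned into three sets A, B, C such that B is an independent set in G and there are no edges of G between A and B (so every edge incident to a vertex of B goes to C). Then every path in G has at most max(1, |A|) + 2|C| vertices. -/
/-- Along a walk, vertices of an independent set `B` whose neighbours all lie in `C` are separated
by vertices of `C`; a visit to `A` saves one vertex of `B`. -/
theorem SimpleGraph.Walk.countP_support_le {V : Type*} [DecidableEq V] {G : SimpleGraph V}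
    {A B C : Finset V}
    (hcover : ∀ v : V, v ∈ A ∨ v ∈ B ∨ v ∈ C)
    (hAB : Disjoint A B) (hAC : Disjoint A C) (hBC : Disjoint B C)
    (hBindep : ∀ u ∈ B, ∀ v ∈ B, ¬ G.Adj u v)
    (hABedge : ∀ u ∈ A, ∀ v ∈ B, ¬ G.Adj u v) {u v : V} (p : G.Walk u v) :
    p.length + 1 = p.support.countP (· ∈ A) + p.support.countP (· ∈ B) +
      p.support.countP (· ∈ C) ∧
    p.support.countP (· ∈ B) ≤ p.support.countP (· ∈ C) + 1 ∧
    (u ∉ B → p.support.countP (· ∈ B) ≤ p.support.countP (· ∈ C)) ∧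
    (0 < p.support.countP (· ∈ A) → p.support.countP (· ∈ B) ≤ p.support.countP (· ∈ C)) ∧
    (u ∈ C → 0 < p.support.countP (· ∈ A) →
      p.support.countP (· ∈ B) + 1 ≤ p.support.countP (· ∈ C)) := by
  rw [Finset.disjoint_left] at hAB hAC hBC
  induction p with
  | @nil w =>
    have hw := hcover w
    have h₁ := @hAB w
    have h₂ := @hAC w
    have h₃ := @hBC w
    by_cases hA : w ∈ A <;> by_cases hB : w ∈ B <;> by_cases hC : w ∈ C <;>
      simp_all
  | @cons w x y h p ih =>
    have hw := hcover w
    have hx := hcover x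
    have h₁ := @hAB w
    have h₂ := @hAC w
    have h₃ := @hBC w
    have hwx : w ∈ B → x ∉ B := fun hw hx => hBindep w hw x hx h
    have hwx' : w ∈ A → x ∉ B := fun hw hx => hABedge w hw x hx h
    have hxw : x ∈ A → w ∉ B := fun hx hw => hABedge x hx w hw h.symm
    simp only [SimpleGraph.Walk.length_cons, SimpleGraph.Walk.support_cons, List.countP_cons,
      decide_eq_true_eq]
    grind

/-- A list without repetitions has at most `s.card` entries in the finset `s`. -/
theorem List.Nodup.countP_mem_le_card {α : Type*} [DecidableEq α] {l : List α} (hl : l.Nodup)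
    (s : Finset α) : l.countP (· ∈ s) ≤ s.card := by
  rw [List.countP_eq_length_filter, ← List.toFinset_card_of_nodup (hl.filter _)]
  exact Finset.card_le_card fun x hx => by simpa using (List.mem_filter.1 (List.mem_toFinset.1 hx)).2

/-- If the vertex set of a graph `G` is partitioned into sets `A`, `B`, `C` such that `B` is
independent and there are no edges between `A` and `B`, then every path in `G` has at most
`max(1, |A|) + 2|C|` vertices. -/
theorem path_order_bound {V : Type*} [Fintype V] [DecidableEq V] (G : SimpleGraph V)
    (A B C : Finset V)
    (hcover : ∀ v : V, v ∈ A ∨ v ∈ B ∨ v ∈ C)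
    (hAB : Disjoint A B) (hAC : Disjoint A C) (hBC : Disjoint B C)
    (hBindep : ∀ u ∈ B, ∀ v ∈ B, ¬ G.Adj u v)
    (hABedge : ∀ u ∈ A, ∀ v ∈ B, ¬ G.Adj u v) :
    ∀ (u v : V) (p : G.Walk u v), p.IsPath → p.length + 1 ≤ max 1 A.card + 2 * C.card := by
  intro u v p hp
  obtain ⟨hlen, hB, -, hA, -⟩ :=
    p.countP_support_le hcover hAB hAC hBC hBindep hABedge
  have hcA := hp.support_nodup.countP_mem_le_card A
  have hcC := hp.support_nodup.countP_mem_le_card C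
  omega
end
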